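/- Theorem 1.6 (trichotomy of universal learning rates): Let 𝒳 be a Polish space and let ℋ be a measurable concept class with |ℋ| ≥ 3. Then exactly one of the following holds: (i) ℋ is learnable with optimal rate R(n) = e^{-n}; (ii) ℋ is learnable with optimal rate R(n) = 1/max(n,1); (iii) ℋ requires arbitrarily slow rates. -/

import Mathlib

open scoped ENNReal

/-- A function is universally measurable if it is measurable with respect to (the completion of)
every Borel probability measure on its domain. -/
def UniversallyMeasurable {α β : Type*} [MeasurableSpace α] [MeasurableSpace β] (f : α → β) : Prop :=
  ∀ μ : MeasureTheory.Measure α, MeasureTheory.IsProbabilityMeasure μ →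
    MeasureTheory.NullMeasurable f μ

variable {𝒳 : Type*}

/-- The error of a classifier `h` under distribution `P` on `𝒳 × {0,1}`. -/
noncomputable def errP [MeasurableSpace 𝒳] (P : MeasureTheory.Measure (𝒳 × Bool))
    (h : 𝒳 → Bool) : ℝ≥0∞ :=
  P {p : 𝒳 × Bool | h p.1 ≠ p.2}

/-- `P` is realizable w.r.t. the concept class `ℋ`: `inf_{h ∈ ℋ} er_P(h) = 0`. -/
def Realizable [MeasurableSpace 𝒳] (ℋ : Set (𝒳 → Bool))
    (P : MeasureTheory.Measure (𝒳 × Bool)) : Prop :=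
  (⨅ h ∈ ℋ, errP P h) = 0

/-- A learning algorithm: a sequence of universally measurable maps
`H_n : (𝒳 × {0,1})^n × 𝒳 → {0,1}`. -/
structure LearningAlgorithm (𝒳 : Type*) [MeasurableSpace 𝒳] where
  H : ∀ n : ℕ, (Fin n → 𝒳 × Bool) → 𝒳 → Bool
  meas : ∀ n : ℕ, UniversallyMeasurable fun q : (Fin n → 𝒳 × Bool) × 𝒳 => H n q.1 q.2

/-- Expected error `E[er_P(ĥ_n)]` of the output of a learning algorithm on an i.i.d. sample of
size `n` from `P`, i.e. integration with respect to `P^{⊗n}`. -/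
noncomputable def expErr [MeasurableSpace 𝒳] (P : MeasureTheory.Measure (𝒳 × Bool))
    (A : LearningAlgorithm 𝒳) (n : ℕ) : ℝ≥0∞ :=
  MeasureTheory.lintegral (MeasureTheory.Measure.pi fun _ : Fin n => P)
    fun s => errP P (A.H n s)

/-- A rate function: `R : ℕ → [0,1]` with `R(n) → 0`. -/
def IsRate (R : ℕ → ℝ) : Prop :=
  (∀ n, R n ∈ Set.Icc (0 : ℝ) 1) ∧ Filter.Tendsto R Filter.atTop (nhds 0)

/-- `ℋ` is learnable at rate `R`. -/
def LearnableAtRate [MeasurableSpace 𝒳] (ℋ : Set (𝒳 → Bool)) (R : ℕ → ℝ) : Prop :=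
  ∃ A : LearningAlgorithm 𝒳,
    ∀ P : MeasureTheory.Measure (𝒳 × Bool),
      MeasureTheory.IsProbabilityMeasure P → Realizable ℋ P →
        ∃ C > (0 : ℝ), ∃ c > (0 : ℝ), ∀ n : ℕ,
          expErr P A n ≤ ENNReal.ofReal (C * R ⌈c * (n : ℝ)⌉₊)

/-- `ℋ` is not learnable at rate faster than `R`. -/
def NotLearnableFasterThan [MeasurableSpace 𝒳] (ℋ : Set (𝒳 → Bool)) (R : ℕ → ℝ) : Prop :=
  ∀ A : LearningAlgorithm 𝒳,
    ∃ P : MeasureTheory.Measure (𝒳 × Bool),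
      MeasureTheory.IsProbabilityMeasure P ∧ Realizable ℋ P ∧
        ∃ C > (0 : ℝ), ∃ c > (0 : ℝ),
          {n : ℕ | ENNReal.ofReal (C * R ⌈c * (n : ℝ)⌉₊) ≤ expErr P A n}.Infinite

/-- `ℋ` is learnable with optimal rate `R`. -/
def LearnableWithOptimalRate [MeasurableSpace 𝒳] (ℋ : Set (𝒳 → Bool)) (R : ℕ → ℝ) : Prop :=
  LearnableAtRate ℋ R ∧ NotLearnableFasterThan ℋ R

/-- `ℋ` requires arbitrarily slow rates. -/
def RequiresArbitrarilySlowRates [MeasurableSpace 𝒳] (ℋ : Set (𝒳 → Bool)) : Prop :=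
  ∀ R : ℕ → ℝ, IsRate R → NotLearnableFasterThan ℋ R

/-- Witness that `ℋ` is a measurable class: it is parameterized by a Polish space `Θ` via a
Borel measurable map `𝗁 : Θ × 𝒳 → {0,1}`. -/
structure MeasurableClassWitness (𝒳 : Type*) [MeasurableSpace 𝒳] (ℋ : Set (𝒳 → Bool)) where
  Θ : Type
  [tΘ : TopologicalSpace Θ]
  [mΘ : MeasurableSpace Θ]
  [polish : PolishSpace Θ]
  [borel : BorelSpace Θ]
  f : Θ → 𝒳 → Bool
  meas : Measurable (Function.uncurry f)
  range_eq : ℋ = Set.range f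

/-- `ℋ` is a measurable class (image admissible Suslin). -/
def MeasurableClass (𝒳 : Type*) [MeasurableSpace 𝒳] (ℋ : Set (𝒳 → Bool)) : Prop :=
  Nonempty (MeasurableClassWitness 𝒳 ℋ)

/-- `ℋ` has an infinite Littlestone tree: nodes are indexed by finite binary strings, and every
finite branch is consistent with some concept in `ℋ`. -/
def HasInfiniteLittlestoneTree (ℋ : Set (𝒳 → Bool)) : Prop :=
  ∃ x : List Bool → 𝒳, ∀ (y : ℕ → Bool) (n : ℕ),
    ∃ h ∈ ℋ, ∀ k ≤ n, h (x (List.ofFn fun i : Fin k => y i)) = y k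

/-- `ℋ` has an infinite VCL tree: the node at depth `k` along a branch is a `(k+1)`-tuple of
points, edges out of it are labelled by `{0,1}^{k+1}`, and every finite branch is consistent
with some concept in `ℋ`. -/
def HasInfiniteVCLTree (ℋ : Set (𝒳 → Bool)) : Prop :=
  ∃ x : ∀ k : ℕ, (∀ j : Fin k, Fin (j.val + 1) → Bool) → Fin (k + 1) → 𝒳,
    ∀ (y : ∀ k : ℕ, Fin (k + 1) → Bool) (n : ℕ),
      ∃ h ∈ ℋ, ∀ k ≤ n, ∀ i : Fin (k + 1),
        h (x k (fun j => y j.val) i) = y k i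

namespace UniversalLearning

open MeasureTheory Set Filter Topology

section UniversalSigmaAlgebra

variable {α β γ : Type*} [MeasurableSpace α] [MeasurableSpace β] [MeasurableSpace γ]

/-- The σ-algebra of universally measurable sets. -/
@[reducible] def univMS : MeasurableSpace α where
  MeasurableSet' s := ∀ μ : Measure α, IsProbabilityMeasure μ → NullMeasurableSet s μ
  measurableSet_empty _ _ := nullMeasurableSet_empty
  measurableSet_compl _ hs μ hμ := (hs μ hμ).compl
  measurableSet_iUnion _ hf μ hμ := NullMeasurableSet.iUnion fun i => hf i μ hμ

theorem measurableSet_univMS_iff {s : Set α} : MeasurableSet[univMS] s ↔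
    ∀ μ : Measure α, IsProbabilityMeasure μ → NullMeasurableSet s μ := Iff.rfl

theorem universallyMeasurable_iff {f : α → β} :
    UniversallyMeasurable f ↔ Measurable[univMS] f :=
  ⟨fun h _ hs μ hμ => h μ hμ hs, fun h μ hμ _ hs => h hs μ hμ⟩

theorem measurable_univMS {f : α → β} (hf : Measurable f) : Measurable[univMS] f :=
  fun _ hs _ _ => (hf hs).nullMeasurableSet

/-- A universally measurable map stays measurable when the target is enlarged to its universally
measurable sets. -/
theorem measurable_univMS_univMS {f : α → β} (hf : Measurable[univMS] f) :
    Measurable[univMS, univMS] f := by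
  intro s hs μ hμ
  have hfn : NullMeasurable f μ := fun t ht => hf ht μ hμ
  let ν : Measure β := @Measure.map (NullMeasurableSpace α μ) β _ _ f μ.completion
  have hfm : @Measurable (NullMeasurableSpace α μ) β _ _ f := hfn
  have hν : ∀ t, MeasurableSet t → ν t = μ (f ⁻¹' t) := fun t ht =>
    (Measure.map_apply hfm ht).trans (μ.completion_apply _)
  have hνp : IsProbabilityMeasure ν := ⟨by rw [hν _ MeasurableSet.univ]; simp⟩
  have hsn : NullMeasurableSet s ν := measurableSet_univMS_iff.1 hs ν hνp
  obtain ⟨t, hts, htm, hte⟩ := hsn.exists_measurable_subset_ae_eq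
  obtain ⟨u, hsu, hum, hue⟩ := hsn.exists_measurable_superset_ae_eq
  have h0 : μ (f ⁻¹' (u \ t)) = 0 := by
    rw [← hν _ (hum.diff htm)]
    exact (ae_le_set.1 (hue.trans hte.symm).le)
  refine (hfn htm).congr ?_
  refine (ae_eq_set (μ := μ)).2 ⟨?_, ?_⟩
  · rw [sdiff_eq_empty.2 (preimage_mono hts)]; simp
  · refine measure_mono_null ?_ h0
    rintro x ⟨hx1, hx2⟩
    exact ⟨hsu hx1, hx2⟩

theorem measurable_univMS_comp {g : β → γ} {f : α → β} (hg : Measurable[univMS] g)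
    (hf : Measurable[univMS] f) : Measurable[univMS] (fun x => g (f x)) :=
  @Measurable.comp _ _ _ univMS univMS _ _ _ hg (measurable_univMS_univMS hf)

end UniversalSigmaAlgebra

section Analytic

variable {α : Type*} [TopologicalSpace α] [PolishSpace α] [MeasurableSpace α] [BorelSpace α]

theorem exists_compact_subset_range {f : (ℕ → ℕ) → α} (hf : Continuous f) (μ : Measure α)
    [IsFiniteMeasure μ] {r : ℝ≥0∞} (hr : r < μ (range f)) :
    ∃ K ⊆ range f, IsCompact K ∧ r ≤ μ K := by
  have key : ∀ (s : Set (ℕ → ℕ)) (n : ℕ), r < μ (f '' s) →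
      ∃ a : ℕ, r < μ (f '' (s ∩ {x | x n ≤ a})) := by
    intro s n hs
    have hU : f '' s = ⋃ a : ℕ, f '' (s ∩ {x | x n ≤ a}) := by
      rw [← image_iUnion, ← inter_iUnion]
      congr 1
      ext x
      simp only [mem_inter_iff, mem_iUnion, mem_ofPred_eq]
      exact ⟨fun h => ⟨h, x n, le_rfl⟩, fun h => h.1⟩
    have hm : Monotone fun a : ℕ => f '' (s ∩ {x | x n ≤ a}) := by
      intro a b hab
      refine image_mono (inter_subset_inter_right _ ?_)
      intro x hx
      exact le_trans hx hab
    rw [hU, hm.measure_iUnion] at hs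
    exact lt_iSup_iff.1 hs
  choose A hA using fun (s : Set (ℕ → ℕ)) (n : ℕ) => (show ∃ a : ℕ, r < μ (f '' s) →
    r < μ (f '' (s ∩ {x | x n ≤ a})) by
      by_cases h : r < μ (f '' s)
      · exact (key s n h).imp fun a ha _ => ha
      · exact ⟨0, fun h' => absurd h' h⟩)
  let S : ℕ → Set (ℕ → ℕ) := fun n =>
    Nat.rec univ (fun n s => s ∩ {x | x n ≤ A s n}) n
  have hS : ∀ n, r < μ (f '' S n) := by
    intro n
    induction n with
    | zero => simpa [S] using hr
    | succ n ih => exact hA _ _ ih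
  let a : ℕ → ℕ := fun n => A (S n) n
  have hSmem : ∀ n x, x ∈ S n ↔ ∀ i < n, x i ≤ a i := by
    intro n x
    induction n with
    | zero => simp [S]
    | succ n ih =>
      have : S (n + 1) = S n ∩ {x | x n ≤ a n} := rfl
      rw [this, mem_inter_iff, ih]
      constructor
      · rintro ⟨h1, h2⟩ i hi
        rcases Nat.lt_succ_iff_lt_or_eq.1 hi with h | rfl
        exacts [h1 i h, h2]
      · exact fun h => ⟨fun i hi => h i (by omega), h n (by omega)⟩
  let B : Set (ℕ → ℕ) := univ.pi fun n => Iic (a n)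
  have hB : IsCompact B := isCompact_univ_pi fun n => (finite_Iic (a n)).isCompact
  refine ⟨f '' B, image_subset_range _ _, hB.image hf, ?_⟩
  rw [Set.measure_eq_iInf_isOpen]
  refine le_iInf₂ fun U hU => le_iInf fun hUo => ?_
  obtain ⟨n, hn⟩ : ∃ n, f '' S n ⊆ U := by
    by_contra! hcon
    have : ∀ n, ∃ x ∈ S n, f x ∉ U := by
      intro n
      obtain ⟨_, ⟨x, hx, rfl⟩, hxU⟩ := not_subset.1 (hcon n)
      exact ⟨x, hx, hxU⟩
    choose x hx hxU using this
    obtain ⟨z, hz, φ, hφ, hlim⟩ := hB.tendsto_subseq (x := fun n i => min (x n i) (a i))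
      (fun n i _ => mem_Iic.2 (min_le_right _ _))
    have hlim' : Tendsto (x ∘ φ) atTop (𝓝 z) := by
      rw [tendsto_pi_nhds] at hlim ⊢
      intro i
      refine (hlim i).congr' ?_
      filter_upwards [eventually_gt_atTop i] with n hn
      exact min_eq_left ((hSmem _ _).1 (hx (φ n)) i (hn.trans_le (hφ.id_le n)))
    have hev := ((hf.tendsto z).comp hlim').eventually (hUo.mem_nhds (hU ⟨z, hz, rfl⟩))
    obtain ⟨n, hn⟩ := hev.exists
    exact hxU _ hn
  exact (hS n).le.trans (measure_mono hn)

theorem _root_.MeasureTheory.AnalyticSet.nullMeasurableSet {s : Set α} (hs : AnalyticSet s)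
    (μ : Measure α) [IsFiniteMeasure μ] : NullMeasurableSet s μ := by
  rw [AnalyticSet] at hs
  rcases hs with rfl | ⟨f, hf, rfl⟩
  · exact nullMeasurableSet_empty
  rcases eq_or_ne (μ (range f)) 0 with h0 | h0
  · exact .of_null h0
  obtain ⟨u, -, hu, hlim⟩ := exists_seq_strictMono_tendsto' (pos_iff_ne_zero.2 h0)
  choose K hKs hKc hK using fun n => exists_compact_subset_range hf μ (hu n).2
  have hm : MeasurableSet (⋃ n, K n) := .iUnion fun n => (hKc n).measurableSet
  have hle : μ (range f) ≤ μ (⋃ n, K n) :=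
    le_of_tendsto' hlim fun n => (hK n).trans (measure_mono (subset_iUnion _ n))
  have hsub : ⋃ n, K n ⊆ range f := iUnion_subset hKs
  refine hm.nullMeasurableSet.congr ?_
  exact ae_eq_of_subset_of_measure_ge hsub hle hm.nullMeasurableSet (measure_ne_top _ _)

theorem _root_.MeasureTheory.AnalyticSet.measurableSet_univMS {s : Set α} (hs : AnalyticSet s) :
    MeasurableSet[univMS] s := fun μ _ => hs.nullMeasurableSet μ

end Analytic

/-- A form of the Kunen–Martin theorem: the rank of an analytic well-founded relation is bounded
by that of a well-founded relation on a countable type. -/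
theorem exists_countable_wellFounded {E : Type*} [TopologicalSpace E] [T2Space E]
    {R : E → E → Prop} (hR : AnalyticSet {q : E × E | R q.1 q.2})
    (hwf : ¬ ∃ e : ℕ → E, ∀ n, R (e (n + 1)) (e n)) :
    ∃ (S : Type) (_ : Countable S) (r : S → S → Prop), WellFounded r ∧
      ∀ B : S → Set E, (∀ s s', r s' s → ∀ e ∈ B s, ∃ e' ∈ B s', R e' e) →
        ∀ e, ∃ s, e ∉ B s := by
  rw [AnalyticSet] at hR
  rcases hR with hR | ⟨F, hF, hFR⟩
  · refine ⟨Bool, inferInstance, fun a b => a < b, wellFounded_lt, fun B hB e => ?_⟩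
    by_contra! h
    obtain ⟨e', -, h'⟩ := hB true false (by decide) e (h true)
    have : (e', e) ∈ {q : E × E | R q.1 q.2} := h'
    rw [hR] at this
    exact this
  have hFR' : ∀ v, R (F v).1 (F v).2 := fun v => by
    have : F v ∈ {q : E × E | R q.1 q.2} := hFR ▸ mem_range_self v
    exact this
  have hRF : ∀ e' e, R e' e → ∃ v, F v = (e', e) := fun e' e h => by
    have : (e', e) ∈ range F := hFR ▸ h
    exact this
  let T : Type := Σ l : ℕ, (Fin l → Fin l → ℕ)
  let apx : (ℕ → ℕ → ℕ) → ℕ → T := fun v l => ⟨l, fun i j => v i j⟩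
  have hapx : ∀ v v' l l', apx v l = apx v' l' →
      l = l' ∧ ∀ i < l, ∀ j < l, v i j = v' i j := by
    intro v v' l l' h
    obtain rfl : l = l' := congrArg Sigma.fst h
    refine ⟨rfl, fun i hi j hj => ?_⟩
    have := eq_of_heq (Sigma.mk.inj h).2
    exact congrFun (congrFun this ⟨i, hi⟩) ⟨j, hj⟩
  let chain : (ℕ → ℕ → ℕ) → ℕ → Prop := fun v l =>
    ∀ i, i + 1 < l → (F (v i)).1 = (F (v (i + 1))).2
  let rT : T → T → Prop := fun t' t => ∃ v l, chain v (l + 1) ∧ t' = apx v (l + 1) ∧ t = apx v l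
  have hrT : WellFounded rT := by
    rw [wellFounded_iff_isEmpty_descending_chain]
    refine ⟨fun ⟨t, ht⟩ => hwf ?_⟩
    choose v l hc h1 h2 using ht
    have hl : ∀ n, l (n + 1) = l n + 1 := fun n =>
      (hapx _ _ _ _ ((h2 (n + 1)).symm.trans (h1 n))).1
    have hle : ∀ n, n ≤ l n := fun n => by
      induction n with
      | zero => exact Nat.zero_le _
      | succ n ih => rw [hl]; omega
    have hv : ∀ n, ∀ i ≤ l n, ∀ j ≤ l n, v (n + 1) i j = v n i j := fun n i hi j hj =>
      (hapx _ _ _ _ ((h2 (n + 1)).symm.trans (h1 n))).2 i (by rw [hl]; omega) j (by rw [hl]; omega)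
    have hstab : ∀ i j n, max i j ≤ n → v n i j = v (max i j) i j := by
      intro i j n hn
      induction n, hn using Nat.le_induction with
      | base => rfl
      | succ n hn ih =>
        rw [← ih]
        have := hle n
        exact hv n i (by omega) j (by omega)
    let w : ℕ → ℕ → ℕ := fun i j => v (max i j) i j
    have hlim : ∀ i, Tendsto (fun n => v n i) atTop (𝓝 (w i)) := by
      intro i
      rw [tendsto_pi_nhds]
      intro j
      refine tendsto_const_nhds.congr' ?_
      filter_upwards [eventually_ge_atTop (max i j)] with n hn
      exact (hstab i j n hn).symm
    have hw : ∀ i, (F (w i)).1 = (F (w (i + 1))).2 := by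
      intro i
      have a1 := (continuous_fst.tendsto _).comp ((hF.tendsto _).comp (hlim i))
      have a2 := (continuous_snd.tendsto _).comp ((hF.tendsto _).comp (hlim (i + 1)))
      refine tendsto_nhds_unique a1 (a2.congr' ?_)
      filter_upwards [eventually_ge_atTop (i + 1)] with n hn
      exact (hc n i (by have := hle n; omega)).symm
    refine ⟨fun n => (F (w n)).2, fun n => ?_⟩
    have := hFR' (w n)
    rwa [hw n] at this
  let t0 : T := apx 0 0
  let r : Option T → Option T → Prop := fun s' s =>
    ∃ t', s' = some t' ∧ ((s = none ∧ t' = t0) ∨ ∃ t, s = some t ∧ rT t' t)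
  have hacc : ∀ t, Acc r (some t) := by
    intro t
    induction t using hrT.induction with
    | _ t ih =>
      refine ⟨_, fun s' hs' => ?_⟩
      obtain ⟨t', rfl, ⟨h, -⟩ | ⟨t1, h1, h2⟩⟩ := hs'
      · simp at h
      · obtain rfl := Option.some.inj h1
        exact ih _ h2
  refine ⟨Option T, inferInstance, r, ⟨fun s => ?_⟩, fun B hB e => ?_⟩
  · rcases s with _ | t
    · refine ⟨_, fun s' hs' => ?_⟩
      obtain ⟨t', rfl, -⟩ := hs'
      exact hacc _
    · exact hacc t
  · have claim : ∀ t : T, ∀ v l, t = apx v l → chain v l →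
        ∀ e, (∀ k, l = k + 1 → e = (F (v k)).1) → ¬ ∃ e' ∈ B (some t), R e' e := by
      intro t
      induction t using hrT.induction with
      | _ t ih =>
        rintro v l rfl hch e he ⟨e', he', hRe⟩
        obtain ⟨u, hu⟩ := hRF _ _ hRe
        let v' := Function.update v l u
        have hv' : ∀ i < l, v' i = v i := fun i hi => Function.update_of_ne hi.ne _ _
        have hv'l : v' l = u := Function.update_self _ _ _
        have hch' : chain v' (l + 1) := by
          intro i hi
          rcases Nat.lt_succ_iff_lt_or_eq.1 hi with h | h
          · rw [hv' i (by omega), hv' _ h]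
            exact hch i h
          · rw [hv' i (by omega), h, hv'l, hu]
            exact (he i h.symm).symm
        have happ : apx v l = apx v' l := by
          simp only [apx]
          congr 1
          funext i j
          rw [hv' i i.2]
        have hr : rT (apx v' (l + 1)) (apx v l) := ⟨v', l, hch', rfl, happ⟩
        obtain ⟨e'', he'', hR''⟩ := hB (some (apx v l)) (some (apx v' (l + 1)))
          ⟨_, rfl, Or.inr ⟨_, rfl, hr⟩⟩ e' he'
        refine ih _ hr v' (l + 1) rfl hch' e' ?_ ⟨e'', he'', hR''⟩
        rintro k hk
        obtain rfl : l = k := by omega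
        rw [hv'l, hu]
    by_contra! h
    refine claim t0 0 0 rfl (fun i hi => by omega) e (fun k hk => by omega) ?_
    exact hB none (some t0) ⟨_, rfl, Or.inl ⟨rfl, rfl⟩⟩ e (h none)

section Game

variable {𝒳 Θ : Type*}

/-- The first `k` rows of a history, row `j` cut to its first `m j` examples, are consistent with
some parameter. -/
def Consistent (f : Θ → 𝒳 → Bool) (m : ℕ → ℕ) (k : ℕ) (p : ℕ → ℕ → 𝒳 × Bool) : Prop :=
  ∃ θ, ∀ j < k, ∀ i < m j, f θ (p j i).1 = (p j i).2

/-- An infinite tree whose nodes at depth `k` are `m k`-tuples of points, with children indexed by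
codes of label vectors, all of whose finite branches are consistent. -/
def HasTree (f : Θ → 𝒳 → Bool) (m : ℕ → ℕ) : Prop :=
  ∃ x : List ℕ → ℕ → 𝒳, ∀ l : List ℕ, ∃ θ, ∀ k < l.length, ∀ i < m k,
    f θ (x (l.take k) i) = (l.getD k 0).testBit i

theorem analyticSet_exists {α β : Type*} [TopologicalSpace α] [PolishSpace α] [MeasurableSpace α]
    [BorelSpace α] [TopologicalSpace β] [PolishSpace β] [MeasurableSpace β] [BorelSpace β]
    {p : α → β → Prop} (h : MeasurableSet {q : α × β | p q.1 q.2}) :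
    AnalyticSet {a | ∃ b, p a b} := by
  have := h.analyticSet.image_of_continuous continuous_fst
  convert this using 1
  ext a
  simp

theorem analyticSet_consistent [TopologicalSpace 𝒳] [PolishSpace 𝒳] [MeasurableSpace 𝒳]
    [BorelSpace 𝒳] [TopologicalSpace Θ] [PolishSpace Θ] [MeasurableSpace Θ] [BorelSpace Θ]
    {f : Θ → 𝒳 → Bool} {m : ℕ → ℕ} (hf : Measurable (Function.uncurry f)) (k : ℕ) :
    AnalyticSet {p : ℕ → ℕ → 𝒳 × Bool | Consistent f m k p} := by
  refine analyticSet_exists (p := fun (p : ℕ → ℕ → 𝒳 × Bool) θ =>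
    ∀ j < k, ∀ i < m j, f θ (p j i).1 = (p j i).2) ?_
  have h1 : ∀ j i, MeasurableSet {q : (ℕ → ℕ → 𝒳 × Bool) × Θ |
      f q.2 (q.1 j i).1 = (q.1 j i).2} := by
    intro j i
    have hm : Measurable fun q : (ℕ → ℕ → 𝒳 × Bool) × Θ => q.1 j i := by fun_prop
    exact measurableSet_eq_fun (hf.comp (measurable_snd.prodMk hm.fst)) hm.snd
  simp only [measurableSet_setOfPred] at h1 ⊢
  exact .forall fun j => .imp measurable_const (.forall fun i => .imp measurable_const (h1 j i))

variable [Inhabited 𝒳]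

/-- Write the row of points `x` labelled by the bits of `c` as row `k` of the history `p`. -/
def extend (m : ℕ → ℕ) (k : ℕ) (p : ℕ → ℕ → 𝒳 × Bool) (x : ℕ → 𝒳) (c : ℕ) :
    ℕ → ℕ → 𝒳 × Bool :=
  Function.update p k fun i => if i < m k then (x i, c.testBit i) else default

/-- Positions of the game from which the player presenting points loses within `s` more moves,
where `s` lies in a relation `r`. -/
inductive Lost (f : Θ → 𝒳 → Bool) (m : ℕ → ℕ) {S : Type} (r : S → S → Prop) :
    S → ℕ → (ℕ → ℕ → 𝒳 × Bool) → Prop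
  | dead (s : S) (k : ℕ) (p : ℕ → ℕ → 𝒳 × Bool) (h : ¬ Consistent f m k p) : Lost f m r s k p
  | step (s s' : S) (k : ℕ) (p : ℕ → ℕ → 𝒳 × Bool) (hr : r s' s) (c : (ℕ → 𝒳) → ℕ)
      (h : ∀ x, Lost f m r s' (k + 1) (extend m k p x (c x))) : Lost f m r s k p

variable {f : Θ → 𝒳 → Bool} {m : ℕ → ℕ} {S : Type} {r : S → S → Prop}

theorem not_lost_iff {s : S} {k : ℕ} {p : ℕ → ℕ → 𝒳 × Bool} :
    ¬ Lost f m r s k p ↔ Consistent f m k p ∧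
      ∀ s', r s' s → ∃ x, ∀ c, ¬ Lost f m r s' (k + 1) (extend m k p x c) := by
  constructor
  · intro h
    refine ⟨by_contra fun hc => h (.dead _ _ _ hc), fun s' hs' => ?_⟩
    by_contra! hcon
    choose c hc using hcon
    exact h (.step _ _ _ _ hs' c hc)
  · rintro ⟨h1, h2⟩ h
    cases h with
    | dead _ _ _ h => exact h h1
    | step _ s' _ _ hr c hc =>
      obtain ⟨x, hx⟩ := h2 s' hr
      exact hx _ (hc x)

theorem continuous_extend [TopologicalSpace 𝒳] (k c : ℕ) :
    Continuous fun q : (ℕ → ℕ → 𝒳 × Bool) × (ℕ → 𝒳) => extend m k q.1 q.2 c := by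
  unfold extend
  refine Continuous.update continuous_fst k (continuous_pi fun i => ?_)
  split_ifs <;> fun_prop

theorem Lost.mono [IsWellFounded S r] {s : S} {k : ℕ} {p : ℕ → ℕ → 𝒳 × Bool}
    (h : Lost f m r s k p) {s' : S} (hs : IsWellFounded.rank r s ≤ IsWellFounded.rank r s') :
    Lost f m r s' k p := by
  induction h generalizing s' with
  | dead s k p h => exact .dead _ _ _ h
  | step s s₁ k p hr c _ ih =>
    have h1 : IsWellFounded.rank r s₁ < IsWellFounded.rank r s' :=
      (IsWellFounded.rank_lt_of_rel hr).trans_le hs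
    rw [IsWellFounded.rank_eq (r := r) s', Ordinal.lt_iSup_iff] at h1
    obtain ⟨⟨s₂, h2⟩, h3⟩ := h1
    exact .step _ s₂ _ _ h2 c fun x => ih x (Order.lt_succ_iff.1 h3)

section Analytic

variable [TopologicalSpace 𝒳] [PolishSpace 𝒳] [MeasurableSpace 𝒳] [BorelSpace 𝒳]
  [TopologicalSpace Θ] [PolishSpace Θ] [MeasurableSpace Θ] [BorelSpace Θ]

theorem analyticSet_not_lost [Countable S] (hr : WellFounded r)
    (hf : Measurable (Function.uncurry f)) (s : S) (k : ℕ) :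
    AnalyticSet {p : ℕ → ℕ → 𝒳 × Bool | ¬ Lost f m r s k p} := by
  induction s using hr.induction generalizing k with
  | _ s ih =>
    let A : Option S → Set (ℕ → ℕ → 𝒳 × Bool) := fun o => o.elim {p | Consistent f m k p}
      fun s' => {p | r s' s → ∃ x, ∀ c, ¬ Lost f m r s' (k + 1) (extend m k p x c)}
    have hA : {p : ℕ → ℕ → 𝒳 × Bool | ¬ Lost f m r s k p} = ⋂ o, A o := by
      ext p
      rw [mem_ofPred_eq, not_lost_iff, mem_iInter, Option.forall]
      rfl
    rw [hA]
    refine AnalyticSet.iInter fun o => ?_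
    rcases o with _ | s'
    · exact analyticSet_consistent hf k
    by_cases hs : r s' s
    · have : AnalyticSet (⋂ c : ℕ, (fun q : (ℕ → ℕ → 𝒳 × Bool) × (ℕ → 𝒳) =>
          extend m k q.1 q.2 c) ⁻¹' {p | ¬ Lost f m r s' (k + 1) p}) :=
        AnalyticSet.iInter fun c => (ih s' hs (k + 1)).preimage (continuous_extend k c)
      convert this.image_of_continuous continuous_fst using 1
      ext p
      simp [A, hs]
    · convert (MeasurableSet.univ (α := ℕ → ℕ → 𝒳 × Bool)).analyticSet using 1
      ext p
      simp [A, hs]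

/-- A depth together with a labelling of all nodes. -/
abbrev NodeAssignment (𝒳 : Type*) := ℕ × (List ℕ → ℕ → 𝒳)

theorem exists_lost [Nonempty Θ] (hf : Measurable (Function.uncurry f)) (h : ¬ HasTree f m) :
    ∃ (S : Type) (_ : Countable S) (r : S → S → Prop), WellFounded r ∧
      ∀ p : ℕ → ℕ → 𝒳 × Bool, ∃ s, Lost f m r s 0 p := by
  have hP : PolishSpace (NodeAssignment 𝒳) :=
    inferInstanceAs (PolishSpace (ℕ × (List ℕ → ℕ → 𝒳)))
  have hB : BorelSpace (NodeAssignment 𝒳) :=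
    inferInstanceAs (BorelSpace (ℕ × (List ℕ → ℕ → 𝒳)))
  let R : NodeAssignment 𝒳 → NodeAssignment 𝒳 → Prop := fun e' e => e'.1 = e.1 + 1 ∧
    (∀ l : List ℕ, l.length < e.1 → e'.2 l = e.2 l) ∧
    ∀ l : List ℕ, ∃ θ, l.length = e.1 + 1 → ∀ k < l.length, ∀ i < m k,
      f θ (e'.2 (l.take k) i) = (l.getD k 0).testBit i
  have hR : AnalyticSet {q : NodeAssignment 𝒳 × NodeAssignment 𝒳 | R q.1 q.2} := by
    have h1 : MeasurableSet {q : NodeAssignment 𝒳 × NodeAssignment 𝒳 | q.1.1 = q.2.1 + 1} :=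
      measurableSet_eq_fun (by fun_prop) (by fun_prop)
    have h2 : MeasurableSet {q : NodeAssignment 𝒳 × NodeAssignment 𝒳 |
        ∀ l : List ℕ, l.length < q.2.1 → q.1.2 l = q.2.2 l} := by
      rw [measurableSet_setOfPred]
      refine .forall fun l => .imp ?_ ?_
      · exact measurableSet_setOfPred.1
          (measurableSet_lt measurable_const (by fun_prop))
      · exact measurableSet_setOfPred.1
          (measurableSet_eq_fun (f := fun q : NodeAssignment 𝒳 × NodeAssignment 𝒳 => q.1.2 l)
            (g := fun q : NodeAssignment 𝒳 × NodeAssignment 𝒳 => q.2.2 l)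
            (by fun_prop) (by fun_prop))
    have h3 : ∀ l : List ℕ, AnalyticSet {q : NodeAssignment 𝒳 × NodeAssignment 𝒳 |
        ∃ θ, l.length = q.2.1 + 1 →
        ∀ k < l.length, ∀ i < m k, f θ (q.1.2 (l.take k) i) = (l.getD k 0).testBit i} := by
      intro l
      refine analyticSet_exists (p := fun (q : NodeAssignment 𝒳 × NodeAssignment 𝒳) θ =>
        l.length = q.2.1 + 1 →
        ∀ k < l.length, ∀ i < m k, f θ (q.1.2 (l.take k) i) = (l.getD k 0).testBit i) ?_
      rw [measurableSet_setOfPred]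
      refine .imp ?_ (.forall fun k => .imp measurable_const (.forall fun i =>
        .imp measurable_const ?_))
      · exact measurableSet_setOfPred.1
          (measurableSet_eq_fun measurable_const (by fun_prop))
      · have hm : Measurable fun q : (NodeAssignment 𝒳 × NodeAssignment 𝒳) × Θ =>
            q.1.1.2 (l.take k) i := by fun_prop
        exact measurableSet_setOfPred.1 (measurableSet_eq_fun
          (hf.comp (measurable_snd.prodMk hm)) measurable_const)
    let A : Option (List ℕ) → Set (NodeAssignment 𝒳 × NodeAssignment 𝒳) := fun o => o.elim
      ({q : NodeAssignment 𝒳 × NodeAssignment 𝒳 | q.1.1 = q.2.1 + 1} ∩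
        {q : NodeAssignment 𝒳 × NodeAssignment 𝒳 |
          ∀ l : List ℕ, l.length < q.2.1 → q.1.2 l = q.2.2 l})
      fun l => {q : NodeAssignment 𝒳 × NodeAssignment 𝒳 | ∃ θ, l.length = q.2.1 + 1 →
        ∀ k < l.length, ∀ i < m k, f θ (q.1.2 (l.take k) i) = (l.getD k 0).testBit i}
    have hA : {q : NodeAssignment 𝒳 × NodeAssignment 𝒳 | R q.1 q.2} = ⋂ o, A o := by
      ext q
      rw [mem_iInter, Option.forall]
      exact and_assoc.symm
    rw [hA]
    refine AnalyticSet.iInter fun o => ?_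
    rcases o with _ | l
    · exact (h1.inter h2).analyticSet
    · exact h3 l
  have hwf : ¬ ∃ e : ℕ → NodeAssignment 𝒳, ∀ n, R (e (n + 1)) (e n) := by
    rintro ⟨e, he⟩
    refine h ?_
    have hd : ∀ n, (e n).1 = (e 0).1 + n := by
      intro n
      induction n with
      | zero => rfl
      | succ n ih => rw [(he n).1, ih, add_assoc]
    have hst : ∀ (l : List ℕ) n, l.length + 1 ≤ n → (e n).2 l = (e (l.length + 1)).2 l := by
      intro l n hn
      induction n, hn using Nat.le_induction with
      | base => rfl
      | succ n hn ih => rw [← ih, (he n).2.1 l (by rw [hd]; omega)]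
    refine ⟨fun l => (e (l.length + 1)).2 l, fun l => ?_⟩
    let n := l.length
    let l' := l ++ List.replicate ((e 0).1 + 1) 0
    have hl' : l'.length = (e n).1 + 1 := by
      rw [hd]
      simp [l', n]
      omega
    obtain ⟨θ, hθ⟩ := (he n).2.2 l'
    refine ⟨θ, fun k hk i hi => ?_⟩
    have := hθ hl' k (by rw [hl', hd]; omega) i hi
    rw [show l'.take k = l.take k from List.take_append_of_le_length hk.le,
      show l'.getD k 0 = l.getD k 0 from List.getD_append _ _ _ _ hk] at this
    rw [← this, hst (l.take k) (n + 1) (by simp [n])]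
  obtain ⟨S, hS, r, hr, hB⟩ := exists_countable_wellFounded hR hwf
  refine ⟨S, hS, r, hr, fun p => ?_⟩
  let pos : (List ℕ → ℕ → 𝒳) → List ℕ → ℕ → ℕ → 𝒳 × Bool := fun τ l j => 
    if j < l.length then fun i => if i < m j then (τ (l.take j) i, (l.getD j 0).testBit i)
      else default else p j
  let B : S → Set (NodeAssignment 𝒳) := fun s =>
    {e | ∀ l : List ℕ, l.length = e.1 → ¬ Lost f m r s e.1 (pos e.2 l)}
  have hstep : ∀ s s', r s' s → ∀ e ∈ B s, ∃ e' ∈ B s', R e' e := by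
    rintro s s' hs ⟨d, τ⟩ hτ
    have : ∀ l : List ℕ, ∃ x, l.length = d → ∀ c,
        ¬ Lost f m r s' (d + 1) (extend m d (pos τ l) x c) := by
      intro l
      by_cases hl : l.length = d
      · obtain ⟨x, hx⟩ := (not_lost_iff.1 (hτ l hl)).2 s' hs
        exact ⟨x, fun _ => hx⟩
      · exact ⟨fun _ => default, fun h => absurd h hl⟩
    choose x hx using this
    let τ' : List ℕ → ℕ → 𝒳 := fun l => if l.length < d then τ l else x l
    have hpos : ∀ l : List ℕ, l.length = d + 1 → 
        pos τ' l = extend m d (pos τ (l.take d)) (x (l.take d)) (l.getD d 0) := by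
      intro l hl
      funext j
      rcases lt_trichotomy j d with hj | rfl | hj
      · have h1 : j < d + 1 := by omega
        have h2 : (l.take d).getD j 0 = l.getD j 0 := by simp [List.getD, hj]
        have h3 : (l.take d).take j = l.take j := by rw [List.take_take, min_eq_left hj.le]
        simp only [pos, extend, hl, Function.update_of_ne hj.ne, List.length_take, τ', h1, hj,
          h2, h3, if_true, min_eq_left (Nat.le_succ d), min_eq_left h1.le]
      · simp only [pos, extend, hl, Function.update_self, List.length_take, τ',
          min_eq_left (Nat.le_succ j), lt_irrefl, if_false, Nat.lt_succ_self, if_true]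
      · have h1 : ¬ j < d + 1 := by omega
        simp only [pos, extend, hl, Function.update_of_ne hj.ne', List.length_take, h1,
          min_eq_left (Nat.le_succ d), hj.not_gt, if_false]
    have hnl : ∀ l : List ℕ, l.length = d + 1 → ¬ Lost f m r s' (d + 1) (pos τ' l) := by
      intro l hl
      rw [hpos l hl]
      exact hx _ (by simp [hl]) _
    refine ⟨(d + 1, τ'), hnl, rfl, fun l hl => if_pos hl, fun l => ?_⟩
    by_cases hl : l.length = d + 1
    · obtain ⟨θ, hθ⟩ := (not_lost_iff.1 (hnl l hl)).1
      refine ⟨θ, fun _ k hk i hi => ?_⟩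
      have := hθ k (by omega) i hi
      simpa [pos, hk, hi] using this
    · obtain ⟨θ⟩ := ‹Nonempty Θ›
      exact ⟨θ, fun h => absurd h hl⟩
  obtain ⟨s, hs⟩ := hB B hstep (0, fun _ _ => default)
  simp only [B, mem_ofPred_eq, not_forall, not_not] at hs
  obtain ⟨l, hl, hlost⟩ := hs
  refine ⟨s, ?_⟩
  obtain rfl := List.length_eq_zero_iff.1 hl
  simpa [pos] using hlost

end Analytic

/-- The history row consisting of the first `n` entries of `b`. -/
def trunc (n : ℕ) (b : ℕ → 𝒳 × Bool) : ℕ → 𝒳 × Bool := fun i => if i < n then b i else default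

/-- The strategy `φ` predicts all labels of the row `b` correctly. -/
def Hit (m : ℕ → ℕ) (φ : ℕ → (ℕ → ℕ → 𝒳 × Bool) × (ℕ → 𝒳) → ℕ)
    (st : ℕ × (ℕ → ℕ → 𝒳 × Bool)) (b : ℕ → 𝒳 × Bool) : Prop :=
  ∀ i < m st.1, (φ st.1 (st.2, fun i => (trunc (m st.1) b i).1)).testBit i = (b i).2

open Classical in
/-- Record the row `b` if it is a hit. -/
noncomputable def stepState (m : ℕ → ℕ) (φ : ℕ → (ℕ → ℕ → 𝒳 × Bool) × (ℕ → 𝒳) → ℕ)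
    (st : ℕ × (ℕ → ℕ → 𝒳 × Bool)) (b : ℕ → 𝒳 × Bool) : ℕ × (ℕ → ℕ → 𝒳 × Bool) :=
  if Hit m φ st b then (st.1 + 1, Function.update st.2 st.1 (trunc (m st.1) b)) else st

/-- The state of the game after playing the rows `b 0, …, b (t - 1)`. -/
noncomputable def state (m : ℕ → ℕ) (φ : ℕ → (ℕ → ℕ → 𝒳 × Bool) × (ℕ → 𝒳) → ℕ)
    (b : ℕ → ℕ → 𝒳 × Bool) : ℕ → ℕ × (ℕ → ℕ → 𝒳 × Bool)
  | 0 => (0, fun _ _ => default)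
  | t + 1 => stepState m φ (state m φ b t) (b t)

theorem state_fst_le (φ : ℕ → (ℕ → ℕ → 𝒳 × Bool) × (ℕ → 𝒳) → ℕ) (b : ℕ → ℕ → 𝒳 × Bool) (t : ℕ) :
    (state m φ b t).1 ≤ t := by
  induction t with
  | zero => exact le_rfl
  | succ t ih =>
    rw [state, stepState]
    split_ifs
    · exact Nat.succ_le_succ ih
    · omega

theorem state_rows (φ : ℕ → (ℕ → ℕ → 𝒳 × Bool) × (ℕ → 𝒳) → ℕ) (b : ℕ → ℕ → 𝒳 × Bool) (t : ℕ) :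
    ∀ j < (state m φ b t).1, ∃ t' < t, (state m φ b t).2 j = trunc (m j) (b t') := by
  induction t with
  | zero => exact fun j hj => absurd hj (Nat.not_lt_zero _)
  | succ t ih =>
    intro j hj
    rw [state, stepState] at hj ⊢
    split_ifs at hj ⊢ with h
    · rcases Nat.lt_succ_iff_lt_or_eq.1 hj with h1 | h1
      · obtain ⟨t', ht', h2⟩ := ih j h1
        exact ⟨t', by omega, by simpa [Function.update_of_ne h1.ne] using h2⟩
      · subst h1
        exact ⟨t, by omega, by simp⟩
    · obtain ⟨t', ht', h2⟩ := ih j hj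
      exact ⟨t', by omega, h2⟩

theorem consistent_state (φ : ℕ → (ℕ → ℕ → 𝒳 × Bool) × (ℕ → 𝒳) → ℕ) (b : ℕ → ℕ → 𝒳 × Bool)
    (hb : ∀ K : ℕ, ∃ θ, ∀ j < K, ∀ i < K, f θ (b j i).1 = (b j i).2) (t : ℕ) :
    Consistent f m (state m φ b t).1 (state m φ b t).2 := by
  obtain ⟨θ, hθ⟩ := hb (t + ∑ j ∈ Finset.range t, m j)
  refine ⟨θ, fun j hj i hi => ?_⟩
  obtain ⟨t', ht', h⟩ := state_rows φ b t j hj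
  have hjt := hj.trans_le (state_fst_le φ b t)
  have : m j ≤ ∑ j ∈ Finset.range t, m j :=
    Finset.single_le_sum (f := m) (fun _ _ => Nat.zero_le _) (Finset.mem_range.2 hjt)
  rw [h, trunc, if_pos hi]
  exact hθ _ (by omega) _ (by omega)

/-- If there is no infinite tree, there is a universally measurable strategy that predicts
correctly only finitely often on every consistent sequence of rows. -/
theorem exists_strategy [TopologicalSpace 𝒳] [PolishSpace 𝒳] [MeasurableSpace 𝒳] [BorelSpace 𝒳]
    [TopologicalSpace Θ] [PolishSpace Θ] [MeasurableSpace Θ] [BorelSpace Θ] [Nonempty Θ]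
    (hf : Measurable (Function.uncurry f)) (h : ¬ HasTree f m) :
    ∃ φ : ℕ → (ℕ → ℕ → 𝒳 × Bool) × (ℕ → 𝒳) → ℕ, (∀ k, Measurable[univMS] (φ k)) ∧
      ∀ b : ℕ → ℕ → 𝒳 × Bool,
        (∀ K : ℕ, ∃ θ, ∀ j < K, ∀ i < K, f θ (b j i).1 = (b j i).2) →
        ∃ T, ∀ t ≥ T, state m φ b t = state m φ b T ∧ ¬ Hit m φ (state m φ b t) (b t) := by
  classical
  obtain ⟨S, hS, r, hr, hlost⟩ := exists_lost hf h
  have : IsWellFounded S r := ⟨hr⟩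
  let Q : ℕ → (ℕ → ℕ → 𝒳 × Bool) × (ℕ → 𝒳) → ℕ → Prop := fun k q c =>
    ∃ s, ¬ Lost f m r s k q.1 ∧ Lost f m r s (k + 1) (extend m k q.1 q.2 c)
  let Q' : ℕ → (ℕ → ℕ → 𝒳 × Bool) × (ℕ → 𝒳) → ℕ → Prop := fun k q c =>
    Q k q c ∨ ¬ ∃ c', Q k q c'
  have hQ' : ∀ k q, ∃ c, Q' k q c := by
    intro k q
    by_cases h : ∃ c', Q k q c'
    · exact h.imp fun _ => Or.inl
    · exact ⟨0, Or.inr h⟩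
  have hQm : ∀ k c, MeasurableSet[univMS] {q | Q k q c} := by
    intro k c
    have : {q | Q k q c} = ⋃ s, {q | ¬ Lost f m r s k q.1} ∩
        {q | ¬ Lost f m r s (k + 1) (extend m k q.1 q.2 c)}ᶜ := by
      ext q
      simp [Q]
    rw [this]
    refine MeasurableSet.iUnion fun s => MeasurableSet.inter ?_ (MeasurableSet.compl ?_)
    · exact ((analyticSet_not_lost hr hf s k).preimage continuous_fst).measurableSet_univMS
    · exact ((analyticSet_not_lost hr hf s (k + 1)).preimage
        (continuous_extend k c)).measurableSet_univMS
  have hQm' : ∀ k c, MeasurableSet[univMS] {q | Q' k q c} := by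
    intro k c
    have : {q | Q' k q c} = {q | Q k q c} ∪ (⋃ c', {q | Q k q c'})ᶜ := by
      ext q
      simp [Q']
    rw [this]
    exact MeasurableSet.union (hQm k c) (MeasurableSet.compl (MeasurableSet.iUnion (hQm k)))
  let φ : ℕ → (ℕ → ℕ → 𝒳 × Bool) × (ℕ → 𝒳) → ℕ := fun k q => Nat.find (hQ' k q)
  refine ⟨φ, fun k => @measurable_find _ univMS _ _ (hQ' k) (hQm' k), fun b hb => ?_⟩
  have hφ : ∀ k p x s, Consistent f m k p → Lost f m r s k p → Q k (p, x) (φ k (p, x)) := by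
    intro k p x s hc hs
    obtain ⟨s₀, hs₀, hmin⟩ := hr.has_min {s | Lost f m r s k p} ⟨s, hs⟩
    have hex : ∃ c', Q k (p, x) c' := by
      cases hs₀ with
      | dead _ _ _ h => exact absurd hc h
      | step _ s' _ _ hrs c h =>
        exact ⟨c x, s', fun h' => hmin s' h' hrs, h x⟩
    exact (Nat.find_spec (hQ' k (p, x))).resolve_right (not_not.2 hex)
  have hcons := consistent_state (m := m) φ b hb
  have hstep : ∀ t s, Lost f m r s (state m φ b t).1 (state m φ b t).2 →
      Hit m φ (state m φ b t) (b t) → ∃ s',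
        ¬ Lost f m r s' (state m φ b t).1 (state m φ b t).2 ∧
        Lost f m r s' (state m φ b (t + 1)).1 (state m φ b (t + 1)).2 := by
    intro t s hs hhit
    obtain ⟨s', h1, h2⟩ := hφ _ _ (fun i => (trunc (m (state m φ b t).1) (b t) i).1) s (hcons t) hs
    refine ⟨s', h1, ?_⟩
    rw [state, stepState, if_pos hhit]
    convert h2 using 1
    simp only [extend]
    congr 1
    funext i
    by_cases hi : i < m (state m φ b t).1
    · rw [if_pos hi, hhit i hi]
      simp [trunc, hi]
    · simp [trunc, hi]
  have hall : ∀ t, ∃ s, Lost f m r s (state m φ b t).1 (state m φ b t).2 := by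
    intro t
    induction t with
    | zero => exact hlost _
    | succ t ih =>
      obtain ⟨s, hs⟩ := ih
      by_cases hhit : Hit m φ (state m φ b t) (b t)
      · obtain ⟨s', -, h'⟩ := hstep t s hs hhit
        exact ⟨s', h'⟩
      · exact ⟨s, by rwa [state, stepState, if_neg hhit]⟩
  obtain ⟨s0, hs0⟩ := hall 0
  obtain ⟨s, ⟨T, hT⟩, hmin⟩ := (InvImage.wf (IsWellFounded.rank r) Ordinal.lt_wf).has_min
    {s | ∃ t, Lost f m r s (state m φ b t).1 (state m φ b t).2} ⟨s0, 0, hs0⟩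
  have hmin' : ∀ s' t, Lost f m r s' (state m φ b t).1 (state m φ b t).2 →
      IsWellFounded.rank r s ≤ IsWellFounded.rank r s' := fun s' t h =>
    not_lt.1 (hmin s' ⟨t, h⟩)
  have hno : ∀ t, state m φ b t = state m φ b T → ¬ Hit m φ (state m φ b t) (b t) := by
    intro t ht hhit
    obtain ⟨s', h1, h2⟩ := hstep t s (by rwa [ht]) hhit
    refine h1 (Lost.mono ?_ (hmin' s' _ h2))
    rwa [ht]
  have hst : ∀ t ≥ T, state m φ b t = state m φ b T := by
    intro t ht
    induction t, ht using Nat.le_induction with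
    | base => rfl
    | succ t ht ih => rw [state, stepState, if_neg (hno t ih), ih]
  exact ⟨T, fun t ht => ⟨hst t ht, hno t (hst t ht)⟩⟩

end Game

section Product

variable {α β : Type*} [MeasurableSpace α] [MeasurableSpace β]

theorem measurable_univMS_of_forall {f : α → β}
    (h : ∀ μ : Measure α, IsProbabilityMeasure μ → AEMeasurable f μ) : Measurable[univMS] f :=
  fun _ hs μ hμ => (h μ hμ).nullMeasurable hs

theorem _root_.MeasurableSet.nullMeasurableSet_of_univMS {s : Set α}
    (hs : MeasurableSet[univMS] s) (μ : Measure α) [hμ : IsProbabilityMeasure μ] :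
    NullMeasurableSet s μ := hs μ hμ

theorem prod_apply_univMS {E : Set (α × β)} (hE : MeasurableSet[univMS] E) (μ : Measure α)
    (ν : Measure β) [IsProbabilityMeasure μ] [IsProbabilityMeasure ν] :
    AEMeasurable (fun a => ν (Prod.mk a ⁻¹' E)) μ ∧
      μ.prod ν E = ∫⁻ a, ν (Prod.mk a ⁻¹' E) ∂μ := by
  obtain ⟨t, -, htm, hte⟩ :=
    (hE.nullMeasurableSet_of_univMS (μ.prod ν)).exists_measurable_subset_ae_eq
  have h : (fun a => ν (Prod.mk a ⁻¹' t)) =ᵐ[μ] fun a => ν (Prod.mk a ⁻¹' E) := by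
    filter_upwards [Measure.ae_ae_of_ae_prod hte] with a ha
    exact measure_congr ha
  refine ⟨(measurable_measure_prodMk_left htm).aemeasurable.congr h, ?_⟩
  rw [← measure_congr hte, Measure.prod_apply htm, lintegral_congr_ae h]

theorem measurable_univMS_measure_prodMk {E : Set (α × β)} (hE : MeasurableSet[univMS] E)
    (ν : Measure β) [IsProbabilityMeasure ν] :
    Measurable[univMS] fun a => ν (Prod.mk a ⁻¹' E) :=
  measurable_univMS_of_forall fun μ _ => (prod_apply_univMS hE μ ν).1

theorem measurableSet_univMS_preimage {E : Set β} (hE : MeasurableSet[univMS] E) {f : α → β}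
    (hf : Measurable f) : MeasurableSet[univMS] (f ⁻¹' E) :=
  measurable_univMS_univMS (measurable_univMS hf) hE

theorem measure_prod_le_of_slices {E : Set (α × β)} (hE : MeasurableSet[univMS] E) (μ : Measure α)
    (ν : Measure β) [IsProbabilityMeasure μ] [IsProbabilityMeasure ν] {c : ℝ≥0∞}
    (h : ∀ᵐ a ∂μ, ν (Prod.mk a ⁻¹' E) ≤ c) : μ.prod ν E ≤ c := by
  rw [(prod_apply_univMS hE μ ν).2]
  exact (lintegral_mono_ae h).trans (by simp)

theorem measure_prod_le_of_slices_symm {E : Set (α × β)} (hE : MeasurableSet[univMS] E)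
    (μ : Measure α) (ν : Measure β) [IsProbabilityMeasure μ] [IsProbabilityMeasure ν] {c : ℝ≥0∞}
    (h : ∀ᵐ b ∂ν, μ ((fun a => (a, b)) ⁻¹' E) ≤ c) : μ.prod ν E ≤ c := by
  rw [← Measure.measurePreserving_swap.measure_preimage (hE.nullMeasurableSet_of_univMS _)]
  exact measure_prod_le_of_slices (measurableSet_univMS_preimage hE measurable_swap) ν μ h

end Product

section IID

variable {Z : Type*} [MeasurableSpace Z] {I J L : Type*}

/-- The law of an independent family, indexed by `I`, of variables with law `P`. -/
noncomputable abbrev iid (P : Measure Z) [IsProbabilityMeasure P] (I : Type*) : Measure (I → Z) :=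
  Measure.infinitePi fun _ : I => P

variable (P : Measure Z) [IsProbabilityMeasure P]

theorem measurePreserving_comp_injective {σ : I → J} (hσ : Function.Injective σ) :
    MeasurePreserving (fun ξ : J → Z => fun i => ξ (σ i)) (iid P J) (iid P I) := by
  classical
  refine ⟨by fun_prop, Measure.eq_infinitePi _ fun s t ht => ?_⟩
  rw [Measure.map_apply (by fun_prop) (.pi s.countable_toSet fun i _ => ht i)]
  rcases s.eq_empty_or_nonempty with rfl | ⟨i₀, -⟩
  · simp
  have : Nonempty I := ⟨i₀⟩
  have hpre : (fun ξ : J → Z => fun i => ξ (σ i)) ⁻¹' (Set.pi s t) =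
      Set.pi (s.image σ : Finset J) (fun j => t (Function.invFun σ j)) := by
    ext ξ
    simp [Set.mem_pi, Function.leftInverse_invFun hσ _]
  rw [hpre, Measure.infinitePi_pi (fun _ : J => P) fun j _ => ht _,
    Finset.prod_image hσ.injOn]
  simp [Function.leftInverse_invFun hσ _]

theorem measurePreserving_sum :
    MeasurePreserving (fun ξ : I ⊕ J → Z => (fun i => ξ (.inl i), fun j => ξ (.inr j)))
      (iid P (I ⊕ J)) ((iid P I).prod (iid P J)) := by
  have hm : Measurable fun p : (I → Z) × (J → Z) => (Sum.elim p.1 p.2 : I ⊕ J → Z) := by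
    refine measurable_pi_lambda _ fun o => ?_
    rcases o with i | j
    · exact (measurable_pi_apply i).comp measurable_fst
    · exact (measurable_pi_apply j).comp measurable_snd
  have key : ((iid P I).prod (iid P J)).map
      (fun p : (I → Z) × (J → Z) => (Sum.elim p.1 p.2 : I ⊕ J → Z)) = iid P (I ⊕ J) := by
    refine Measure.eq_infinitePi _ fun s t ht => ?_
    rw [Measure.map_apply hm (.pi s.countable_toSet fun i _ => ht i)]
    have hpre : (fun p : (I → Z) × (J → Z) => (Sum.elim p.1 p.2 : I ⊕ J → Z)) ⁻¹' (Set.pi s t) =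
        (Set.pi s.toLeft fun i => t (.inl i)) ×ˢ (Set.pi s.toRight fun j => t (.inr j)) := by
      ext p
      simp [Set.mem_pi, Sum.forall]
    rw [hpre, Measure.prod_prod, Measure.infinitePi_pi (fun _ : I => P) fun i _ => ht _,
      Measure.infinitePi_pi (fun _ : J => P) fun i _ => ht _]
    conv_rhs => rw [← Finset.toLeft_disjSum_toRight (u := s), Finset.prod_disjSum]
  have hm' : Measurable fun ξ : I ⊕ J → Z =>
    ((fun i => ξ (.inl i), fun j => ξ (.inr j)) : (I → Z) × (J → Z)) := by fun_prop
  refine ⟨hm', ?_⟩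
  rw [← key, Measure.map_map hm' hm]
  exact Measure.map_id

theorem measurePreserving_pair {σ : I → L} {τ : J → L} (hσ : Function.Injective σ)
    (hτ : Function.Injective τ) (h : ∀ i j, σ i ≠ τ j) :
    MeasurePreserving (fun ξ : L → Z => (fun i => ξ (σ i), fun j => ξ (τ j)))
      (iid P L) ((iid P I).prod (iid P J)) :=
  (measurePreserving_sum P).comp
    (measurePreserving_comp_injective P (σ := Sum.elim σ τ) (hσ.sumElim hτ h))

theorem measurePreserving_pair_point {σ : I → L} {l : L} (hσ : Function.Injective σ)
    (h : ∀ i, σ i ≠ l) :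
    MeasurePreserving (fun ξ : L → Z => (fun i => ξ (σ i), ξ l))
      (iid P L) ((iid P I).prod P) := by
  have h1 := measurePreserving_pair P (J := Unit) (τ := fun _ => l) hσ
    (fun _ _ _ => rfl) fun i _ => h i
  exact ((MeasurePreserving.id _).prod (measurePreserving_eval_infinitePi _ ())).comp h1

theorem measurePreserving_curry :
    MeasurePreserving (fun (ξ : I × J → Z) i j => ξ (i, j)) (iid P (I × J)) (iid (iid P J) I) :=
  ⟨by fun_prop, Measure.infinitePi_map_curry (fun (_ : I) (_ : J) => P)⟩

theorem measurePreserving_update [DecidableEq I] (i : I) :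
    MeasurePreserving (fun q : (I → Z) × Z => Function.update q.1 i q.2) ((iid P I).prod P)
      (iid P I) := by
  have hm : Measurable fun q : (I → Z) × Z => Function.update q.1 i q.2 := by
    fun_prop
  refine ⟨hm, Measure.eq_infinitePi _ fun s t ht => ?_⟩
  rw [Measure.map_apply hm (.pi s.countable_toSet fun i _ => ht i)]
  have hpre : (fun q : (I → Z) × Z => Function.update q.1 i q.2) ⁻¹' (Set.pi s t) =
      (Set.pi (s.erase i : Finset I) t) ×ˢ (if i ∈ s then t i else univ) := by
    ext q
    simp only [mem_preimage, Set.mem_pi, Finset.mem_coe, mem_prod, Finset.mem_erase]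
    constructor
    · intro h
      refine ⟨fun j hj => by simpa [Function.update_of_ne hj.1] using h j hj.2, ?_⟩
      split_ifs with hi
      · simpa using h i hi
      · trivial
    · rintro ⟨h1, h2⟩ j hj
      rcases eq_or_ne j i with rfl | hji
      · simpa [hj] using h2
      · simpa [Function.update_of_ne hji] using h1 j ⟨hji, hj⟩
  rw [hpre, Measure.prod_prod, Measure.infinitePi_pi (fun _ : I => P) fun i _ => ht _]
  split_ifs with hi
  · exact Finset.prod_erase_mul _ _ hi
  · simp [Finset.erase_eq_of_notMem hi]

end IID

section Congr

variable {𝒳 : Type*} [Inhabited 𝒳] {m : ℕ → ℕ}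
  {φ : ℕ → (ℕ → ℕ → 𝒳 × Bool) × (ℕ → 𝒳) → ℕ}

theorem trunc_congr {n : ℕ} {b b' : ℕ → 𝒳 × Bool} (h : ∀ i < n, b i = b' i) :
    trunc n b = trunc n b' := by
  funext i
  by_cases hi : i < n
  · simp [trunc, hi, h i hi]
  · simp [trunc, hi]

theorem hit_congr {st : ℕ × (ℕ → ℕ → 𝒳 × Bool)} {b b' : ℕ → 𝒳 × Bool}
    (h : ∀ i < m st.1, b i = b' i) : Hit m φ st b ↔ Hit m φ st b' := by
  unfold Hit
  rw [trunc_congr h]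
  exact forall₂_congr fun i hi => by rw [h i hi]

theorem state_congr {B B' : ℕ → ℕ → 𝒳 × Bool} {t : ℕ}
    (h : ∀ j < t, ∀ k ≤ j, ∀ i < m k, B j i = B' j i) : state m φ B t = state m φ B' t := by
  induction t with
  | zero => rfl
  | succ t ih =>
    have h1 := ih fun j hj => h j (by omega)
    have h2 : ∀ i < m (state m φ B' t).1, B t i = B' t i :=
      h t (by omega) _ (state_fst_le φ B' t)
    have h3 := hit_congr (φ := φ) h2
    rw [state, state, h1]
    unfold stepState
    rw [trunc_congr h2]
    by_cases h4 : Hit m φ (state m φ B' t) (B t)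
    · rw [if_pos h4, if_pos (h3.1 h4)]
    · rw [if_neg h4, if_neg fun h5 => h4 (h3.2 h5)]

end Congr

section Measurability

variable {𝒳 : Type*} [Inhabited 𝒳] [MeasurableSpace 𝒳] {m : ℕ → ℕ}
  {φ : ℕ → (ℕ → ℕ → 𝒳 × Bool) × (ℕ → 𝒳) → ℕ}

theorem measurable_trunc (n : ℕ) : Measurable (trunc n : (ℕ → 𝒳 × Bool) → ℕ → 𝒳 × Bool) := by
  refine measurable_pi_lambda _ fun i => ?_
  by_cases hi : i < n
  · simpa [trunc, hi] using measurable_pi_apply i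
  · simp [trunc, hi]

theorem measurableSet_hit (hφ : ∀ k, Measurable[univMS] (φ k)) :
    MeasurableSet[univMS] {q : (ℕ × (ℕ → ℕ → 𝒳 × Bool)) × (ℕ → 𝒳 × Bool) |
      Hit m φ q.1 q.2} := by
  have heq : {q : (ℕ × (ℕ → ℕ → 𝒳 × Bool)) × (ℕ → 𝒳 × Bool) | Hit m φ q.1 q.2} =
      ⋃ k, {q | q.1.1 = k} ∩ ⋂ i, {q | i < m k →
        (φ k (q.1.2, fun i => (trunc (m k) q.2 i).1)).testBit i = (q.2 i).2} := by
    ext q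
    simp [Hit]
  rw [heq]
  refine MeasurableSet.iUnion fun k => MeasurableSet.inter ?_ (MeasurableSet.iInter fun i => ?_)
  · exact measurable_univMS (measurable_fst.comp measurable_fst) (measurableSet_singleton k)
  by_cases hi : i < m k
  · have h1 : Measurable fun q : (ℕ × (ℕ → ℕ → 𝒳 × Bool)) × (ℕ → 𝒳 × Bool) =>
        (q.1.2, fun i => (trunc (m k) q.2 i).1) := by
      refine (by fun_prop : Measurable fun q :
        (ℕ × (ℕ → ℕ → 𝒳 × Bool)) × (ℕ → 𝒳 × Bool) => q.1.2).prodMk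
        (measurable_pi_lambda _ fun i => ?_)
      exact ((measurable_pi_apply i).comp ((measurable_trunc (m k)).comp measurable_snd)).fst
    have h2 := measurable_univMS_comp (hφ k) (measurable_univMS h1)
    have h3 : Measurable fun q : (ℕ × (ℕ → ℕ → 𝒳 × Bool)) × (ℕ → 𝒳 × Bool) => (q.2 i).2 := by
      fun_prop
    have h4 := h2.prodMk (measurable_univMS h3)
    have h5 : MeasurableSet {p : ℕ × Bool | p.1.testBit i = p.2} := .of_discrete
    simpa [hi] using h4 h5
  · simp [hi]

theorem measurable_stepState (hφ : ∀ k, Measurable[univMS] (φ k)) :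
    Measurable[univMS] fun q : (ℕ × (ℕ → ℕ → 𝒳 × Bool)) × (ℕ → 𝒳 × Bool) =>
      stepState m φ q.1 q.2 := by
  classical
  have h : Measurable fun q : (ℕ × (ℕ → ℕ → 𝒳 × Bool)) × (ℕ → 𝒳 × Bool) =>
      (q.1.1 + 1, Function.update q.1.2 q.1.1 (trunc (m q.1.1) q.2)) := by
    refine (by fun_prop : Measurable fun q :
      (ℕ × (ℕ → ℕ → 𝒳 × Bool)) × (ℕ → 𝒳 × Bool) => q.1.1 + 1).prodMk ?_
    refine measurable_pi_lambda _ fun j => ?_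
    simp only [Function.update_apply]
    refine Measurable.ite ?_ ?_ (by fun_prop)
    · exact measurableSet_eq_fun measurable_const (by fun_prop)
    · have : Measurable fun p : ℕ × (ℕ → 𝒳 × Bool) => trunc (m p.1) p.2 :=
        measurable_from_prod_countable_right fun k => measurable_trunc (m k)
      exact this.comp (measurable_fst.fst.prodMk measurable_snd)
  have h1 := measurable_univMS h
  have h2 := measurable_univMS (measurable_fst :
    Measurable (Prod.fst : (ℕ × (ℕ → ℕ → 𝒳 × Bool)) × (ℕ → 𝒳 × Bool) → _))
  unfold stepState
  refine @Measurable.ite _ _ _ _ univMS _ _ _ (measurableSet_hit hφ) ?_ ?_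
  · exact h1
  · exact h2

theorem measurable_state (hφ : ∀ k, Measurable[univMS] (φ k)) (t : ℕ) :
    Measurable[univMS] fun B => state m φ B t := by
  induction t with
  | zero => exact measurable_univMS measurable_const
  | succ t ih =>
    exact measurable_univMS_comp (measurable_stepState hφ)
      (ih.prodMk (measurable_univMS (measurable_pi_apply t)))

end Measurability

section Limit

variable {𝒳 Θ : Type*} [MeasurableSpace 𝒳] [MeasurableSpace Θ]
  {f : Θ → 𝒳 → Bool} {m : ℕ → ℕ} {φ : ℕ → (ℕ → ℕ → 𝒳 × Bool) × (ℕ → 𝒳) → ℕ}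
  {P : Measure (𝒳 × Bool)} [IsProbabilityMeasure P]

theorem ae_consistent (hf : Measurable (Function.uncurry f)) (hP : Realizable (range f) P) :
    ∀ᵐ B ∂iid (iid P ℕ) ℕ, ∀ K : ℕ, ∃ θ, ∀ j < K, ∀ i < K, f θ (B j i).1 = (B j i).2 := by
  rw [ae_all_iff]
  intro K
  rw [ae_iff]
  have hle : ∀ θ, iid (iid P ℕ) ℕ {B : ℕ → ℕ → 𝒳 × Bool |
      ¬ ∃ θ, ∀ j < K, ∀ i < K, f θ (B j i).1 = (B j i).2} ≤ (K * K : ℕ) * errP P (f θ) := by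
    intro θ
    have hm : MeasurableSet {p : 𝒳 × Bool | f θ p.1 ≠ p.2} :=
      (measurableSet_eq_fun (hf.comp (measurable_const.prodMk measurable_fst))
        measurable_snd).compl
    have hsub : {B : ℕ → ℕ → 𝒳 × Bool | ¬ ∃ θ, ∀ j < K, ∀ i < K, f θ (B j i).1 = (B j i).2} ⊆
        ⋃ q ∈ Finset.range K ×ˢ Finset.range K,
          (fun B : ℕ → ℕ → 𝒳 × Bool => B q.1 q.2) ⁻¹' {p : 𝒳 × Bool | f θ p.1 ≠ p.2} := by
      intro B hB
      simp only [mem_ofPred_eq, not_exists, not_forall] at hB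
      obtain ⟨j, hj, i, hi, h⟩ := hB θ
      simp only [mem_iUnion]
      exact ⟨(j, i), by simp [hj, hi], h⟩
    refine (measure_mono hsub).trans ((measure_biUnion_finset_le _ _).trans ?_)
    have hq : ∀ q : ℕ × ℕ, iid (iid P ℕ) ℕ
        ((fun B : ℕ → ℕ → 𝒳 × Bool => B q.1 q.2) ⁻¹' {p : 𝒳 × Bool | f θ p.1 ≠ p.2}) =
        errP P (f θ) := fun q =>
      ((measurePreserving_eval_infinitePi (fun _ : ℕ => P) q.2).comp
        (measurePreserving_eval_infinitePi (fun _ : ℕ => iid P ℕ) q.1)).measure_preimage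
        hm.nullMeasurableSet
    rw [Finset.sum_congr rfl fun q _ => hq q]
    simp
  have hz : (⨅ θ, errP P (f θ)) = 0 := by
    have := hP
    rwa [Realizable, iInf_range] at this
  refine le_antisymm ?_ zero_le
  calc _ ≤ ⨅ θ, (K * K : ℕ) * errP P (f θ) := le_iInf hle
    _ = (K * K : ℕ) * ⨅ θ, errP P (f θ) := by
      have : Nonempty Θ := by
        by_contra h
        rw [not_nonempty_iff] at h
        rw [iInf_of_empty] at hz
        exact ENNReal.top_ne_zero hz
      exact (ENNReal.mul_iInf fun h => absurd h (ENNReal.natCast_ne_top _)).symm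
    _ = 0 := by rw [hz, mul_zero]

variable [Inhabited 𝒳]

/-- A state of the game in which the strategy almost surely never predicts correctly. -/
def Good (m : ℕ → ℕ) (φ : ℕ → (ℕ → ℕ → 𝒳 × Bool) × (ℕ → 𝒳) → ℕ) (P : Measure (𝒳 × Bool))
    [IsProbabilityMeasure P] (st : ℕ × (ℕ → ℕ → 𝒳 × Bool)) : Prop :=
  iid P ℕ {b | Hit m φ st b} = 0

theorem measurableSet_good (hφ : ∀ k, Measurable[univMS] (φ k)) :
    MeasurableSet[univMS] {st | Good m φ P st} :=
  measurable_univMS_measure_prodMk (measurableSet_hit hφ) (iid P ℕ) (measurableSet_singleton 0)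

/-- The game played on independent rows quickly reaches good states. -/
theorem exists_forall_measure_not_good_le (hφ : ∀ k, Measurable[univMS] (φ k))
    (hterm : ∀ b : ℕ → ℕ → 𝒳 × Bool,
      (∀ K : ℕ, ∃ θ, ∀ j < K, ∀ i < K, f θ (b j i).1 = (b j i).2) →
      ∃ T, ∀ t ≥ T, state m φ b t = state m φ b T ∧ ¬ Hit m φ (state m φ b t) (b t))
    (hf : Measurable (Function.uncurry f)) (hP : Realizable (range f) P)
    [MeasurableEq (ℕ × (ℕ → ℕ → 𝒳 × Bool))]
    {ε : ℝ≥0∞} (hε : 0 < ε) :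
    ∃ T₀, ∀ T ≥ T₀, iid (iid P ℕ) ℕ {B | ¬ (Good m φ P (state m φ B T) ∧
      (state m φ B T).1 ≤ T₀)} ≤ ε := by
  set ν := iid P ℕ with hν
  set μ := iid ν ℕ with hμ
  have hstate := measurable_state (m := m) hφ
  let H : ℕ → Set (ℕ → ℕ → 𝒳 × Bool) := fun t => {B | Hit m φ (state m φ B t) (B t)}
  have hH : ∀ t, MeasurableSet[univMS] (H t) := fun t =>
    measurable_univMS_univMS ((hstate t).prodMk (measurable_univMS (measurable_pi_apply t)))
      (measurableSet_hit hφ)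
  let G : ℕ → Set (ℕ → ℕ → 𝒳 × Bool) := fun T =>
    {B | ∀ t ≥ T, state m φ B t = state m φ B T ∧ B ∉ H t}
  have hG : ∀ T, MeasurableSet[univMS] (G T) := by
    intro T
    have : G T = ⋂ t, ⋂ (_ : t ≥ T), ((fun B => (state m φ B t, state m φ B T)) ⁻¹'
        {q | q.1 = q.2} ∩ (H t)ᶜ) := by
      ext B
      simp [G]
    rw [this]
    refine MeasurableSet.iInter fun t => MeasurableSet.iInter fun _ =>
      MeasurableSet.inter ?_ (MeasurableSet.compl (hH t))
    exact (hstate t).prodMk (hstate T) (measurableSet_eq_fun measurable_fst measurable_snd)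
  have hGmono : Monotone G := by
    intro T T' hTT B hB t ht
    exact ⟨(hB t (hTT.trans ht)).1.trans (hB T' hTT).1.symm, (hB t (hTT.trans ht)).2⟩
  have hlim : Tendsto (fun T => μ (G T)ᶜ) atTop (𝓝 0) := by
    have h0 : μ (⋂ T, (G T)ᶜ) = 0 := by
      rw [← compl_iUnion]
      have := ae_consistent hf hP
      rw [ae_iff] at this
      refine measure_mono_null (fun B hB => ?_) this
      intro hB'
      refine hB ?_
      obtain ⟨T, hT⟩ := hterm B hB'
      exact mem_iUnion.2 ⟨T, hT⟩
    rw [← h0]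
    exact tendsto_measure_iInter_atTop
      (fun T => ((hG T).nullMeasurableSet_of_univMS μ).compl)
      (fun a b hab => compl_subset_compl.2 (hGmono hab)) ⟨0, measure_ne_top _ _⟩
  let q : ℕ × (ℕ → ℕ → 𝒳 × Bool) → ℝ≥0∞ := fun st => ν {b | Hit m φ st b}
  have hq : Measurable[univMS] q := measurable_univMS_measure_prodMk (measurableSet_hit hφ) ν
  have hqae : ∀ T, AEMeasurable (fun B => q (state m φ B T)) μ := by
    intro T
    have : NullMeasurable (fun B => q (state m φ B T)) μ := fun s hs =>
      (measurable_univMS_comp hq (hstate T) hs).nullMeasurableSet_of_univMS μ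
    exact this.aemeasurable
  have hkey : ∀ t, ∫⁻ B, q (state m φ B t) ∂μ ≤ μ (G t)ᶜ := by
    intro t
    have hE : MeasurableSet[univMS] {p : (ℕ → ℕ → 𝒳 × Bool) × (ℕ → 𝒳 × Bool) |
        Hit m φ (state m φ p.1 t) p.2} :=
      measurable_univMS_univMS ((measurable_univMS_comp (hstate t)
        (measurable_univMS measurable_fst)).prodMk (measurable_univMS measurable_snd))
        (measurableSet_hit hφ)
    have h1 := (prod_apply_univMS hE μ ν).2
    have h2 := (measurePreserving_update ν t).measure_preimage
      ((hH t).nullMeasurableSet_of_univMS _)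
    have h3 : (fun p : (ℕ → ℕ → 𝒳 × Bool) × (ℕ → 𝒳 × Bool) => Function.update p.1 t p.2) ⁻¹' H t =
        {p | Hit m φ (state m φ p.1 t) p.2} := by
      ext p
      have : state m φ (Function.update p.1 t p.2) t = state m φ p.1 t :=
        state_congr fun j hj _ _ _ _ => by rw [Function.update_of_ne hj.ne]
      simp [H, this]
    rw [h3, h1] at h2
    refine h2.le.trans (measure_mono fun B hB hB' => (hB' t le_rfl).2 hB)
  have hgood : ∀ T, μ (G T ∩ {B | ¬ Good m φ P (state m φ B T)}) = 0 := by
    intro T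
    have h0 : ∫⁻ B in G T, q (state m φ B T) ∂μ = 0 := by
      refine le_antisymm (ge_of_tendsto hlim ?_) zero_le
      filter_upwards [eventually_ge_atTop T] with t ht
      refine le_trans ?_ (hkey t)
      refine le_trans (le_of_eq ?_) (setLIntegral_le_lintegral (G T) _)
      refine lintegral_congr_ae ?_
      filter_upwards [ae_restrict_mem₀ ((hG T).nullMeasurableSet_of_univMS μ)] with B hB
      rw [(hB t ht).1]
    rw [lintegral_eq_zero_iff' (hqae T).restrict, Filter.EventuallyEq,
      ae_restrict_iff'₀ ((hG T).nullMeasurableSet_of_univMS μ), ae_iff] at h0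
    refine measure_mono_null ?_ h0
    rintro B ⟨hB1, hB2⟩ h
    exact hB2 (h hB1)
  obtain ⟨T₀, hT₀⟩ := (hlim.eventually (ge_mem_nhds hε)).exists
  refine ⟨T₀, fun T hT => ?_⟩
  calc _ ≤ μ ((G T₀)ᶜ ∪ (G T₀ ∩ {B | ¬ Good m φ P (state m φ B T₀)})) := by
        refine measure_mono fun B hB => ?_
        by_cases hBG : B ∈ G T₀
        · refine Or.inr ⟨hBG, fun hg => hB ?_⟩
          rw [(hBG T hT).1]
          exact ⟨hg, state_fst_le φ B T₀⟩
        · exact Or.inl hBG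
    _ ≤ μ (G T₀)ᶜ + μ (G T₀ ∩ {B | ¬ Good m φ P (state m φ B T₀)}) := measure_union_le _ _
    _ ≤ ε := by rw [hgood, add_zero]; exact hT₀

end Limit

section Transfer

variable {𝒳 : Type*} [MeasurableSpace 𝒳] [Inhabited 𝒳] {I : Type*}

theorem exists_learner {n : ℕ} (R : Finset I) (hR : R.card ≤ n) {G : (I → 𝒳 × Bool) → 𝒳 → Bool}
    (hG : Measurable[univMS] (Function.uncurry G))
    (hdep : ∀ ξ ξ', (∀ i ∈ R, ξ i = ξ' i) → G ξ = G ξ') :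
    ∃ H : (Fin n → 𝒳 × Bool) → 𝒳 → Bool,
      (UniversallyMeasurable fun q : (Fin n → 𝒳 × Bool) × 𝒳 => H q.1 q.2) ∧
      ∀ (P : Measure (𝒳 × Bool)) [IsProbabilityMeasure P],
        ∫⁻ s, errP P (H s) ∂(Measure.pi fun _ : Fin n => P) =
          ((iid P I).prod P) {q | G q.1 q.2.1 ≠ q.2.2} := by
  classical
  let idx : R → Fin n := fun i => Fin.castLE hR (R.equivFin i)
  have hidx : Function.Injective idx := fun i j h =>
    R.equivFin.injective (Fin.castLE_injective hR h)
  let e : (R → 𝒳 × Bool) → I → 𝒳 × Bool := fun ρ i => if h : i ∈ R then ρ ⟨i, h⟩ else default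
  have he : Measurable e := by
    refine measurable_pi_lambda _ fun i => ?_
    by_cases h : i ∈ R
    · simpa [e, h] using measurable_pi_apply _
    · simp [e, h]
  have hGe : ∀ ξ : I → 𝒳 × Bool, G (e fun i => ξ i) = G ξ := fun ξ =>
    hdep _ _ fun i hi => by simp [e, hi]
  let E : Set ((R → 𝒳 × Bool) × (𝒳 × Bool)) := {q | G (e q.1) q.2.1 ≠ q.2.2}
  have hE : MeasurableSet[univMS] E := by
    have h1 : Measurable fun q : (R → 𝒳 × Bool) × (𝒳 × Bool) => (e q.1, q.2.1) := by fun_prop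
    have h2 : Measurable fun q : (R → 𝒳 × Bool) × (𝒳 × Bool) => q.2.2 := by fun_prop
    have h3 := (measurable_univMS_comp hG (measurable_univMS h1)).prodMk (measurable_univMS h2)
    exact h3 (MeasurableSet.of_discrete (s := {p : Bool × Bool | p.1 ≠ p.2}))
  refine ⟨fun s => G (e fun i => s (idx i)), ?_, fun P _ => ?_⟩
  · rw [universallyMeasurable_iff]
    have h1 : Measurable fun q : (Fin n → 𝒳 × Bool) × 𝒳 => fun i => q.1 (idx i) :=
      measurable_pi_lambda _ fun i => (measurable_pi_apply _).comp measurable_fst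
    exact measurable_univMS_comp hG (measurable_univMS ((he.comp h1).prodMk measurable_snd))
  · have hσ : Function.Injective (Subtype.val : R → I) := Subtype.val_injective
    have h1 := ((measurePreserving_comp_injective P hσ).prod
      (MeasurePreserving.id P)).measure_preimage (hE.nullMeasurableSet_of_univMS _)
    have h2 := ((measurePreserving_comp_injective P hidx).prod
      (MeasurePreserving.id P)).measure_preimage (hE.nullMeasurableSet_of_univMS _)
    have h3 : Prod.map (fun ξ : I → 𝒳 × Bool => fun i : R => ξ i) id ⁻¹' E =
        {q | G q.1 q.2.1 ≠ q.2.2} := by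
      ext q
      simp [E, hGe]
    have hE' : MeasurableSet[univMS]
        (Prod.map (fun ξ : Fin n → 𝒳 × Bool => fun i : R => ξ (idx i)) id ⁻¹' E) :=
      measurableSet_univMS_preimage hE (by fun_prop)
    rw [← h3, h1, ← h2, (prod_apply_univMS hE' _ _).2, iid, Measure.infinitePi_eq_pi]
    rfl

theorem exists_learningAlgorithm (R : ℕ → Finset I) (hR : ∀ n, (R n).card ≤ n)
    {G : ℕ → (I → 𝒳 × Bool) → 𝒳 → Bool}
    (hG : ∀ n, Measurable[univMS] (Function.uncurry (G n)))
    (hdep : ∀ n ξ ξ', (∀ i ∈ R n, ξ i = ξ' i) → G n ξ = G n ξ') :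
    ∃ A : LearningAlgorithm 𝒳, ∀ (P : Measure (𝒳 × Bool)) [IsProbabilityMeasure P] (n : ℕ),
      expErr P A n = ((iid P I).prod P) {q | G n q.1 q.2.1 ≠ q.2.2} := by
  choose H hH1 hH2 using fun n => exists_learner (R n) (hR n) (hG n) (hdep n)
  exact ⟨⟨H, hH1⟩, fun P _ n => hH2 n P⟩

end Transfer

section Count

open Classical in
/-- The number of `i < N` satisfying `p`. -/
noncomputable def count (N : ℕ) (p : ℕ → Prop) : ℕ := ((Finset.range N).filter p).card

theorem count_add_count_not (N : ℕ) (p : ℕ → Prop) : count N p + count N (fun i => ¬ p i) = N := by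
  classical
  unfold count
  rw [Finset.card_filter_add_card_filter_not, Finset.card_range]

theorem count_mono {N : ℕ} {p q : ℕ → Prop} (h : ∀ i < N, p i → q i) : count N p ≤ count N q := by
  classical
  unfold count
  refine Finset.card_le_card fun i hi => ?_
  simp only [Finset.mem_filter, Finset.mem_range] at hi ⊢
  exact ⟨hi.1, h i hi.1 hi.2⟩

theorem count_congr {N : ℕ} {p q : ℕ → Prop} (h : ∀ i < N, p i ↔ q i) : count N p = count N q :=
  le_antisymm (count_mono fun i hi => (h i hi).1) (count_mono fun i hi => (h i hi).2)

theorem measurable_count {α : Type*} {mα : MeasurableSpace α} {p : α → ℕ → Prop}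
    (hp : ∀ i, MeasurableSet {a | p a i}) (N : ℕ) : Measurable fun a => count N (p a) := by
  classical
  have : (fun a => count N (p a)) = fun a => ∑ i ∈ Finset.range N, if p a i then 1 else 0 := by
    funext a
    rw [count, Finset.card_filter]
  rw [this]
  exact Finset.measurable_sum _ fun i _ => Measurable.ite (hp i) measurable_const measurable_const

variable {W : Type*} [MeasurableSpace W] (ν : Measure W) [IsProbabilityMeasure ν]

theorem lintegral_iid_prod {g : W → ℝ≥0∞} (hg : Measurable g) (N : ℕ) :
    ∫⁻ b, ∏ i ∈ Finset.range N, g (b i) ∂iid ν ℕ = (∫⁻ w, g w ∂ν) ^ N := by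
  have h := ProbabilityTheory.lintegral_prod_eq_prod_lintegral_of_indepFun (μ := iid ν ℕ)
    (Finset.range N)
    (fun i (b : ℕ → W) => g (b i))
    (ProbabilityTheory.iIndepFun_infinitePi (P := fun _ : ℕ => ν) (X := fun _ => g)
      fun _ => hg) fun i => hg.comp (measurable_pi_apply i)
  rw [h]
  have : ∀ i : ℕ, ∫⁻ b, g (b i) ∂iid ν ℕ = ∫⁻ w, g w ∂ν := fun i =>
    (measurePreserving_eval_infinitePi (fun _ : ℕ => ν) i).lintegral_comp hg
  simp [this]

/-- A Chernoff bound: it is exponentially unlikely that at least a fraction `k / l` of independent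
samples falls into a set of small measure. -/
theorem measure_count_ge_le {A : Set W} {p x r : ℝ} (hp : 0 ≤ p) (hx : 1 ≤ x) {k l : ℕ}
    (hA : ν A ≤ ENNReal.ofReal p) (hr : 1 + (x ^ l - 1) * p ≤ r * x ^ k) (N : ℕ) :
    iid ν ℕ {b | k * N ≤ l * count N fun i => b i ∈ A} ≤ ENNReal.ofReal (r ^ N) := by
  classical
  set A' := toMeasurable ν A with hA'
  have hA'm : MeasurableSet A' := measurableSet_toMeasurable _ _
  have hxl : 0 ≤ x ^ l - 1 := sub_nonneg.2 (one_le_pow₀ hx)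
  have hx0 : 0 < x := by linarith
  let g : W → ℝ≥0∞ := fun w => if w ∈ A' then ENNReal.ofReal (x ^ l) else 1
  have hg : Measurable g := Measurable.ite hA'm measurable_const measurable_const
  have hgi : ∫⁻ w, g w ∂ν ≤ ENNReal.ofReal (r * x ^ k) := by
    have : g = fun w => 1 + A'.indicator (fun _ => ENNReal.ofReal (x ^ l - 1)) w := by
      funext w
      by_cases hw : w ∈ A'
      · simp only [g, hw, if_true, indicator_of_mem]
        rw [← ENNReal.ofReal_one, ← ENNReal.ofReal_add zero_le_one hxl]
        ring_nf
      · simp [g, hw]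
    rw [this, lintegral_add_left measurable_const, lintegral_indicator_const hA'm, hA',
      measure_toMeasurable]
    calc _ ≤ 1 + ENNReal.ofReal (x ^ l - 1) * ENNReal.ofReal p := by
          simp only [lintegral_const, measure_univ, mul_one]
          gcongr
      _ = ENNReal.ofReal (1 + (x ^ l - 1) * p) := by
          rw [ENNReal.ofReal_add zero_le_one (mul_nonneg hxl hp), ENNReal.ofReal_mul hxl,
            ENNReal.ofReal_one]
      _ ≤ _ := ENNReal.ofReal_le_ofReal hr
  have hr0 : 0 ≤ r := by
    by_contra h
    have h1 : r * x ^ k < 0 := mul_neg_of_neg_of_pos (not_le.1 h) (pow_pos hx0 k)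
    have h2 : 0 ≤ (x ^ l - 1) * p := mul_nonneg hxl hp
    linarith
  have hgm : Measurable fun b : ℕ → W => ∏ i ∈ Finset.range N, g (b i) :=
    Finset.measurable_prod _ fun i _ => hg.comp (measurable_pi_apply i)
  have hsub : {b : ℕ → W | k * N ≤ l * count N fun i => b i ∈ A} ⊆
      {b | ENNReal.ofReal (x ^ (k * N)) ≤ ∏ i ∈ Finset.range N, g (b i)} := by
    intro b hb
    have h1 : ∏ i ∈ Finset.range N, g (b i) =
        ENNReal.ofReal (x ^ (l * count N fun i => b i ∈ A')) := by
      simp only [g]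
      rw [Finset.prod_ite]
      simp only [Finset.prod_const, one_pow, mul_one]
      rw [pow_mul, ENNReal.ofReal_pow (n := count _ _) (by positivity)]
      rfl
    rw [mem_ofPred_eq, h1]
    refine ENNReal.ofReal_le_ofReal (pow_le_pow_right₀ hx (le_trans hb ?_))
    gcongr
    exact count_mono fun i _ hi => subset_toMeasurable ν A hi
  have hmarkov := mul_meas_ge_le_lintegral (μ := iid ν ℕ) hgm (ENNReal.ofReal (x ^ (k * N)))
  rw [lintegral_iid_prod ν hg] at hmarkov
  have hc : 0 < x ^ (k * N) := pow_pos hx0 _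
  have h2 : ENNReal.ofReal (x ^ (k * N)) * iid ν ℕ {b | k * N ≤ l * count N fun i => b i ∈ A} ≤
      ENNReal.ofReal (x ^ (k * N)) * ENNReal.ofReal (r ^ N) := by
    refine (mul_le_mul_right (measure_mono hsub) _).trans (hmarkov.trans ?_)
    refine (pow_le_pow_left₀ zero_le hgi N).trans (le_of_eq ?_)
    rw [← ENNReal.ofReal_mul hc.le, ← ENNReal.ofReal_pow (by positivity), mul_pow, ← pow_mul,
      mul_comm]
  exact (ENNReal.mul_le_mul_iff_right (by simpa using hc) ENNReal.ofReal_ne_top).1 h2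

theorem measure_prod_count_ge_le {V : Type*} [MeasurableSpace V] (ρ : Measure V)
    [IsProbabilityMeasure ρ] {E : Set (W × V)} (hE : MeasurableSet[univMS] E) {p x r : ℝ}
    (hp : 0 ≤ p) (hx : 1 ≤ x) {k l : ℕ} (hr : 1 + (x ^ l - 1) * p ≤ r * x ^ k) (N : ℕ)
    {S : Set V} (hS : MeasurableSet[univMS] S)
    (hES : ∀ v ∈ S, ν ((fun w => (w, v)) ⁻¹' E) ≤ ENNReal.ofReal p) :
    (iid ν ℕ).prod ρ {q | q.2 ∈ S ∧ k * N ≤ l * count N fun i => (q.1 i, q.2) ∈ E} ≤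
      ENNReal.ofReal (r ^ N) := by
  have hm : MeasurableSet[univMS] {q : (ℕ → W) × V |
      q.2 ∈ S ∧ k * N ≤ l * count N fun i => (q.1 i, q.2) ∈ E} := by
    refine MeasurableSet.inter (measurableSet_univMS_preimage hS measurable_snd) ?_
    have : Measurable[univMS] fun q : (ℕ → W) × V => count N fun i => (q.1 i, q.2) ∈ E :=
      measurable_count (mα := univMS) (fun i => measurableSet_univMS_preimage hE
        (f := fun q : (ℕ → W) × V => (q.1 i, q.2)) (by fun_prop)) N
    exact this (MeasurableSet.of_discrete (s := {c : ℕ | k * N ≤ l * c}))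
  refine measure_prod_le_of_slices_symm hm _ _ (ae_of_all _ fun v => ?_)
  by_cases hv : v ∈ S
  · refine (measure_mono ?_).trans (measure_count_ge_le ν hp hx (hES v hv) hr N)
    intro b hb
    exact hb.2
  · have : (fun b : ℕ → W => (b, v)) ⁻¹' {q : (ℕ → W) × V |
        q.2 ∈ S ∧ k * N ≤ l * count N fun i => (q.1 i, q.2) ∈ E} = ∅ := by
      ext b
      simp [hv]
    rw [this]
    simp

end Count

section ExpSmall

/-- Exponential decay of a sequence. -/
def ExpSmall (a : ℕ → ℝ≥0∞) : Prop :=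
  ∃ C > (0 : ℝ), ∃ r ∈ Ioo (0 : ℝ) 1, ∀ n, a n ≤ ENNReal.ofReal (C * r ^ n)

theorem ExpSmall.mono {a b : ℕ → ℝ≥0∞} (hb : ExpSmall b) (h : ∀ n, a n ≤ b n) : ExpSmall a := by
  obtain ⟨C, hC, r, hr, hbn⟩ := hb
  exact ⟨C, hC, r, hr, fun n => (h n).trans (hbn n)⟩

theorem ExpSmall.mono_eventually {a b : ℕ → ℝ≥0∞} (hb : ExpSmall b) (ha : ∀ n, a n ≤ 1)
    (n₀ : ℕ) (h : ∀ n ≥ n₀, a n ≤ b n) : ExpSmall a := by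
  obtain ⟨C, hC, r, hr, hbn⟩ := hb
  refine ⟨C + (r ^ n₀)⁻¹, by have := pow_pos hr.1 n₀; positivity, r, hr, fun n => ?_⟩
  have h1 : 0 < r ^ n := pow_pos hr.1 n
  have h2 : 0 < r ^ n₀ := pow_pos hr.1 n₀
  rcases le_total n₀ n with hn | hn
  · refine (h n hn).trans ((hbn n).trans (ENNReal.ofReal_le_ofReal ?_))
    have : 0 < (r ^ n₀)⁻¹ * r ^ n := by positivity
    nlinarith
  · refine (ha n).trans ?_
    rw [← ENNReal.ofReal_one]
    refine ENNReal.ofReal_le_ofReal ?_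
    have h3 : r ^ n₀ ≤ r ^ n := pow_le_pow_of_le_one hr.1.le hr.2.le hn
    have h4 : 1 ≤ (r ^ n₀)⁻¹ * r ^ n := by
      rw [← div_eq_inv_mul, one_le_div h2]
      exact h3
    nlinarith [mul_pos hC h1]

theorem ExpSmall.add {a b : ℕ → ℝ≥0∞} (ha : ExpSmall a) (hb : ExpSmall b) :
    ExpSmall fun n => a n + b n := by
  obtain ⟨C, hC, r, hr, han⟩ := ha
  obtain ⟨D, hD, s, hs, hbn⟩ := hb
  refine ⟨C + D, by positivity, max r s, ⟨lt_max_of_lt_left hr.1, max_lt hr.2 hs.2⟩, fun n => ?_⟩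
  have h0 := hr.1.le
  have h1 := hs.1.le
  refine (add_le_add (han n) (hbn n)).trans ?_
  rw [← ENNReal.ofReal_add (by positivity) (by positivity), add_mul]
  refine ENNReal.ofReal_le_ofReal (add_le_add ?_ ?_)
  · gcongr
    exact le_max_left _ _
  · gcongr
    exact le_max_right _ _

theorem expSmall_zero : ExpSmall fun _ => 0 :=
  ⟨1, one_pos, 1 / 2, by norm_num, fun _ => zero_le⟩

theorem ExpSmall.sum {ι : Type*} {a : ι → ℕ → ℝ≥0∞} (s : Finset ι) (h : ∀ i ∈ s, ExpSmall (a i)) :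
    ExpSmall fun n => ∑ i ∈ s, a i n := by
  classical
  induction s using Finset.induction_on with
  | empty => simpa using expSmall_zero
  | insert i s hi ih =>
    simp only [Finset.sum_insert hi]
    exact (h i (Finset.mem_insert_self i s)).add
      (ih fun j hj => h j (Finset.mem_insert_of_mem hj))

theorem expSmall_mul_pow_div {r : ℝ} (hr0 : 0 ≤ r) (hr1 : r < 1) {D : ℕ} (hD : 0 < D) :
    ExpSmall fun n => n * ENNReal.ofReal (r ^ (n / D)) := by
  wlog hr : 0 < r generalizing r
  · refine (this (r := 1 / 2) (by norm_num) (by norm_num) (by norm_num)).mono fun n => ?_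
    have : r = 0 := le_antisymm (not_lt.1 hr) hr0
    gcongr
    rw [this]
    norm_num
  set s := r ^ (1 / (2 * D : ℝ)) with hs
  have hs0 : 0 < s := Real.rpow_pos_of_pos hr _
  have hs1 : s < 1 := Real.rpow_lt_one hr0 hr1 (by positivity)
  have hsD : s ^ (2 * D) = r := by
    rw [hs, ← Real.rpow_natCast, ← Real.rpow_mul hr0]
    push_cast
    rw [one_div_mul_cancel (by positivity), Real.rpow_one]
  obtain ⟨M, hM⟩ := (tendsto_self_mul_const_pow_of_lt_one hs0.le hs1).bddAbove_range
  have hM' : ∀ n : ℕ, n * s ^ n ≤ M := fun n => hM ⟨n, rfl⟩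
  have hM0 : 0 ≤ M := by simpa using hM' 0
  refine ⟨(M + 1) * r⁻¹, by positivity, s, ⟨hs0, hs1⟩, fun n => ?_⟩
  beta_reduce
  rw [← ENNReal.ofReal_natCast, ← ENNReal.ofReal_mul (by positivity)]
  refine ENNReal.ofReal_le_ofReal ?_
  have h1 : r * r ^ (n / D) ≤ s ^ n * s ^ n := by
    rw [← pow_succ', ← pow_add, ← hsD, ← pow_mul]
    refine pow_le_pow_of_le_one hs0.le hs1.le ?_
    have := Nat.lt_div_mul_add (a := n) hD
    nlinarith
  have h2 : r ^ (n / D) ≤ r⁻¹ * (s ^ n * s ^ n) := by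
    rw [← div_eq_inv_mul, le_div_iff₀ hr, mul_comm]
    exact h1
  calc (n : ℝ) * r ^ (n / D) ≤ n * (r⁻¹ * (s ^ n * s ^ n)) := by gcongr
    _ = n * s ^ n * r⁻¹ * s ^ n := by ring
    _ ≤ (M + 1) * r⁻¹ * s ^ n := by
        gcongr
        linarith [hM' n]

theorem expSmall_pow_div {r : ℝ} (hr0 : 0 ≤ r) (hr1 : r < 1) {D : ℕ} (hD : 0 < D) :
    ExpSmall fun n => ENNReal.ofReal (r ^ (n / D)) := by
  refine (expSmall_mul_pow_div hr0 hr1 hD).mono_eventually (fun n => ?_) 1 fun n hn => ?_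
  · rw [← ENNReal.ofReal_one]
    exact ENNReal.ofReal_le_ofReal (pow_le_one₀ hr0 hr1.le)
  · exact le_mul_of_one_le_left zero_le (by exact_mod_cast hn)

theorem ExpSmall.exists_le_exp {a : ℕ → ℝ≥0∞} (h : ExpSmall a) :
    ∃ C > (0 : ℝ), ∃ c > (0 : ℝ), ∀ n : ℕ,
      a n ≤ ENNReal.ofReal (C * Real.exp (-(⌈c * (n : ℝ)⌉₊ : ℝ))) := by
  obtain ⟨C, hC, r, hr, han⟩ := h
  have hlog : 0 < -Real.log r := neg_pos.2 (Real.log_neg hr.1 hr.2)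
  refine ⟨C * Real.exp 1, by positivity, -Real.log r, hlog, fun n =>
    (han n).trans (ENNReal.ofReal_le_ofReal ?_)⟩
  have h1 : (⌈-Real.log r * n⌉₊ : ℝ) ≤ -Real.log r * n + 1 :=
    (Nat.ceil_lt_add_one (by positivity)).le
  rw [mul_assoc, ← Real.exp_add]
  gcongr
  rw [← Real.exp_log hr.1, ← Real.exp_nat_mul, Real.log_exp]
  gcongr
  linarith

end ExpSmall

section ModelSelection

variable {𝒳 : Type*}

/-- The indices of the sample: cell `(T, i, j)` is the `j`-th point of the `i`-th batch used by the
`T`-th predictor; the remaining points form a validation set. -/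
abbrev Cell := (ℕ × ℕ × ℕ) ⊕ ℕ

/-- The number of batches for the `T`-th predictor with `n` sample points. -/
def numBatches (n T : ℕ) : ℕ := n / 4 / 2 ^ T / (T + 1)

theorem numBatches_eq (n T : ℕ) : numBatches n T = n / (4 * 2 ^ T * (T + 1)) := by
  rw [numBatches, Nat.div_div_eq_div_mul, Nat.div_div_eq_div_mul, mul_assoc]

/-- The cells used with `n` sample points. -/
def usedCells (n : ℕ) : Finset Cell :=
  ((Finset.range n).biUnion fun T =>
    ({T} ×ˢ Finset.range (numBatches n T) ×ˢ Finset.range T).map ⟨Sum.inl, Sum.inl_injective⟩) ∪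
    (Finset.range (n / 2)).map ⟨Sum.inr, Sum.inr_injective⟩

theorem card_usedCells_le (n : ℕ) : (usedCells n).card ≤ n := by
  refine (Finset.card_union_le _ _).trans ?_
  have h1 : ∀ T, numBatches n T * T ≤ n / 4 / 2 ^ T := by
    intro T
    calc numBatches n T * T ≤ numBatches n T * (T + 1) := by gcongr; omega
      _ ≤ n / 4 / 2 ^ T := Nat.div_mul_le_self _ _
  have h2 : ((Finset.range n).biUnion fun T =>
      (({T} ×ˢ Finset.range (numBatches n T) ×ˢ Finset.range T).map
        ⟨Sum.inl, Sum.inl_injective⟩ : Finset Cell)).card ≤ n / 2 := by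
    refine Finset.card_biUnion_le.trans ?_
    calc _ ≤ ∑ T ∈ Finset.range n, n / 4 / 2 ^ T :=
          Finset.sum_le_sum fun T _ => by simpa using h1 T
      _ ≤ n / 4 * 2 / (2 - 1) := Nat.geom_sum_le le_rfl _ _
      _ ≤ n / 2 := by omega
  rw [Finset.card_map, Finset.card_range]
  omega

variable (E : ℕ → Set ((ℕ → 𝒳 × Bool) × (𝒳 × Bool)))

/-- The number of batches of the `T`-th predictor that err on `z`. -/
noncomputable def hits (n T : ℕ) (ξ : Cell → 𝒳 × Bool) (z : 𝒳 × Bool) : ℕ :=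
  count (numBatches n T) fun i => ((fun j => ξ (.inl (T, i, j))), z) ∈ E T

/-- The `T`-th predictor passes the validation. -/
def Accepted (n : ℕ) (ξ : Cell → 𝒳 × Bool) (T : ℕ) : Prop :=
  ∀ v < n / 2, 16 * hits E n T ξ (ξ (.inr v)) ≤ numBatches n T

open Classical in
/-- Predict by the majority vote of the first predictor that passes the validation. -/
noncomputable def selectPredict (n : ℕ) (ξ : Cell → 𝒳 × Bool) (x : 𝒳) : Bool :=
  decide (∃ T < n, (Accepted E n ξ T ∧ ∀ T' < T, ¬ Accepted E n ξ T') ∧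
    2 * hits E n T ξ (x, true) < numBatches n T)

variable {E}

section Measurability

variable [MeasurableSpace 𝒳]

theorem measurable_hits (hE : ∀ T, MeasurableSet[univMS] (E T))
    {α : Type*} [MeasurableSpace α] {g : α → Cell → 𝒳 × Bool}
    {h : α → 𝒳 × Bool} (hg : Measurable g) (hh : Measurable h) (n T : ℕ) :
    Measurable[univMS] fun a => hits E n T (g a) (h a) :=
  measurable_count (mα := univMS) (fun i => measurableSet_univMS_preimage (hE T)
    (f := fun a => ((fun j => g a (.inl (T, i, j))), h a)) (by fun_prop)) _

theorem measurableSet_accepted (hE : ∀ T, MeasurableSet[univMS] (E T)) (n T : ℕ) :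
    MeasurableSet[univMS] {ξ : Cell → 𝒳 × Bool | Accepted E n ξ T} := by
  have : {ξ : Cell → 𝒳 × Bool | Accepted E n ξ T} = ⋂ v, ⋂ (_ : v < n / 2),
      {ξ | 16 * hits E n T ξ (ξ (.inr v)) ≤ numBatches n T} := by
    ext ξ
    simp [Accepted]
  rw [this]
  exact MeasurableSet.iInter fun v => MeasurableSet.iInter fun _ =>
    measurable_hits hE measurable_id (measurable_pi_apply (Sum.inr v)) n T
      (MeasurableSet.of_discrete (s := {c : ℕ | 16 * c ≤ numBatches n T}))

theorem measurable_selectPredict (hE : ∀ T, MeasurableSet[univMS] (E T)) (n : ℕ) :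
    Measurable[univMS] (Function.uncurry (selectPredict E n)) := by
  refine @measurable_to_bool _ univMS _ ?_
  have : Function.uncurry (selectPredict E n) ⁻¹' {true} = ⋃ T, ⋃ (_ : T < n),
      ((Prod.fst ⁻¹' ({ξ | Accepted E n ξ T} ∩ ⋂ T', ⋂ (_ : T' < T), {ξ | Accepted E n ξ T'}ᶜ)) ∩
        {q | 2 * hits E n T q.1 (q.2, true) < numBatches n T}) := by
    ext q
    simp only [selectPredict, Function.uncurry, mem_preimage, mem_singleton_iff, decide_eq_true_iff,
      mem_iUnion, mem_inter_iff, mem_iInter, mem_compl_iff, mem_ofPred_eq, exists_prop]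
  rw [this]
  refine MeasurableSet.iUnion fun T => MeasurableSet.iUnion fun _ => MeasurableSet.inter
    (measurableSet_univMS_preimage (MeasurableSet.inter (measurableSet_accepted hE n T)
      (MeasurableSet.iInter fun T' => MeasurableSet.iInter fun _ =>
        MeasurableSet.compl (measurableSet_accepted hE n T'))) measurable_fst) ?_
  exact measurable_hits hE measurable_fst (by fun_prop) n T
    (MeasurableSet.of_discrete (s := {c : ℕ | 2 * c < numBatches n T}))

end Measurability

theorem hits_congr (hdep : ∀ T B B' z, (∀ j < T, B j = B' j) → ((B, z) ∈ E T ↔ (B', z) ∈ E T))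
    {n T : ℕ} (hT : T < n) {ξ ξ' : Cell → 𝒳 × Bool} (h : ∀ i ∈ usedCells n, ξ i = ξ' i)
    (z : 𝒳 × Bool) : hits E n T ξ z = hits E n T ξ' z := by
  refine count_congr fun i hi => hdep T _ _ z fun j hj => h _ ?_
  simp [usedCells, hi, hj, hT]

theorem selectPredict_congr
    (hdep : ∀ T B B' z, (∀ j < T, B j = B' j) → ((B, z) ∈ E T ↔ (B', z) ∈ E T))
    {n : ℕ} {ξ ξ' : Cell → 𝒳 × Bool} (h : ∀ i ∈ usedCells n, ξ i = ξ' i) :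
    selectPredict E n ξ = selectPredict E n ξ' := by
  have h1 : ∀ T < n, Accepted E n ξ T ↔ Accepted E n ξ' T := by
    intro T hT
    refine forall₂_congr fun v hv => ?_
    rw [hits_congr hdep hT h, h (.inr v) (by simp [usedCells, hv])]
  funext x
  refine decide_eq_decide.2 (exists_congr fun T => and_congr_right fun hT => ?_)
  rw [hits_congr hdep hT h, h1 T hT, forall₂_congr fun T' hT' => not_congr (h1 T' (hT'.trans hT))]

/-- A wrong majority vote means that many batches err. -/
theorem le_hits_of_selectPredict_ne (hbool : ∀ T B x, (B, (x, true)) ∈ E T ↔ (B, (x, false)) ∉ E T)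
    {n T : ℕ} {ξ : Cell → 𝒳 × Bool} {z : 𝒳 × Bool} (hT : T < n) (hacc : Accepted E n ξ T)
    (hmin : ∀ T' < T, ¬ Accepted E n ξ T') (h : selectPredict E n ξ z.1 ≠ z.2) :
    numBatches n T ≤ 2 * hits E n T ξ z := by
  have huniq : ∀ T', (Accepted E n ξ T' ∧ ∀ T'' < T', ¬ Accepted E n ξ T'') → T' = T := by
    rintro T' ⟨h1, h2⟩
    rcases lt_trichotomy T' T with h3 | h3 | h3
    · exact absurd h1 (hmin T' h3)
    · exact h3
    · exact absurd hacc (h2 T h3)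
  have hpred : selectPredict E n ξ z.1 = true ↔ 2 * hits E n T ξ (z.1, true) < numBatches n T := by
    refine (@decide_eq_true_iff _ (_)).trans ?_
    constructor
    · rintro ⟨T', -, h1, h2⟩
      rwa [huniq T' h1] at h2
    · exact fun h2 => ⟨T, hT, ⟨hacc, hmin⟩, h2⟩
  obtain ⟨x, y⟩ := z
  cases y with
  | true =>
    by_contra hlt
    exact h (hpred.2 (not_le.1 hlt))
  | false =>
    have h1 : selectPredict E n ξ x = true := by simpa using h
    have h2 := hpred.1 h1
    have h3 := count_add_count_not (numBatches n T)
      fun i => ((fun j => ξ (.inl (T, i, j))), (x, true)) ∈ E T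
    have h4 : count (numBatches n T) (fun i => ((fun j => ξ (.inl (T, i, j))), (x, true)) ∉ E T) =
        hits E n T ξ (x, false) :=
      count_congr fun i _ => by rw [hbool, not_not]
    rw [h4] at h3
    change 2 * hits E n T ξ (x, true) < numBatches n T at h2
    have h5 : count (numBatches n T) (fun i => ((fun j => ξ (.inl (T, i, j))), (x, true)) ∈ E T) =
        hits E n T ξ (x, true) := rfl
    omega

end ModelSelection

section ModelSelectionRate

variable {𝒳 : Type*} [MeasurableSpace 𝒳] {E : ℕ → Set ((ℕ → 𝒳 × Bool) × (𝒳 × Bool))}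
  (P : Measure (𝒳 × Bool)) [IsProbabilityMeasure P]

theorem measurePreserving_batches (T : ℕ) :
    MeasurePreserving (fun (ξ : Cell → 𝒳 × Bool) i j => ξ (.inl (T, i, j))) (iid P Cell)
      (iid (iid P ℕ) ℕ) := by
  have hσ : Function.Injective fun p : ℕ × ℕ => (Sum.inl (T, p.1, p.2) : Cell) := by
    rintro ⟨i, j⟩ ⟨i', j'⟩ h
    simpa using h
  exact (measurePreserving_curry P).comp (measurePreserving_comp_injective P hσ)

theorem measurePreserving_batches_test (T : ℕ) :
    MeasurePreserving (fun q : (Cell → 𝒳 × Bool) × (𝒳 × Bool) =>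
      ((fun i j => q.1 (.inl (T, i, j)) : ℕ → ℕ → 𝒳 × Bool), q.2)) ((iid P Cell).prod P)
      ((iid (iid P ℕ) ℕ).prod P) :=
  (measurePreserving_batches P T).prod (MeasurePreserving.id P)

theorem measurePreserving_batches_validation (T v : ℕ) :
    MeasurePreserving (fun ξ : Cell → 𝒳 × Bool =>
      ((fun i j => ξ (.inl (T, i, j)) : ℕ → ℕ → 𝒳 × Bool), ξ (.inr v))) (iid P Cell)
      ((iid (iid P ℕ) ℕ).prod P) := by
  have hσ : Function.Injective fun p : ℕ × ℕ => (Sum.inl (T, p.1, p.2) : Cell) := by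
    rintro ⟨i, j⟩ ⟨i', j'⟩ h
    simpa using h
  exact ((measurePreserving_curry P).prod (MeasurePreserving.id P)).comp
    (measurePreserving_pair_point P hσ (l := .inr v) fun _ => by simp)

theorem expSmall_pow_numBatches {r : ℝ} (hr0 : 0 ≤ r) (hr1 : r < 1) (T : ℕ) :
    ExpSmall fun n => ENNReal.ofReal (r ^ numBatches n T) := by
  simp only [numBatches_eq]
  exact expSmall_pow_div hr0 hr1 (by positivity)

theorem expSmall_mul_pow_numBatches {r : ℝ} (hr0 : 0 ≤ r) (hr1 : r < 1) (T : ℕ) :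
    ExpSmall fun n => n * ENNReal.ofReal (r ^ numBatches n T) := by
  simp only [numBatches_eq]
  exact expSmall_mul_pow_div hr0 hr1 (by positivity)

theorem iid_forall_mem_le {Z : Type*} [MeasurableSpace Z] (P : Measure Z) [IsProbabilityMeasure P]
    (S : Set Z) (N : ℕ) : iid P ℕ {ξ | ∀ v < N, ξ v ∈ S} ≤ P S ^ N := by
  have h1 : {ξ : ℕ → Z | ∀ v < N, ξ v ∈ S} ⊆
      Set.pi (Finset.range N) fun _ => toMeasurable P S := fun ξ hξ v hv =>
    subset_toMeasurable P S (hξ v (by simpa using hv))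
  refine (measure_mono h1).trans ?_
  rw [iid, Measure.infinitePi_pi _ fun _ _ => measurableSet_toMeasurable _ _]
  simp

theorem measurable_err_prob (hE : ∀ T, MeasurableSet[univMS] (E T)) (T : ℕ) :
    Measurable[univMS] fun z => iid P ℕ ((fun w => (w, z)) ⁻¹' E T) :=
  measurable_univMS_measure_prodMk (measurableSet_univMS_preimage (hE T) measurable_swap) (iid P ℕ)

theorem expSmall_accepted (hE : ∀ T, MeasurableSet[univMS] (E T)) (T : ℕ) :
    ExpSmall fun n => ((iid P Cell).prod P)
    {q | Accepted E n q.1 T ∧ numBatches n T ≤ 2 * hits E n T q.1 q.2} := by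
  have hp := measurable_err_prob P hE T
  let S : Set (𝒳 × Bool) := {z | iid P ℕ ((fun w => (w, z)) ⁻¹' E T) ≤ ENNReal.ofReal (1 / 4)}
  have hS : MeasurableSet[univMS] S := hp measurableSet_Iic
  by_cases h0 : P Sᶜ = 0
  · refine (expSmall_pow_numBatches (r := 7 / 8) (by norm_num) (by norm_num) T).mono fun n => ?_
    let A : Set ((ℕ → ℕ → 𝒳 × Bool) × (𝒳 × Bool)) := {q | q.2 ∈ S ∧
      1 * numBatches n T ≤ 2 * count (numBatches n T) fun i => (q.1 i, q.2) ∈ E T}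
    have hA := measure_prod_count_ge_le (iid P ℕ) P (hE T) (p := 1 / 4) (x := 2) (r := 7 / 8)
      (k := 1) (l := 2) (by norm_num) (by norm_num) (by norm_num) (numBatches n T) hS
      fun v hv => hv
    have hAm : NullMeasurableSet A ((iid (iid P ℕ) ℕ).prod P) := by
      refine MeasurableSet.nullMeasurableSet_of_univMS ?_ _
      refine MeasurableSet.inter (measurableSet_univMS_preimage hS measurable_snd) ?_
      exact measurable_count (mα := univMS) (fun i => measurableSet_univMS_preimage (hE T)
        (f := fun q : (ℕ → ℕ → 𝒳 × Bool) × (𝒳 × Bool) => (q.1 i, q.2)) (by fun_prop))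
        (numBatches n T) (MeasurableSet.of_discrete (s := {c : ℕ | 1 * numBatches n T ≤ 2 * c}))
    have hsub : {q : (Cell → 𝒳 × Bool) × (𝒳 × Bool) | Accepted E n q.1 T ∧
        numBatches n T ≤ 2 * hits E n T q.1 q.2} ⊆
        Prod.snd ⁻¹' Sᶜ ∪ (fun q : (Cell → 𝒳 × Bool) × (𝒳 × Bool) =>
          ((fun i j => q.1 (.inl (T, i, j)) : ℕ → ℕ → 𝒳 × Bool), q.2)) ⁻¹' A := by
      rintro q ⟨-, hq⟩
      by_cases hqS : q.2 ∈ S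
      · exact Or.inr ⟨hqS, by rw [one_mul]; exact hq⟩
      · exact Or.inl hqS
    refine (measure_mono hsub).trans ((measure_union_le _ _).trans ?_)
    rw [(measurePreserving_batches_test P T).measure_preimage hAm,
      (measurePreserving_snd (μ := iid P Cell) (ν := P)).measure_preimage
        (hS.nullMeasurableSet_of_univMS P).compl, h0, zero_add]
    exact hA
  · have hS1 : P.real S < 1 := by
      have h2 : P S ≠ 1 := fun h => h0 (by
        rw [prob_compl_eq_one_sub₀ (hS.nullMeasurableSet_of_univMS P), h, tsub_self])
      exact (ENNReal.toReal_lt_toReal (measure_ne_top _ _) ENNReal.one_ne_top).2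
        (lt_of_le_of_ne prob_le_one h2)
    have hsum := (expSmall_pow_div (r := P.real S) measureReal_nonneg hS1 two_pos).add
      (expSmall_mul_pow_numBatches (r := 9 / 10) (by norm_num) (by norm_num) T)
    refine hsum.mono fun n => ?_
    let A : Set ((ℕ → ℕ → 𝒳 × Bool) × (𝒳 × Bool)) := {q | q.2 ∈ Sᶜ ∧
      15 * numBatches n T ≤ 16 * count (numBatches n T) fun i => (q.1 i, q.2) ∈ (E T)ᶜ}
    have hEc : MeasurableSet[univMS] (E T)ᶜ := MeasurableSet.compl (hE T)
    have hSc : MeasurableSet[univMS] Sᶜ := MeasurableSet.compl hS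
    have hA := measure_prod_count_ge_le (iid P ℕ) P hEc (p := 3 / 4)
      (x := 11 / 10) (r := 9 / 10) (k := 15) (l := 16) (by norm_num) (by norm_num) (by norm_num)
      (numBatches n T) hSc fun v hv => by
        have h1 : ENNReal.ofReal (1 / 4) < iid P ℕ ((fun w => (w, v)) ⁻¹' E T) := not_le.1 hv
        have h2 : NullMeasurableSet ((fun w => (w, v)) ⁻¹' E T) (iid P ℕ) :=
          (measurableSet_univMS_preimage (hE T) (by fun_prop)).nullMeasurableSet_of_univMS _
        rw [preimage_compl, prob_compl_eq_one_sub₀ h2]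
        refine (tsub_le_tsub_left h1.le 1).trans ?_
        rw [← ENNReal.ofReal_one, ← ENNReal.ofReal_sub _ (by norm_num)]
        norm_num
    have hAm : NullMeasurableSet A ((iid (iid P ℕ) ℕ).prod P) := by
      refine MeasurableSet.nullMeasurableSet_of_univMS ?_ _
      refine MeasurableSet.inter (measurableSet_univMS_preimage hSc measurable_snd) ?_
      exact measurable_count (mα := univMS) (fun i => measurableSet_univMS_preimage hEc
        (f := fun q : (ℕ → ℕ → 𝒳 × Bool) × (𝒳 × Bool) => (q.1 i, q.2)) (by fun_prop))
        (numBatches n T) (MeasurableSet.of_discrete (s := {c : ℕ | 15 * numBatches n T ≤ 16 * c}))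
    have hsub : {q : (Cell → 𝒳 × Bool) × (𝒳 × Bool) | Accepted E n q.1 T ∧
        numBatches n T ≤ 2 * hits E n T q.1 q.2} ⊆ Prod.fst ⁻¹' {ξ | Accepted E n ξ T} :=
      fun q hq => hq.1
    have hsub2 : {ξ : Cell → 𝒳 × Bool | Accepted E n ξ T} ⊆
        (fun ξ v => ξ (.inr v)) ⁻¹' {η : ℕ → 𝒳 × Bool | ∀ v < n / 2, η v ∈ S} ∪
        ⋃ v ∈ Finset.range (n / 2), (fun ξ : Cell → 𝒳 × Bool =>
          ((fun i j => ξ (.inl (T, i, j)) : ℕ → ℕ → 𝒳 × Bool), ξ (.inr v))) ⁻¹' A := by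
      intro ξ hξ
      by_cases h : ∀ v < n / 2, ξ (.inr v) ∈ S
      · exact Or.inl h
      · push Not at h
        obtain ⟨v, hv, hvS⟩ := h
        refine Or.inr (mem_biUnion (by simpa using hv) ⟨hvS, ?_⟩)
        have h1 := hξ v hv
        have h2 := count_add_count_not (numBatches n T)
          fun i => ((fun j => ξ (.inl (T, i, j))), ξ (.inr v)) ∈ E T
        unfold hits at h1
        simp only [mem_compl_iff]
        omega
    have hSm : NullMeasurableSet {η : ℕ → 𝒳 × Bool | ∀ v < n / 2, η v ∈ S} (iid P ℕ) := by
      refine MeasurableSet.nullMeasurableSet_of_univMS ?_ _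
      have : {η : ℕ → 𝒳 × Bool | ∀ v < n / 2, η v ∈ S} =
          ⋂ v, ⋂ (_ : v < n / 2), (fun η => η v) ⁻¹' S := by
        ext
        simp
      rw [this]
      exact MeasurableSet.iInter fun v => MeasurableSet.iInter fun _ =>
        measurableSet_univMS_preimage hS (measurable_pi_apply v)
    refine (measure_mono hsub).trans ?_
    rw [(measurePreserving_fst (μ := iid P Cell) (ν := P)).measure_preimage
        ((measurableSet_accepted hE n T).nullMeasurableSet_of_univMS _)]
    refine (measure_mono hsub2).trans ((measure_union_le _ _).trans (add_le_add ?_ ?_))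
    · rw [(measurePreserving_comp_injective P (σ := (Sum.inr : ℕ → Cell))
        Sum.inr_injective).measure_preimage hSm]
      refine (iid_forall_mem_le P S _).trans (le_of_eq ?_)
      rw [ENNReal.ofReal_pow measureReal_nonneg, ofReal_measureReal]
    · refine (measure_biUnion_finset_le _ _).trans ?_
      calc _ ≤ ∑ v ∈ Finset.range (n / 2), ENNReal.ofReal ((9 / 10) ^ numBatches n T) :=
            Finset.sum_le_sum fun v _ => by
              rw [(measurePreserving_batches_validation P T v).measure_preimage hAm]
              exact hA
        _ = (n / 2 : ℕ) * ENNReal.ofReal ((9 / 10) ^ numBatches n T) := by simp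
        _ ≤ n * ENNReal.ofReal ((9 / 10) ^ numBatches n T) := by
            gcongr
            exact Nat.div_le_self n 2

theorem expSmall_not_accepted (hE : ∀ T, MeasurableSet[univMS] (E T)) (T : ℕ)
    (hgood : iid P ℕ {B | P (Prod.mk B ⁻¹' E T) ≠ 0} ≤ ENNReal.ofReal (1 / 2 ^ 32)) :
    ExpSmall fun n => ((iid P Cell).prod P) {q | Accepted E n q.1 T →
      numBatches n T ≤ 2 * hits E n T q.1 q.2} := by
  refine (expSmall_pow_numBatches (r := 1 / 2) (by norm_num) (by norm_num) T).mono fun n => ?_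
  let Bad : Set (ℕ → 𝒳 × Bool) := {B | P (Prod.mk B ⁻¹' E T) ≠ 0}
  have hBad : MeasurableSet[univMS] Bad :=
    measurable_univMS_measure_prodMk (hE T) P (measurableSet_singleton 0).compl
  let C : Set (ℕ → ℕ → 𝒳 × Bool) := {b | 1 * numBatches n T ≤ 16 *
    count (numBatches n T) fun i => b i ∈ Bad}
  have hCle : iid (iid P ℕ) ℕ C ≤ ENNReal.ofReal ((1 / 2) ^ numBatches n T) :=
    measure_count_ge_le (iid P ℕ) (p := 1 / 2 ^ 32) (x := 4) (r := 1 / 2) (k := 1) (l := 16)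
      (by norm_num) (by norm_num) hgood (by norm_num) _
  have hC : MeasurableSet[univMS] C :=
    measurable_count (mα := univMS) (fun i => measurableSet_univMS_preimage hBad
      (measurable_pi_apply i)) (numBatches n T)
      (MeasurableSet.of_discrete (s := {c : ℕ | 1 * numBatches n T ≤ 16 * c}))
  let D : Set ((ℕ → ℕ → 𝒳 × Bool) × (𝒳 × Bool)) := ⋃ i, {q | q.1 i ∉ Bad ∧ (q.1 i, q.2) ∈ E T}
  have hD : MeasurableSet[univMS] D := MeasurableSet.iUnion fun i =>
    MeasurableSet.inter (MeasurableSet.compl (measurableSet_univMS_preimage hBad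
      (f := fun q : (ℕ → ℕ → 𝒳 × Bool) × (𝒳 × Bool) => q.1 i) (by fun_prop)))
      (measurableSet_univMS_preimage (hE T)
        (f := fun q : (ℕ → ℕ → 𝒳 × Bool) × (𝒳 × Bool) => (q.1 i, q.2)) (by fun_prop))
  have hD0 : ((iid (iid P ℕ) ℕ).prod P) D = 0 := by
    refine le_antisymm (measure_prod_le_of_slices hD _ _ (ae_of_all _ fun b => ?_)) zero_le
    refine le_of_eq ?_
    rw [show Prod.mk b ⁻¹' D = ⋃ i, {z | b i ∉ Bad ∧ (b i, z) ∈ E T} by ext; simp [D]]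
    refine measure_iUnion_null fun i => ?_
    by_cases hi : b i ∈ Bad
    · simp [hi]
    · exact measure_mono_null (fun z hz => hz.2) (not_not.1 hi)
  have hsub : {q : (Cell → 𝒳 × Bool) × (𝒳 × Bool) | Accepted E n q.1 T →
      numBatches n T ≤ 2 * hits E n T q.1 q.2} ⊆
      (Prod.fst ⁻¹' ((fun (ξ : Cell → 𝒳 × Bool) i j => ξ (.inl (T, i, j))) ⁻¹' C)) ∪
      ((fun q : (Cell → 𝒳 × Bool) × (𝒳 × Bool) =>
        ((fun i j => q.1 (.inl (T, i, j)) : ℕ → ℕ → 𝒳 × Bool), q.2)) ⁻¹' D ∪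
      Prod.fst ⁻¹' ⋃ v, (fun ξ : Cell → 𝒳 × Bool =>
        ((fun i j => ξ (.inl (T, i, j)) : ℕ → ℕ → 𝒳 × Bool), ξ (.inr v))) ⁻¹' D) := by
    rintro ⟨ξ, z⟩ hq
    by_contra hn
    simp only [mem_union, mem_preimage, mem_iUnion, not_or, not_exists] at hn
    obtain ⟨h1, h2, h3⟩ := hn
    have key : ∀ z', ((fun i j => ξ (.inl (T, i, j)) : ℕ → ℕ → 𝒳 × Bool), z') ∉ D →
        hits E n T ξ z' ≤ count (numBatches n T) fun i => (fun j => ξ (.inl (T, i, j))) ∈ Bad := by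
      intro z' hz'
      refine count_mono fun i _ hi => ?_
      by_contra hb
      exact hz' (mem_iUnion.2 ⟨i, hb, hi⟩)
    have h4 : 16 * (count (numBatches n T) fun i => (fun j => ξ (.inl (T, i, j))) ∈ Bad) <
        numBatches n T := by
      by_contra h
      refine h1 (?_ : 1 * numBatches n T ≤ _)
      rw [one_mul]
      exact not_lt.1 h
    have h5 : numBatches n T ≤ 2 * hits E n T ξ z := hq fun v _ => by
      have := key _ (h3 v)
      simp only
      omega
    have := key _ h2
    omega
  refine (measure_mono hsub).trans ((measure_union_le _ _).trans ?_)
  have hbat := measurePreserving_batches P T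
  have hfst := measurePreserving_fst (μ := iid P Cell) (ν := P)
  have hCn : NullMeasurableSet C (iid (iid P ℕ) ℕ) := hC.nullMeasurableSet_of_univMS _
  have hDn : NullMeasurableSet D ((iid (iid P ℕ) ℕ).prod P) := hD.nullMeasurableSet_of_univMS _
  have e1 : ((iid P Cell).prod P) (Prod.fst ⁻¹'
      ((fun (ξ : Cell → 𝒳 × Bool) i j => ξ (.inl (T, i, j))) ⁻¹' C)) = iid (iid P ℕ) ℕ C :=
    (hbat.comp hfst).measure_preimage hCn
  have e3 : ((iid P Cell).prod P) (Prod.fst ⁻¹' ⋃ v, (fun ξ : Cell → 𝒳 × Bool =>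
      ((fun i j => ξ (.inl (T, i, j)) : ℕ → ℕ → 𝒳 × Bool), ξ (.inr v))) ⁻¹' D) = 0 := by
    rw [preimage_iUnion]
    refine measure_iUnion_null fun v => ?_
    have := ((measurePreserving_batches_validation P T v).comp hfst).measure_preimage hDn
    rwa [hD0] at this
  have e2 := (measurePreserving_batches_test P T).measure_preimage hDn
  rw [hD0] at e2
  rw [e1]
  refine (add_le_add hCle (measure_union_le _ _)).trans ?_
  rw [e2, e3]
  simp

/-- If one of countably many predictors, trained on a batch, is almost surely perfect with
probability close to one, then model selection learns at an exponential rate. -/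
theorem expSmall_selectPredict (hE : ∀ T, MeasurableSet[univMS] (E T))
    (hbool : ∀ T B x, (B, (x, true)) ∈ E T ↔ (B, (x, false)) ∉ E T) {T : ℕ}
    (hgood : iid P ℕ {B | P (Prod.mk B ⁻¹' E T) ≠ 0} ≤ ENNReal.ofReal (1 / 2 ^ 32)) :
    ExpSmall fun n => ((iid P Cell).prod P) {q | selectPredict E n q.1 q.2.1 ≠ q.2.2} := by
  have hsum := (ExpSmall.sum (Finset.range T) fun T' _ => expSmall_accepted P hE T').add
    (expSmall_not_accepted P hE T hgood)
  refine hsum.mono_eventually (fun n => prob_le_one) (T + 1) fun n hn => ?_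
  refine le_trans (measure_mono ?_) ((measure_union_le _ _).trans
    (add_le_add (measure_biUnion_finset_le _ _) le_rfl))
  intro q hq
  by_cases hacc : ∃ T' < T, Accepted E n q.1 T'
  · classical
    have hex : ∃ T', Accepted E n q.1 T' := hacc.imp fun _ h => h.2
    have hlt : Nat.find hex < T := by
      obtain ⟨T', hT', h⟩ := hacc
      exact (Nat.find_min' hex h).trans_lt hT'
    refine Or.inl (mem_biUnion (x := Nat.find hex) (by simpa using hlt)
      ⟨Nat.find_spec hex, ?_⟩)
    exact le_hits_of_selectPredict_ne hbool (by omega) (Nat.find_spec hex)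
      (fun _ => Nat.find_min hex) hq
  · push Not at hacc
    exact Or.inr fun h => le_hits_of_selectPredict_ne hbool (by omega) h hacc hq

end ModelSelectionRate

section Exponential

variable {𝒳 Θ : Type*} [TopologicalSpace 𝒳] [PolishSpace 𝒳] [MeasurableSpace 𝒳] [BorelSpace 𝒳]
  [Inhabited 𝒳] [TopologicalSpace Θ] [PolishSpace Θ] [MeasurableSpace Θ] [BorelSpace Θ]
  [Nonempty Θ] {f : Θ → 𝒳 → Bool}

/-- Classes without infinite Littlestone tree are learnable at an exponential rate. -/
theorem learnableAtRate_exp (hf : Measurable (Function.uncurry f))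
    (h : ¬ HasTree f fun _ => 1) :
    LearnableAtRate (range f) fun n => Real.exp (-(n : ℝ)) := by
  obtain ⟨φ, hφ, hterm⟩ := exists_strategy hf h
  set m : ℕ → ℕ := fun _ => 1 with hm
  let E : ℕ → Set ((ℕ → 𝒳 × Bool) × (𝒳 × Bool)) := fun T =>
    {q | Hit m φ (state m φ (fun j _ => q.1 j) T) fun _ => q.2}
  have hE : ∀ T, MeasurableSet[univMS] (E T) := fun T =>
    measurable_univMS_univMS ((measurable_univMS_comp (measurable_state hφ T)
      (measurable_univMS (f := fun q : (ℕ → 𝒳 × Bool) × (𝒳 × Bool) => fun j (_ : ℕ) => q.1 j)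
        (by fun_prop))).prodMk (measurable_univMS
      (f := fun q : (ℕ → 𝒳 × Bool) × (𝒳 × Bool) => fun _ : ℕ => q.2) (by fun_prop)))
      (measurableSet_hit hφ)
  have hdep : ∀ T B B' z, (∀ j < T, B j = B' j) → ((B, z) ∈ E T ↔ (B', z) ∈ E T) := by
    intro T B B' z hB
    have : state m φ (fun j (_ : ℕ) => B j) T = state m φ (fun j _ => B' j) T :=
      state_congr fun j hj _ _ _ _ => hB j hj
    simp only [E, mem_ofPred_eq, this]
  have hbool : ∀ T B x, (B, (x, true)) ∈ E T ↔ (B, (x, false)) ∉ E T := by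
    intro T B x
    simp only [E, mem_ofPred_eq, Hit, hm, Nat.lt_one_iff, forall_eq]
    have : (fun i => (trunc 1 (fun _ : ℕ => (x, true)) i).1) =
        fun i => (trunc 1 (fun _ : ℕ => (x, false)) i).1 := by
      funext i
      by_cases hi : i < 1 <;> simp [trunc, hi]
    rw [this]
    simp
  obtain ⟨A, hA⟩ := exists_learningAlgorithm usedCells card_usedCells_le
    (measurable_selectPredict hE) fun n ξ ξ' hξ => selectPredict_congr hdep hξ
  refine ⟨A, fun P _ hP => ?_⟩
  simp only [hA P]
  obtain ⟨T, hT⟩ := exists_forall_measure_not_good_le (m := m) hφ hterm hf hP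
    (ε := ENNReal.ofReal (1 / 2 ^ 32)) (by simp)
  refine (expSmall_selectPredict P hE hbool (T := T) (le_trans ?_ (hT T le_rfl))).exists_le_exp
  have hmp1 : MeasurePreserving (fun (ξ : ℕ × ℕ → 𝒳 × Bool) j => ξ (j, 0)) (iid P (ℕ × ℕ))
      (iid P ℕ) := measurePreserving_comp_injective P fun i j hij => by simpa using hij
  have hmp2 := measurePreserving_curry P (I := ℕ) (J := ℕ)
  have hm1 : MeasurableSet[univMS] {B | P (Prod.mk B ⁻¹' E T) ≠ 0} :=
    measurable_univMS_measure_prodMk (hE T) P (measurableSet_singleton 0).compl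
  have hm2 : MeasurableSet[univMS] {B | ¬ Good m φ P (state m φ B T)} :=
    MeasurableSet.compl (measurable_univMS_univMS (measurable_state hφ T) (measurableSet_good hφ))
  have hsub : {B | ¬ Good m φ P (state m φ B T)} ⊆
      {B | ¬ (Good m φ P (state m φ B T) ∧ (state m φ B T).1 ≤ T)} := fun B hB h => hB h.1
  refine le_trans (le_of_eq ?_) (measure_mono hsub)
  rw [← hmp1.measure_preimage (hm1.nullMeasurableSet_of_univMS _),
    ← hmp2.measure_preimage (hm2.nullMeasurableSet_of_univMS _)]
  congr 1
  ext ξ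
  refine not_congr ?_
  have hst : state m φ (fun j (_ : ℕ) => ξ (j, 0)) T = state m φ (fun j k => ξ (j, k)) T :=
    state_congr fun j _ k _ i hi => by rw [show i = 0 by simpa [hm] using hi]
  have hHm : MeasurableSet[univMS] {z : 𝒳 × Bool | Hit m φ (state m φ (fun j k => ξ (j, k)) T)
      fun _ => z} :=
    measurableSet_univMS_preimage (measurableSet_hit (m := m) hφ)
      (f := fun z : 𝒳 × Bool => (state m φ (fun j k => ξ (j, k)) T, fun _ : ℕ => z))
      (by fun_prop)
  have h0 := (measurePreserving_eval_infinitePi (fun _ : ℕ => P) 0).measure_preimage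
    (hHm.nullMeasurableSet_of_univMS P)
  change P (Prod.mk (fun j => ξ (j, 0)) ⁻¹' E T) = 0 ↔
    iid P ℕ {b | Hit m φ (state m φ (fun j k => ξ (j, k)) T) b} = 0
  have e1 : (Function.eval 0 ⁻¹' {z : 𝒳 × Bool | Hit m φ (state m φ (fun j k => ξ (j, k)) T)
      fun _ => z} : Set (ℕ → 𝒳 × Bool)) = {b | Hit m φ (state m φ (fun j k => ξ (j, k)) T) b} := by
    ext b
    exact hit_congr fun i hi => by rw [show i = 0 by simpa [hm] using hi]
  rw [← e1, h0]
  simp only [E, ← hst]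
  rfl

end Exponential

end UniversalLearning

namespace UniversalLearning

open Finset

section OneInclusion

variable {α : Type*} [DecidableEq α]

/-- The edges in direction `a` of the one-inclusion graph of a family, represented by their lower
ends. -/
def edges (a : α) (𝒜 : Finset (Finset α)) : Finset (Finset α) :=
  𝒜.memberSubfamily a ∩ 𝒜.nonMemberSubfamily a

theorem mem_edges {a : α} {𝒜 : Finset (Finset α)} {s : Finset α} :
    s ∈ edges a 𝒜 ↔ insert a s ∈ 𝒜 ∧ s ∈ 𝒜 ∧ a ∉ s := by
  simp only [edges, mem_inter, mem_memberSubfamily, mem_nonMemberSubfamily]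
  tauto

theorem notMem_of_shatters {a : α} {𝒜 : Finset (Finset α)} {s : Finset α} (h : ∀ t ∈ 𝒜, a ∉ t)
    (hs : 𝒜.Shatters s) : a ∉ s := by
  obtain ⟨t, ht, hst⟩ := hs.exists_superset
  exact fun ha => h t ht (hst ha)

theorem card_edges_add_le (a : α) (𝒜 ℬ : Finset (Finset α)) :
    (edges a 𝒜).card + (edges a ℬ).card ≤ (edges a (𝒜 ∪ ℬ)).card + (edges a (𝒜 ∩ ℬ)).card := by
  rw [← card_union_add_card_inter]
  refine add_le_add (card_le_card fun s => ?_) (card_le_card fun s => ?_)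
  · simp only [mem_union, mem_edges]
    tauto
  · simp only [mem_inter, mem_edges]
    tauto

theorem card_edges_split {a b : α} (hab : a ≠ b) (𝒜 : Finset (Finset α)) :
    (edges a 𝒜).card =
      (edges a (𝒜.memberSubfamily b)).card + (edges a (𝒜.nonMemberSubfamily b)).card := by
  rw [← card_memberSubfamily_add_card_nonMemberSubfamily b (edges a 𝒜)]
  congr 2
  · ext s
    simp only [mem_memberSubfamily, mem_edges, mem_insert, insert_comm a b]
    tauto
  · ext s
    simp only [mem_nonMemberSubfamily, mem_edges, mem_insert]
    tauto

/-- The one-inclusion graph of a family that shatters only sets of size at most `d` has density at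
most `d`. -/
theorem sum_card_edges_le (U : Finset α) : ∀ (𝒜 : Finset (Finset α)) (d : ℕ), (∀ s ∈ 𝒜, s ⊆ U) →
    (∀ s, 𝒜.Shatters s → s.card ≤ d) → ∑ a ∈ U, (edges a 𝒜).card ≤ d * 𝒜.card := by
  induction U using Finset.induction_on with
  | empty => simp
  | insert b U hb ih =>
    intro 𝒜 d hU hd
    set 𝒜₁ := 𝒜.memberSubfamily b with h1
    set 𝒜₀ := 𝒜.nonMemberSubfamily b with h0
    have hsub : ∀ s ∈ 𝒜₁ ∪ 𝒜₀, s ⊆ U := by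
      intro s hs
      rw [mem_union, h1, h0, mem_memberSubfamily, mem_nonMemberSubfamily] at hs
      rcases hs with ⟨h, hbs⟩ | ⟨h, hbs⟩
      · exact (subset_insert_iff_of_notMem hbs).1 ((subset_insert b s).trans (hU _ h))
      · exact (subset_insert_iff_of_notMem hbs).1 (hU _ h)
    have hnot : ∀ s ∈ 𝒜₁ ∪ 𝒜₀, b ∉ s := fun s hs hbs => hb (hsub s hs hbs)
    have hunion : ∑ a ∈ U, (edges a (𝒜₁ ∪ 𝒜₀)).card ≤ d * (𝒜₁ ∪ 𝒜₀).card := by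
      refine ih _ d hsub fun s hs => hd s fun t ht => ?_
      have hbs := notMem_of_shatters hnot hs
      obtain ⟨u, hu, rfl⟩ := hs ht
      rw [mem_union, h1, h0, mem_memberSubfamily, mem_nonMemberSubfamily] at hu
      rcases hu with ⟨h, -⟩ | ⟨h, -⟩
      · exact ⟨_, h, by rw [inter_insert_of_notMem hbs]⟩
      · exact ⟨_, h, rfl⟩
    have hinter : ∑ a ∈ U, (edges a (𝒜₁ ∩ 𝒜₀)).card + (𝒜₁ ∩ 𝒜₀).card ≤
        d * (𝒜₁ ∩ 𝒜₀).card := by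
      have hsh : ∀ s, (𝒜₁ ∩ 𝒜₀).Shatters s → s.card + 1 ≤ d := by
        intro s hs
        have hbs := notMem_of_shatters
          (fun t ht => hnot t (mem_union_left _ (mem_inter.1 ht).1)) hs
        rw [← card_insert_of_notMem hbs]
        refine hd _ fun t ht => ?_
        obtain ⟨u, hu, hut⟩ := hs (t := t.erase b) (by
          rw [← subset_insert_iff]
          exact ht)
        rw [mem_inter, h1, h0, mem_memberSubfamily, mem_nonMemberSubfamily] at hu
        by_cases hbt : b ∈ t
        · refine ⟨_, hu.1.1, ?_⟩
          rw [← insert_inter_distrib, hut, insert_erase hbt]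
        · refine ⟨_, hu.2.1, ?_⟩
          rw [insert_inter_of_notMem hu.2.2, hut, erase_eq_of_notMem hbt]
      rcases (𝒜₁ ∩ 𝒜₀).eq_empty_or_nonempty with he | hne
      · rw [he]
        simp [edges, memberSubfamily, nonMemberSubfamily]
      · obtain ⟨d, rfl⟩ : ∃ d', d = d' + 1 :=
          ⟨d - 1, by have := hsh ∅ (shatters_empty.2 hne); omega⟩
        have := ih (𝒜₁ ∩ 𝒜₀) d (fun s hs => hsub s (mem_union_left _ (mem_inter.1 hs).1))
          fun s hs => by have := hsh s hs; omega
        rw [add_mul, one_mul]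
        omega
    have hcard : (𝒜₁ ∪ 𝒜₀).card + (𝒜₁ ∩ 𝒜₀).card = 𝒜.card := by
      rw [card_union_add_card_inter, h1, h0, card_memberSubfamily_add_card_nonMemberSubfamily]
    have hU : ∑ a ∈ U, (edges a 𝒜).card ≤
        ∑ a ∈ U, (edges a (𝒜₁ ∪ 𝒜₀)).card + ∑ a ∈ U, (edges a (𝒜₁ ∩ 𝒜₀)).card := by
      rw [← sum_add_distrib]
      refine sum_le_sum fun a ha => ?_
      rw [card_edges_split (b := b) (fun h => hb (h ▸ ha)) 𝒜]
      exact card_edges_add_le a _ _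
    rw [sum_insert hb]
    calc (edges b 𝒜).card + ∑ a ∈ U, (edges a 𝒜).card
        ≤ (𝒜₁ ∩ 𝒜₀).card + (∑ a ∈ U, (edges a (𝒜₁ ∪ 𝒜₀)).card +
          ∑ a ∈ U, (edges a (𝒜₁ ∩ 𝒜₀)).card) := add_le_add le_rfl hU
      _ ≤ d * (𝒜₁ ∪ 𝒜₀).card + d * (𝒜₁ ∩ 𝒜₀).card := by omega
      _ = d * 𝒜.card := by rw [← mul_add, hcard]

theorem card_filter_symmDiff_mem (a : α) (𝒜 : Finset (Finset α)) :
    (𝒜.filter fun s => symmDiff s {a} ∈ 𝒜).card = 2 * (edges a 𝒜).card := by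
  have hflip : ∀ s : Finset α, a ∉ s → symmDiff s {a} = insert a s := by
    intro s hs
    ext x
    simp only [mem_symmDiff, mem_singleton, mem_insert]
    by_cases hx : x = a <;> simp_all
  have hflip' : ∀ s : Finset α, a ∉ s → symmDiff (insert a s) {a} = s := by
    intro s hs
    rw [← hflip s hs, symmDiff_symmDiff_cancel_right]
  have h : (𝒜.filter fun s => symmDiff s {a} ∈ 𝒜) = edges a 𝒜 ∪ (edges a 𝒜).image (insert a) := by
    ext s
    simp only [mem_filter, mem_union, mem_image, mem_edges]
    constructor
    · rintro ⟨h1, h2⟩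
      by_cases ha : a ∈ s
      · have h3 := hflip' (s.erase a) (notMem_erase a s)
        rw [insert_erase ha] at h3
        rw [h3] at h2
        exact Or.inr ⟨s.erase a, ⟨by rwa [insert_erase ha], h2, notMem_erase a s⟩, insert_erase ha⟩
      · exact Or.inl ⟨hflip s ha ▸ h2, h1, ha⟩
    · rintro (⟨h1, h2, h3⟩ | ⟨t, ⟨h1, h2, h3⟩, rfl⟩)
      · exact ⟨h2, by rwa [hflip s h3]⟩
      · exact ⟨h1, by rwa [hflip' t h3]⟩
  rw [h, card_union_of_disjoint, card_image_of_injOn, two_mul]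
  · intro s hs t ht hst
    rw [mem_coe, mem_edges] at hs ht
    rw [← erase_insert hs.2.2, ← erase_insert ht.2.2]
    exact congrArg (fun u => u.erase a) hst
  · rw [disjoint_left]
    intro s hs hs'
    obtain ⟨t, -, rfl⟩ := mem_image.1 hs'
    exact (mem_edges.1 hs).2.2 (mem_insert_self a t)

/-- The one-inclusion predictor: for a family of labelings of `U` shattering only sets of size at
most `d`, each label can be predicted from the others so that, for each labeling in the family, at
most `2 * d` predictions are wrong. -/
theorem exists_oneInclusion (U : Finset α) (𝒜 : Finset (Finset α)) (d : ℕ) (hU : ∀ s ∈ 𝒜, s ⊆ U)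
    (hd : ∀ s, 𝒜.Shatters s → s.card ≤ d) :
    ∃ g : α → Finset α → Bool, (∀ a s, g a (insert a s) = g a (s.erase a)) ∧
      ∀ s ∈ 𝒜, (U.filter fun a => g a s ≠ decide (a ∈ s)).card ≤ 2 * d := by
  induction 𝒜 using Finset.strongInduction with
  | H 𝒜 ih =>
    rcases 𝒜.eq_empty_or_nonempty with rfl | hne
    · exact ⟨fun _ _ => true, fun _ _ => rfl, by simp⟩
    obtain ⟨v, hv, hdeg⟩ : ∃ v ∈ 𝒜, (U.filter fun a => symmDiff v {a} ∈ 𝒜).card ≤ 2 * d := by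
      by_contra! hcon
      have h1 : ∑ v ∈ 𝒜, 2 * d < ∑ v ∈ 𝒜, (U.filter fun a => symmDiff v {a} ∈ 𝒜).card :=
        sum_lt_sum_of_nonempty hne hcon
      have h2 : ∑ v ∈ 𝒜, (U.filter fun a => symmDiff v {a} ∈ 𝒜).card =
          ∑ a ∈ U, (𝒜.filter fun v => symmDiff v {a} ∈ 𝒜).card :=
        sum_card_bipartiteAbove_eq_sum_card_bipartiteBelow _
      have h3 := sum_card_edges_le U 𝒜 d hU hd
      rw [h2, sum_congr rfl fun a _ => card_filter_symmDiff_mem a 𝒜, sum_const,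
        smul_eq_mul] at h1
      have h4 := mul_sum U (fun a => (edges a 𝒜).card) 2
      nlinarith
    obtain ⟨g, hg, hgs⟩ := ih (𝒜.erase v) (erase_ssubset hv)
      (fun s hs => hU s (mem_of_mem_erase hs))
      fun s hs => hd s (hs.mono_left (erase_subset v 𝒜))
    refine ⟨fun a s => if s.erase a = v.erase a then
      (if symmDiff v {a} ∈ 𝒜 then decide (a ∉ v) else decide (a ∈ v)) else g a s,
      fun a s => ?_, fun s hs => ?_⟩
    · simp only [hg a s, erase_insert_eq_erase, erase_idem]
    · by_cases hsv : s = v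
      · subst hsv
        refine (card_le_card fun a => ?_).trans hdeg
        simp only [mem_filter]
        rintro ⟨haU, h⟩
        refine ⟨haU, ?_⟩
        by_contra hn
        simp [hn] at h
      · refine (card_le_card fun a => ?_).trans (hgs s (mem_erase.2 ⟨hsv, hs⟩))
        simp only [mem_filter]
        rintro ⟨haU, h⟩
        refine ⟨haU, ?_⟩
        by_cases he : s.erase a = v.erase a
        · have hav : a ∈ s ↔ a ∉ v := by
            by_cases h1 : a ∈ s <;> by_cases h2 : a ∈ v <;>
              simp only [h1, h2, not_true, not_false_iff, iff_true, iff_false]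
            · exact hsv (by rw [← insert_erase h1, he, insert_erase h2])
            · exact hsv (by rw [← erase_eq_of_notMem h1, he, erase_eq_of_notMem h2])
          have hfl : symmDiff v {a} = s := by
            ext x
            have hx := Finset.ext_iff.1 he x
            simp only [mem_erase] at hx
            simp only [mem_symmDiff, mem_singleton]
            by_cases hxa : x = a
            · subst hxa
              tauto
            · tauto
          rw [if_pos he, hfl, if_pos hs] at h
          exact absurd (decide_eq_decide.2 hav.symm) h
        · rwa [if_neg he] at h

end OneInclusion

end UniversalLearning

namespace UniversalLearning

open MeasureTheory Set Filter Topology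

section Counting

variable {Ω ι : Type*} [MeasurableSpace Ω] {μ : Measure Ω}

theorem measurable_card_filter {α : Type*} {mα : MeasurableSpace α} {p : α → ι → Prop}
    [∀ a, DecidablePred (p a)] (hp : ∀ i, MeasurableSet {a | p a i}) (s : Finset ι) :
    Measurable fun a => (s.filter (p a)).card := by
  classical
  have : (fun a => (s.filter (p a)).card) = fun a => ∑ i ∈ s, if p a i then 1 else 0 := by
    funext a
    rw [Finset.card_filter]
  rw [this]
  exact Finset.measurable_sum _ fun i _ => Measurable.ite (hp i) measurable_const measurable_const

theorem card_filter_eq_sum_indicator {Ω ι : Type*} (s : Finset ι) {A : ι → Set Ω}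
    [∀ ω, DecidablePred fun i => ω ∈ A i] (ω : Ω) :
    ((s.filter fun i => ω ∈ A i).card : ℝ≥0∞) = ∑ i ∈ s, (A i).indicator (fun _ => 1) ω := by
  rw [Finset.card_filter, Nat.cast_sum]
  refine Finset.sum_congr rfl fun i _ => ?_
  by_cases h : ω ∈ A i <;> simp [h]

theorem lintegral_card_filter (s : Finset ι) {A : ι → Set Ω} [∀ ω, DecidablePred fun i => ω ∈ A i]
    (hA : ∀ i ∈ s, NullMeasurableSet (A i) μ) :
    ∫⁻ ω, ((s.filter fun i => ω ∈ A i).card : ℝ≥0∞) ∂μ = ∑ i ∈ s, μ (A i) := by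
  simp only [card_filter_eq_sum_indicator]
  rw [lintegral_finsetSum' s fun i hi => (aemeasurable_indicator_const_iff 1).2 (hA i hi)]
  exact Finset.sum_congr rfl fun i hi => lintegral_indicator_one₀ (hA i hi)

theorem mul_measure_le_card_filter_le (s : Finset ι) {A : ι → Set Ω}
    [∀ ω, DecidablePred fun i => ω ∈ A i]
    (hA : ∀ i ∈ s, NullMeasurableSet (A i) μ) (K : ℝ≥0∞) :
    K * μ {ω | K ≤ (s.filter fun i => ω ∈ A i).card} ≤ ∑ i ∈ s, μ (A i) := by
  rw [← lintegral_card_filter s hA]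
  refine mul_meas_ge_le_lintegral₀ ?_ K
  simp only [card_filter_eq_sum_indicator]
  exact Finset.aemeasurable_fun_sum s fun i hi => (aemeasurable_indicator_const_iff 1).2 (hA i hi)

theorem sum_measure_le_of_card_filter_le [IsProbabilityMeasure μ] (s : Finset ι) {A : ι → Set Ω}
    [∀ ω, DecidablePred fun i => ω ∈ A i]
    (hA : ∀ i ∈ s, NullMeasurableSet (A i) μ) {D : ℕ}
    (hD : ∀ᵐ ω ∂μ, (s.filter fun i => ω ∈ A i).card ≤ D) : ∑ i ∈ s, μ (A i) ≤ D := by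
  rw [← lintegral_card_filter s hA]
  calc _ ≤ ∫⁻ _, (D : ℝ≥0∞) ∂μ := lintegral_mono_ae (hD.mono fun ω h => by exact_mod_cast h)
    _ = D := by simp

end Counting

section Vote

variable {𝒳 W : Type*} (E : ℕ → Set (W × (ℕ → 𝒳 × Bool))) (M N : ℕ)

open Classical in
/-- The number of pairs of a batch and a position that err on the test example `z`, when `z` is
inserted into the sample at that position. -/
noncomputable def wrongPairs (B : ℕ → W) (ζ : ℕ → 𝒳 × Bool) (z : 𝒳 × Bool) : ℕ :=
  ((Finset.range M ×ˢ Finset.range N).filter fun c =>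
    (B c.1, Function.update ζ c.2 z) ∈ E c.2).card

open Classical in
/-- The majority vote over all batches and positions. -/
noncomputable def votePredict (B : ℕ → W) (ζ : ℕ → 𝒳 × Bool) (x : 𝒳) : Bool :=
  decide (2 * wrongPairs E M N B ζ (x, true) < M * N)

variable {E M N}

theorem wrongPairs_congr {B B' : ℕ → W} {ζ ζ' : ℕ → 𝒳 × Bool} {z : 𝒳 × Bool}
    (h : ∀ i < M, ∀ a < N, (B i, Function.update ζ a z) ∈ E a ↔
      (B' i, Function.update ζ' a z) ∈ E a) :
    wrongPairs E M N B ζ z = wrongPairs E M N B' ζ' z := by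
  classical
  unfold wrongPairs
  congr 1
  refine Finset.filter_congr fun c hc => ?_
  simp only [Finset.mem_product, Finset.mem_range] at hc
  exact h _ hc.1 _ hc.2

theorem mul_le_wrongPairs (hbool : ∀ a B ζ x, (B, Function.update ζ a (x, true)) ∈ E a ↔
      (B, Function.update ζ a (x, false)) ∉ E a) {B : ℕ → W} {ζ : ℕ → 𝒳 × Bool} {z : 𝒳 × Bool}
    (h : votePredict E M N B ζ z.1 ≠ z.2) : M * N ≤ 2 * wrongPairs E M N B ζ z := by
  classical
  obtain ⟨x, y⟩ := z
  cases y with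
  | true =>
    by_contra hlt
    refine h ?_
    unfold votePredict
    exact (@decide_eq_true_iff _ (_)).2 (not_le.1 hlt)
  | false =>
    have h1 : votePredict E M N B ζ x = true := by simpa using h
    have h2 : 2 * wrongPairs E M N B ζ (x, true) < M * N := (@decide_eq_true_iff _ (_)).1 h1
    have h3 : wrongPairs E M N B ζ (x, true) + wrongPairs E M N B ζ (x, false) = M * N := by
      unfold wrongPairs
      rw [Finset.filter_congr (q := fun c : ℕ × ℕ =>
        ¬ (B c.1, Function.update ζ c.2 (x, false)) ∈ E c.2) fun c _ => hbool _ _ _ _, add_comm,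
        Finset.card_filter_add_card_filter_not]
      simp
    omega

variable [MeasurableSpace 𝒳] [MeasurableSpace W]

theorem measurable_votePredict (hE : ∀ a, MeasurableSet[univMS] (E a))
    {α : Type*} [MeasurableSpace α] {B : α → ℕ → W}
    {ζ : α → ℕ → 𝒳 × Bool} {x : α → 𝒳} (hB : Measurable B) (hζ : Measurable ζ) (hx : Measurable x) :
    Measurable[univMS] fun q => votePredict E M N (B q) (ζ q) (x q) := by
  classical
  have h1 : Measurable[univMS] fun q => wrongPairs E M N (B q) (ζ q) (x q, true) := by
    unfold wrongPairs
    exact measurable_card_filter (mα := univMS) (p := fun q (c : ℕ × ℕ) =>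
      (B q c.1, Function.update (ζ q) c.2 (x q, true)) ∈ E c.2)
      (fun c => measurableSet_univMS_preimage (hE c.2)
      (f := fun q => (B q c.1, Function.update (ζ q) c.2 (x q, true))) (by fun_prop)) _
  refine @measurable_to_bool _ univMS _ ?_
  have : (fun q => votePredict E M N (B q) (ζ q) (x q)) ⁻¹' {true} =
      {q | 2 * wrongPairs E M N (B q) (ζ q) (x q, true) < M * N} := by
    ext q
    simp only [votePredict, mem_preimage, mem_singleton_iff, decide_eq_true_iff, mem_ofPred_eq]
  rw [this]
  exact h1 (MeasurableSet.of_discrete (s := {c : ℕ | 2 * c < M * N}))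

open Classical in
theorem measure_votePredict_le (hE : ∀ a, MeasurableSet[univMS] (E a))
    (ν : Measure W) [IsProbabilityMeasure ν] (P : Measure (𝒳 × Bool))
    [IsProbabilityMeasure P] (hbool : ∀ a B ζ x, (B, Function.update ζ a (x, true)) ∈ E a ↔
      (B, Function.update ζ a (x, false)) ∉ E a) {Bad : Set W} (hBad : MeasurableSet[univMS] Bad)
    (hp : ν Bad ≤ ENNReal.ofReal (1 / 2 ^ 32)) {D : ℕ}
    (hD : ∀ B ∉ Bad, ∀ᵐ ζ ∂iid P ℕ, ((Finset.range N).filter fun a => (B, ζ) ∈ E a).card ≤ D)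
    (hM : 0 < M) (hN : 0 < N) :
    (((iid ν ℕ).prod (iid P ℕ)).prod P) {q | votePredict E M N q.1.1 q.1.2 q.2.1 ≠ q.2.2} ≤
      ENNReal.ofReal ((1 / 2) ^ M) + ENNReal.ofReal (4 * D / N) := by
  set μ := ((iid ν ℕ).prod (iid P ℕ)).prod P with hμ
  let F : ℕ → Set (W × (ℕ → 𝒳 × Bool)) := fun a => {p | p.1 ∉ Bad ∧ p ∈ E a}
  have hF : ∀ a, MeasurableSet[univMS] (F a) := fun a =>
    MeasurableSet.inter (MeasurableSet.compl (measurableSet_univMS_preimage hBad measurable_fst))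
      (hE a)
  have hFD : ∑ a ∈ Finset.range N, (ν.prod (iid P ℕ)) (F a) ≤ D := by
    refine sum_measure_le_of_card_filter_le _ (fun a _ => (hF a).nullMeasurableSet_of_univMS _) ?_
    have hm : MeasurableSet[univMS] {p : W × (ℕ → 𝒳 × Bool) |
        ¬ ((Finset.range N).filter fun a => p ∈ F a).card ≤ D} :=
      measurable_card_filter (mα := univMS) (p := fun p a => p ∈ F a) (fun a => hF a)
        (Finset.range N) (MeasurableSet.of_discrete (s := {c : ℕ | ¬ c ≤ D}))
    rw [ae_iff]
    refine le_antisymm (measure_prod_le_of_slices hm _ _ (ae_of_all _ fun B => ?_)) zero_le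
    by_cases hB : B ∈ Bad
    · refine le_of_eq (measure_mono_null (t := ∅) (fun ζ hζ => hζ ?_) measure_empty)
      simp [F, hB]
    · have h0 := ae_iff.1 (hD B hB)
      refine le_of_eq (measure_mono_null ?_ h0)
      intro ζ hζ h
      refine hζ ?_
      simpa only [F, mem_ofPred_eq, hB, not_false_iff, true_and] using h
  let A : ℕ × ℕ → Set (((ℕ → W) × (ℕ → 𝒳 × Bool)) × (𝒳 × Bool)) := fun c =>
    {q | (q.1.1 c.1, Function.update q.1.2 c.2 q.2) ∈ F c.2}
  have hmp : ∀ c : ℕ × ℕ, MeasurePreserving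
      (fun q : ((ℕ → W) × (ℕ → 𝒳 × Bool)) × (𝒳 × Bool) =>
        (q.1.1 c.1, Function.update q.1.2 c.2 q.2)) μ (ν.prod (iid P ℕ)) := fun c =>
    ((measurePreserving_eval_infinitePi (fun _ : ℕ => ν) c.1).prod
      (measurePreserving_update P c.2)).comp
      (measurePreserving_prodAssoc (iid ν ℕ) (iid P ℕ) P)
  have hA : ∀ c, NullMeasurableSet (A c) μ := fun c =>
    ((hF c.2).nullMeasurableSet_of_univMS _).preimage (hmp c).quasiMeasurePreserving
  have hAF : ∀ c, μ (A c) = (ν.prod (iid P ℕ)) (F c.2) := fun c =>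
    (hmp c).measure_preimage ((hF c.2).nullMeasurableSet_of_univMS _)
  have hmarkov := mul_measure_le_card_filter_le (μ := μ) (Finset.range M ×ˢ Finset.range N)
    (fun c _ => hA c) (ENNReal.ofReal (M * N / 4))
  have hsum : ∑ c ∈ Finset.range M ×ˢ Finset.range N, μ (A c) ≤ M * D := by
    rw [Finset.sum_product]
    simp only [hAF]
    rw [Finset.sum_const, Finset.card_range, nsmul_eq_mul]
    gcongr
  let C : Set (ℕ → W) := {b | 1 * M ≤ 4 * count M fun i => b i ∈ Bad}
  have hCle : iid ν ℕ C ≤ ENNReal.ofReal ((1 / 2) ^ M) :=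
    measure_count_ge_le ν (p := 1 / 2 ^ 32) (x := 4) (r := 1 / 2) (k := 1) (l := 4)
      (by norm_num) (by norm_num) hp (by norm_num) _
  have hC : MeasurableSet[univMS] C :=
    measurable_count (mα := univMS) (fun i => measurableSet_univMS_preimage hBad
      (measurable_pi_apply i)) M (MeasurableSet.of_discrete (s := {c : ℕ | 1 * M ≤ 4 * c}))
  have hsub : {q : ((ℕ → W) × (ℕ → 𝒳 × Bool)) × (𝒳 × Bool) |
      votePredict E M N q.1.1 q.1.2 q.2.1 ≠ q.2.2} ⊆
      (fun q : ((ℕ → W) × (ℕ → 𝒳 × Bool)) × (𝒳 × Bool) => q.1.1) ⁻¹' C ∪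
      {q | ENNReal.ofReal (M * N / 4) ≤
        ((Finset.range M ×ˢ Finset.range N).filter fun c => q ∈ A c).card} := by
    rintro ⟨⟨B, ζ⟩, z⟩ hq
    have h1 : M * N ≤ 2 * wrongPairs E M N B ζ z := mul_le_wrongPairs hbool hq
    by_cases hCB : B ∈ C
    · exact Or.inl hCB
    refine Or.inr ?_
    have h2 : 4 * count M (fun i => B i ∈ Bad) ≤ M := by
      have : ¬ 1 * M ≤ 4 * count M fun i => B i ∈ Bad := hCB
      omega
    have h3 : wrongPairs E M N B ζ z ≤ count M (fun i => B i ∈ Bad) * N +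
        ((Finset.range M ×ˢ Finset.range N).filter fun c => ((B, ζ), z) ∈ A c).card := by
      have h4 : count M (fun i => B i ∈ Bad) * N =
          (((Finset.range M).filter fun i => B i ∈ Bad) ×ˢ Finset.range N).card := by
        rw [Finset.card_product, Finset.card_range]
        unfold count
        congr!
      rw [h4]
      refine (Finset.card_le_card fun c hc => ?_).trans (Finset.card_union_le _ _)
      simp only [Finset.mem_filter, Finset.mem_product, Finset.mem_range] at hc
      simp only [Finset.mem_union, Finset.mem_filter, Finset.mem_product, Finset.mem_range]
      by_cases hb : B c.1 ∈ Bad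
      · exact Or.inl ⟨⟨hc.1.1, hb⟩, hc.1.2⟩
      · exact Or.inr ⟨hc.1, hb, hc.2⟩
    have h5 : M * N ≤ 4 * ((Finset.range M ×ˢ Finset.range N).filter
        fun c => ((B, ζ), z) ∈ A c).card := by
      have := Nat.mul_le_mul_right N h2
      nlinarith
    refine ENNReal.ofReal_le_of_le_toReal ?_
    rw [ENNReal.toReal_natCast, div_le_iff₀ (by norm_num), mul_comm (Nat.cast _) (4 : ℝ)]
    exact_mod_cast h5
  refine (measure_mono hsub).trans ((measure_union_le _ _).trans (add_le_add ?_ ?_))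
  · have h1 : MeasurePreserving (fun q : ((ℕ → W) × (ℕ → 𝒳 × Bool)) × (𝒳 × Bool) => q.1.1) μ
        (iid ν ℕ) := measurePreserving_fst.comp measurePreserving_fst
    rw [h1.measure_preimage (hC.nullMeasurableSet_of_univMS _)]
    exact hCle
  · have hMN : (0 : ℝ) < M * N / 4 := by positivity
    refine (ENNReal.mul_le_mul_iff_right (a := ENNReal.ofReal (M * N / 4)) (by simpa using hMN)
      ENNReal.ofReal_ne_top).1 ((hmarkov.trans hsum).trans (le_of_eq ?_))
    rw [← ENNReal.ofReal_mul hMN.le, show (M * N / 4 * (4 * D / N) : ℝ) = (M * D : ℕ) by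
      push_cast; field_simp, ENNReal.ofReal_natCast]
    push_cast
    rfl

end Vote

theorem exists_oneInclusion_vcDim (N : ℕ) (𝒜 : Finset (Finset ℕ)) :
    ∃ g : ℕ → Finset ℕ → Bool, (∀ a s, g a (insert a s) = g a (s.erase a)) ∧
      ((∀ s ∈ 𝒜, s ⊆ Finset.range N) → ∀ s ∈ 𝒜,
        ((Finset.range N).filter fun a => g a s ≠ decide (a ∈ s)).card ≤ 2 * 𝒜.vcDim) := by
  by_cases h : ∀ s ∈ 𝒜, s ⊆ Finset.range N
  · obtain ⟨g, hg, hs⟩ := exists_oneInclusion (Finset.range N) 𝒜 𝒜.vcDim h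
      fun s hs => hs.card_le_vcDim
    exact ⟨g, hg, fun _ => hs⟩
  · exact ⟨fun _ _ => true, fun _ _ => rfl, fun h' => absurd h' h⟩

/-- A choice of one-inclusion predictor for every family of labelings of `N` points. -/
noncomputable def oneInclusion (N : ℕ) (𝒜 : Finset (Finset ℕ)) : ℕ → Finset ℕ → Bool :=
  (exists_oneInclusion_vcDim N 𝒜).choose

theorem oneInclusion_insert (N : ℕ) (𝒜 : Finset (Finset ℕ)) (a : ℕ) (s : Finset ℕ) :
    oneInclusion N 𝒜 a (insert a s) = oneInclusion N 𝒜 a (s.erase a) :=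
  (exists_oneInclusion_vcDim N 𝒜).choose_spec.1 a s

theorem card_oneInclusion_ne_le {N : ℕ} {𝒜 : Finset (Finset ℕ)}
    (h : ∀ s ∈ 𝒜, s ⊆ Finset.range N) {s : Finset ℕ} (hs : s ∈ 𝒜) :
    ((Finset.range N).filter fun a => oneInclusion N 𝒜 a s ≠ decide (a ∈ s)).card ≤
      2 * 𝒜.vcDim :=
  (exists_oneInclusion_vcDim N 𝒜).choose_spec.2 h s hs

/-- The set of positive examples among the first `N` examples. -/
def positives {𝒳 : Type*} (N : ℕ) (ζ : ℕ → 𝒳 × Bool) : Finset ℕ :=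
  (Finset.range N).filter fun c => (ζ c).2

theorem measurableSet_positives_eq {𝒳 : Type*} [MeasurableSpace 𝒳] {N : ℕ} (L : Finset ℕ) :
    MeasurableSet {ζ : ℕ → 𝒳 × Bool | positives N ζ = L} := by
  simp only [positives, Finset.ext_iff, Finset.mem_filter, measurableSet_setOfPred]
  refine .forall fun c => .iff (.and measurable_const ?_) measurable_const
  have : Measurable fun ζ : ℕ → 𝒳 × Bool => (ζ c).2 := by fun_prop
  exact measurableSet_setOfPred.1 (this (measurableSet_singleton true))

section PatternFree

variable {𝒳 : Type*} [Inhabited 𝒳] (m : ℕ → ℕ)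
  (φ : ℕ → (ℕ → ℕ → 𝒳 × Bool) × (ℕ → 𝒳) → ℕ) (N : ℕ)

open Classical in
/-- The labelings of the first `N` points on which the strategy `φ` never hits. -/
noncomputable def patternFree (st : ℕ × (ℕ → ℕ → 𝒳 × Bool)) (x : ℕ → 𝒳) : Finset (Finset ℕ) :=
  (Finset.range N).powerset.filter fun s => ∀ l : List ℕ, l.Nodup → l.length = m st.1 →
    (∀ a ∈ l, a < N) →
    ¬ Hit m φ st fun i => (x (l.getD i (N + i)), decide (l.getD i (N + i) ∈ s))

/-- The one-inclusion predictor for the pattern-free labelings errs on position `a`. -/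
def OneInclusionErr (st : ℕ × (ℕ → ℕ → 𝒳 × Bool)) (ζ : ℕ → 𝒳 × Bool) (a : ℕ) : Prop :=
  oneInclusion N (patternFree m φ N st fun c => (ζ c).1) a (positives N ζ) ≠ (ζ a).2

variable {m φ N}

theorem mem_patternFree {st : ℕ × (ℕ → ℕ → 𝒳 × Bool)} {x : ℕ → 𝒳} {s : Finset ℕ} :
    s ∈ patternFree m φ N st x ↔ s ⊆ Finset.range N ∧ ∀ l : List ℕ, l.Nodup →
      l.length = m st.1 → (∀ a ∈ l, a < N) →
      ¬ Hit m φ st fun i => (x (l.getD i (N + i)), decide (l.getD i (N + i) ∈ s)) := by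
  simp [patternFree]

theorem card_lt_of_shatters_patternFree {st : ℕ × (ℕ → ℕ → 𝒳 × Bool)} {x : ℕ → 𝒳}
    {s : Finset ℕ} (hs : (patternFree m φ N st x).Shatters s) : s.card < m st.1 := by
  by_contra! hle
  obtain ⟨s', hs's, hcard⟩ := Finset.exists_subset_card_eq hle
  replace hs := hs.mono_right hs's
  have hsN : s' ⊆ Finset.range N := by
    obtain ⟨u, hu, hsu⟩ := hs.exists_superset
    exact hsu.trans (mem_patternFree.1 hu).1
  set l := s'.toList with hl
  have hnd : l.Nodup := Finset.nodup_toList s'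
  have hlen : l.length = m st.1 := by rw [hl, Finset.length_toList, hcard]
  set c := φ st.1
    (st.2, fun i => if i < m st.1 then x (l.getD i (N + i)) else (default : 𝒳 × Bool).1) with hc
  obtain ⟨u, hu, hut⟩ := hs (t := s'.filter fun a => c.testBit (l.idxOf a))
    (Finset.filter_subset _ _)
  refine (mem_patternFree.1 hu).2 l hnd hlen
    (fun a ha => by simpa using hsN (Finset.mem_toList.1 ha)) fun i hi => ?_
  have h1 : (fun i => (trunc (m st.1) (fun i => (x (l.getD i (N + i)),
      decide (l.getD i (N + i) ∈ u))) i).1) =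
      fun i => if i < m st.1 then x (l.getD i (N + i)) else (default : 𝒳 × Bool).1 := by
    funext i
    by_cases hi : i < m st.1 <;> simp [trunc, hi]
  rw [h1, ← hc]
  have hil : i < l.length := hlen ▸ hi
  have hget : l.getD i (N + i) = l[i] := List.getD_eq_getElem _ _ hil
  have hmem : l[i] ∈ s' := Finset.mem_toList.1 (List.getElem_mem hil)
  have h2 : l[i] ∈ u ↔ c.testBit i := by
    have h3 := Finset.ext_iff.1 hut l[i]
    rw [Finset.mem_inter, Finset.mem_filter, hnd.idxOf_getElem] at h3
    simpa [hmem] using h3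
  simp only [hget, h2, Bool.decide_eq_true]

theorem vcDim_patternFree_le {st : ℕ × (ℕ → ℕ → 𝒳 × Bool)} (hm : m st.1 = st.1 + 1)
    {x : ℕ → 𝒳} : (patternFree m φ N st x).vcDim ≤ st.1 :=
  Finset.sup_le fun s hs => by
    have := card_lt_of_shatters_patternFree (Finset.mem_shatterer.1 hs)
    omega

theorem patternFree_congr {st : ℕ × (ℕ → ℕ → 𝒳 × Bool)} {x x' : ℕ → 𝒳}
    (h : ∀ c < N, x c = x' c) : patternFree m φ N st x = patternFree m φ N st x' := by
  ext s
  rw [mem_patternFree, mem_patternFree]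
  refine and_congr_right fun _ => forall_congr' fun l => forall₃_congr fun _ hlen hl =>
    not_congr (hit_congr fun i hi => ?_)
  have hil : i < l.length := hlen ▸ hi
  rw [List.getD_eq_getElem _ _ hil, h _ (hl _ (List.getElem_mem hil))]

theorem oneInclusionErr_congr {st : ℕ × (ℕ → ℕ → 𝒳 × Bool)} {ζ ζ' : ℕ → 𝒳 × Bool} {a : ℕ}
    (ha : a < N) (h : ∀ c < N, ζ c = ζ' c) :
    OneInclusionErr m φ N st ζ a ↔ OneInclusionErr m φ N st ζ' a := by
  have h1 : positives N ζ = positives N ζ' :=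
    Finset.filter_congr fun c hc => by rw [h c (Finset.mem_range.1 hc)]
  unfold OneInclusionErr
  rw [patternFree_congr (x := fun c => (ζ c).1) (x' := fun c => (ζ' c).1)
    (fun c hc => by rw [h c hc]), h1, h a ha]

theorem oneInclusionErr_bool (st : ℕ × (ℕ → ℕ → 𝒳 × Bool)) (ζ : ℕ → 𝒳 × Bool) (a : ℕ) (x : 𝒳) :
    OneInclusionErr m φ N st (Function.update ζ a (x, true)) a ↔
      ¬ OneInclusionErr m φ N st (Function.update ζ a (x, false)) a := by
  have h1 : (fun c => (Function.update ζ a (x, true) c).1) =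
      fun c => (Function.update ζ a (x, false) c).1 := by
    funext c
    by_cases hc : c = a
    · subst hc
      simp
    · simp [hc]
  set L := positives N (Function.update ζ a (x, false)) with hL
  have hmem : ∀ y c, c ∈ positives N (Function.update ζ a (x, y)) ↔
      c < N ∧ if c = a then y = true else (ζ c).2 = true := by
    intro y c
    rw [positives, Finset.mem_filter, Finset.mem_range, Function.update_apply]
    by_cases hc : c = a <;> simp [hc]
  have haL : a ∉ L := by simp [hL, hmem]
  have h2 : oneInclusion N (patternFree m φ N st fun c => (Function.update ζ a (x, false) c).1) a
      (positives N (Function.update ζ a (x, true))) =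
      oneInclusion N (patternFree m φ N st fun c => (Function.update ζ a (x, false) c).1) a L := by
    by_cases ha : a < N
    · have : positives N (Function.update ζ a (x, true)) = insert a L := by
        ext c
        rw [Finset.mem_insert, hL, hmem, hmem]
        by_cases hc : c = a <;> simp [hc, ha]
      rw [this, oneInclusion_insert, Finset.erase_eq_of_notMem haL]
    · have : positives N (Function.update ζ a (x, true)) = L := by
        ext c
        rw [hL, hmem, hmem]
        by_cases hc : c = a <;> simp [hc, ha]
      rw [this]
  unfold OneInclusionErr
  rw [h1, h2, Function.update_self, Function.update_self, hL]
  simp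

theorem card_oneInclusionErr_le {st : ℕ × (ℕ → ℕ → 𝒳 × Bool)} (hm : m st.1 = st.1 + 1)
    {ζ : ℕ → 𝒳 × Bool} (h : positives N ζ ∈ patternFree m φ N st fun c => (ζ c).1)
    [DecidablePred (OneInclusionErr m φ N st ζ)] :
    ((Finset.range N).filter fun a => OneInclusionErr m φ N st ζ a).card ≤ 2 * st.1 := by
  refine le_trans ?_ ((card_oneInclusion_ne_le (fun s hs => (mem_patternFree.1 hs).1) h).trans
    (Nat.mul_le_mul_left 2 (vcDim_patternFree_le hm)))
  refine Finset.card_le_card fun a => ?_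
  simp only [Finset.mem_filter, Finset.mem_range]
  rintro ⟨ha, he⟩
  refine ⟨ha, fun h' => he (h'.trans ?_)⟩
  simp [positives, ha]

variable [MeasurableSpace 𝒳]

theorem measurableSet_mem_patternFree (hφ : ∀ k, Measurable[univMS] (φ k)) (s : Finset ℕ) :
    MeasurableSet[univMS] {q : (ℕ × (ℕ → ℕ → 𝒳 × Bool)) × (ℕ → 𝒳 × Bool) |
      s ∈ patternFree m φ N q.1 fun c => (q.2 c).1} := by
  by_cases hs : s ⊆ Finset.range N
  · have h1 : {q : (ℕ × (ℕ → ℕ → 𝒳 × Bool)) × (ℕ → 𝒳 × Bool) |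
        s ∈ patternFree m φ N q.1 fun c => (q.2 c).1} =
        ⋂ l : List ℕ, ⋂ (_ : l.Nodup), ⋂ (_ : ∀ a ∈ l, a < N),
          ({q | l.length = m q.1.1} ∩ (fun q : (ℕ × (ℕ → ℕ → 𝒳 × Bool)) × (ℕ → 𝒳 × Bool) =>
            (q.1, (fun i => ((q.2 (l.getD i (N + i))).1, decide (l.getD i (N + i) ∈ s)) :
              ℕ → 𝒳 × Bool))) ⁻¹' {q | Hit m φ q.1 q.2})ᶜ := by
      ext q
      simp only [mem_ofPred_eq, mem_patternFree, hs, true_and, mem_iInter, mem_compl_iff,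
        mem_inter_iff, mem_preimage, not_and]
      exact forall_congr' fun l => forall_congr' fun _ => by tauto
    rw [h1]
    refine MeasurableSet.iInter fun l => MeasurableSet.iInter fun _ => MeasurableSet.iInter fun _ =>
      MeasurableSet.compl (MeasurableSet.inter ?_ (measurableSet_univMS_preimage
        (measurableSet_hit hφ) (by fun_prop)))
    exact measurable_univMS (f := fun q : (ℕ × (ℕ → ℕ → 𝒳 × Bool)) × (ℕ → 𝒳 × Bool) => q.1.1)
      (by fun_prop) (MeasurableSet.of_discrete (s := {k : ℕ | l.length = m k}))
  · have h1 : {q : (ℕ × (ℕ → ℕ → 𝒳 × Bool)) × (ℕ → 𝒳 × Bool) |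
        s ∈ patternFree m φ N q.1 fun c => (q.2 c).1} = ∅ := by
      ext q
      simp [mem_patternFree, hs]
    rw [h1]
    exact @MeasurableSet.empty _ univMS

theorem measurableSet_patternFree_eq (hφ : ∀ k, Measurable[univMS] (φ k))
    (𝒜 : Finset (Finset ℕ)) :
    MeasurableSet[univMS] {q : (ℕ × (ℕ → ℕ → 𝒳 × Bool)) × (ℕ → 𝒳 × Bool) |
      patternFree m φ N q.1 (fun c => (q.2 c).1) = 𝒜} := by
  have h1 : {q : (ℕ × (ℕ → ℕ → 𝒳 × Bool)) × (ℕ → 𝒳 × Bool) |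
      patternFree m φ N q.1 (fun c => (q.2 c).1) = 𝒜} =
      (⋂ s ∈ (𝒜 : Set (Finset ℕ)), {q | s ∈ patternFree m φ N q.1 fun c => (q.2 c).1}) ∩
      ⋂ s ∈ (𝒜 : Set (Finset ℕ))ᶜ, {q | s ∈ patternFree m φ N q.1 fun c => (q.2 c).1}ᶜ := by
    ext q
    simp only [mem_ofPred_eq, Finset.ext_iff, mem_inter_iff, mem_iInter, mem_compl_iff,
      Finset.mem_coe]
    exact ⟨fun h => ⟨fun s hs => (h s).2 hs, fun s hs h' => hs ((h s).1 h')⟩,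
      fun h s => ⟨fun hs => by_contra fun h' => h.2 s h' hs, h.1 s⟩⟩
  rw [h1]
  exact MeasurableSet.inter
    (MeasurableSet.iInter fun s => MeasurableSet.iInter fun _ => measurableSet_mem_patternFree hφ s)
    (MeasurableSet.iInter fun s => MeasurableSet.iInter fun _ =>
      MeasurableSet.compl (measurableSet_mem_patternFree hφ s))

theorem measurableSet_oneInclusionErr (hφ : ∀ k, Measurable[univMS] (φ k)) (a : ℕ) :
    MeasurableSet[univMS] {q : (ℕ × (ℕ → ℕ → 𝒳 × Bool)) × (ℕ → 𝒳 × Bool) |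
      OneInclusionErr m φ N q.1 q.2 a} := by
  have h1 : {q : (ℕ × (ℕ → ℕ → 𝒳 × Bool)) × (ℕ → 𝒳 × Bool) | OneInclusionErr m φ N q.1 q.2 a} =
      ⋃ 𝒜 : Finset (Finset ℕ), ⋃ L : Finset ℕ,
        {q | patternFree m φ N q.1 (fun c => (q.2 c).1) = 𝒜} ∩
        (Prod.snd ⁻¹' ({ζ : ℕ → 𝒳 × Bool | positives N ζ = L} ∩
          {ζ | oneInclusion N 𝒜 a L ≠ (ζ a).2})) := by
    ext q
    simp [OneInclusionErr]
  rw [h1]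
  refine MeasurableSet.iUnion fun 𝒜 => MeasurableSet.iUnion fun L =>
    MeasurableSet.inter (measurableSet_patternFree_eq hφ 𝒜) ?_
  have h2 : Measurable fun ζ : ℕ → 𝒳 × Bool => (ζ a).2 := by fun_prop
  exact measurable_univMS measurable_snd ((measurableSet_positives_eq L).inter
    (h2 (MeasurableSet.of_discrete (s := {b : Bool | oneInclusion N 𝒜 a L ≠ b}))))

theorem ae_positives_mem_patternFree (hφ : ∀ k, Measurable[univMS] (φ k))
    (P : Measure (𝒳 × Bool)) [IsProbabilityMeasure P] {st : ℕ × (ℕ → ℕ → 𝒳 × Bool)}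
    (h : Good m φ P st) :
    ∀ᵐ ζ ∂iid P ℕ, positives N ζ ∈ patternFree m φ N st fun c => (ζ c).1 := by
  have hH : MeasurableSet[univMS] {b : ℕ → 𝒳 × Bool | Hit m φ st b} :=
    measurableSet_univMS_preimage (measurableSet_hit (m := m) hφ)
      (f := fun b : ℕ → 𝒳 × Bool => (st, b)) (by fun_prop)
  have h1 : ∀ l : List ℕ, l.Nodup → (∀ a ∈ l, a < N) →
      ∀ᵐ ζ ∂iid P ℕ, ¬ Hit m φ st fun i => ζ (l.getD i (N + i)) := by
    intro l hnd hl
    have hσ : Function.Injective fun i => l.getD i (N + i) := by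
      intro i j hij
      simp only [List.getD_eq_getElem?_getD] at hij
      by_cases hi : i < l.length <;> by_cases hj : j < l.length <;> simp [hi, hj] at hij
      · exact (hnd.getElem_inj_iff).1 hij
      · have := hl _ (List.getElem_mem hi)
        omega
      · have := hl _ (List.getElem_mem hj)
        omega
      · exact hij
    rw [ae_iff]
    simp only [not_not]
    exact ((measurePreserving_comp_injective P hσ).measure_preimage
      (hH.nullMeasurableSet_of_univMS _)).trans h
  have h2 : ∀ᵐ ζ ∂iid P ℕ, ∀ l : List ℕ, l.Nodup → (∀ a ∈ l, a < N) →
      ¬ Hit m φ st fun i => ζ (l.getD i (N + i)) := by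
    rw [ae_all_iff]
    intro l
    by_cases hl : l.Nodup ∧ ∀ a ∈ l, a < N
    · exact (h1 l hl.1 hl.2).mono fun ζ h _ _ => h
    · exact ae_of_all _ fun ζ h1 h2 => absurd ⟨h1, h2⟩ hl
  refine h2.mono fun ζ hζ => mem_patternFree.2 ⟨Finset.filter_subset _ _,
    fun l hnd hlen hl hh => ?_⟩
  refine hζ l hnd hl ((hit_congr fun i hi => ?_).1 hh)
  have hil : i < l.length := hlen ▸ hi
  have := hl _ (List.getElem_mem hil)
  rw [List.getD_eq_getElem _ _ hil]
  ext
  · rfl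
  · simp [positives, this]

end PatternFree

section Linear

/-- The number of batches used on a sample of size `n`: the fourth root of `n / 2`. -/
def fourthRoot (n : ℕ) : ℕ := Nat.sqrt (Nat.sqrt (n / 2))

theorem fourthRoot_pow_le (n : ℕ) : fourthRoot n ^ 4 ≤ n / 2 := by
  have h1 : fourthRoot n ^ 2 ≤ Nat.sqrt (n / 2) := Nat.sqrt_le' _
  have h2 : Nat.sqrt (n / 2) ^ 2 ≤ n / 2 := Nat.sqrt_le' _
  calc fourthRoot n ^ 4 = (fourthRoot n ^ 2) ^ 2 := by ring
    _ ≤ Nat.sqrt (n / 2) ^ 2 := Nat.pow_le_pow_left h1 2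
    _ ≤ _ := h2

theorem le_fourthRoot_succ_pow (n : ℕ) : n ≤ 2 * (fourthRoot n + 1) ^ 4 := by
  have h1 : Nat.sqrt (n / 2) < (fourthRoot n + 1) ^ 2 := Nat.lt_succ_sqrt' _
  have h2 : n / 2 < (Nat.sqrt (n / 2) + 1) ^ 2 := Nat.lt_succ_sqrt' _
  have h3 : (Nat.sqrt (n / 2) + 1) ^ 2 ≤ ((fourthRoot n + 1) ^ 2) ^ 2 := Nat.pow_le_pow_left h1 2
  have h4 : ((fourthRoot n + 1) ^ 2) ^ 2 = (fourthRoot n + 1) ^ 4 := by ring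
  omega

/-- The cells used on a sample of size `n`. -/
def batchCells (n : ℕ) : Finset Cell :=
  (Finset.range (fourthRoot n) ×ˢ Finset.range (fourthRoot n) ×ˢ
    Finset.range (fourthRoot n)).disjSum (Finset.range (n / 2))

theorem card_batchCells_le (n : ℕ) : (batchCells n).card ≤ n := by
  have h1 := fourthRoot_pow_le n
  have h2 : fourthRoot n * (fourthRoot n * fourthRoot n) ≤ fourthRoot n ^ 4 := by
    rcases Nat.eq_zero_or_pos (fourthRoot n) with h | h
    · simp [h]
    · calc _ = fourthRoot n ^ 3 := by ring
        _ ≤ _ := Nat.pow_le_pow_right h (by norm_num)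
  simp only [batchCells, Finset.card_disjSum, Finset.card_product, Finset.card_range]
  omega

theorem exists_pow_le_div : ∃ C : ℝ, 0 ≤ C ∧ ∀ n : ℕ, 1 ≤ n →
    (1 / 2 : ℝ) ^ fourthRoot n ≤ C / n := by
  obtain ⟨C, hC⟩ := (tendsto_pow_const_mul_const_pow_of_abs_lt_one 4
    (show |(1 / 2 : ℝ)| < 1 by rw [abs_of_pos] <;> norm_num)).bddAbove_range
  have hC' : ∀ K : ℕ, (K : ℝ) ^ 4 * (1 / 2) ^ K ≤ C := fun K => hC (mem_range_self K)
  have hC0 : 0 ≤ C := le_trans (by positivity) (hC' 0)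
  refine ⟨4 * C, by positivity, fun n hn => ?_⟩
  have hn0 : (0 : ℝ) < n := by exact_mod_cast hn
  rw [le_div_iff₀ hn0]
  have h1 : (n : ℝ) ≤ 2 * (fourthRoot n + 1 : ℕ) ^ 4 := by exact_mod_cast le_fourthRoot_succ_pow n
  have h2 := hC' (fourthRoot n + 1)
  calc (1 / 2 : ℝ) ^ fourthRoot n * n
      ≤ (1 / 2 : ℝ) ^ fourthRoot n * (2 * (fourthRoot n + 1 : ℕ) ^ 4) := by gcongr
    _ = 4 * ((fourthRoot n + 1 : ℕ) ^ 4 * (1 / 2 : ℝ) ^ (fourthRoot n + 1)) := by ring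
    _ ≤ _ := by gcongr

theorem exists_linear_bound {err : ℕ → ℝ≥0∞} (h1 : ∀ n, err n ≤ 1) (T₀ : ℕ)
    (h : ∀ n, T₀ ≤ fourthRoot n → 0 < fourthRoot n → 0 < n / 2 →
      err n ≤ ENNReal.ofReal ((1 / 2) ^ fourthRoot n) +
        ENNReal.ofReal (4 * (2 * T₀ : ℕ) / (n / 2 : ℕ))) :
    ∃ C > (0 : ℝ), ∃ c > (0 : ℝ), ∀ n : ℕ,
      err n ≤ ENNReal.ofReal (C * (1 / max ((⌈c * (n : ℝ)⌉₊ : ℕ) : ℝ) 1)) := by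
  obtain ⟨C, hC0, hC⟩ := exists_pow_le_div
  set n₀ := 2 * (T₀ + 2) ^ 4 with hn₀
  refine ⟨C + 32 * T₀ + n₀ + 1, by positivity, 1, one_pos, fun n => ?_⟩
  rw [one_mul, Nat.ceil_natCast]
  by_cases hn : n < n₀
  · refine (h1 n).trans ?_
    rw [← ENNReal.ofReal_one]
    refine ENNReal.ofReal_le_ofReal ?_
    rw [mul_one_div, le_div_iff₀ (by positivity), one_mul]
    have : (n : ℝ) ≤ n₀ := by exact_mod_cast hn.le
    refine max_le ?_ ?_
    · have : (0 : ℝ) ≤ T₀ := by positivity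
      linarith
    · have : (0 : ℝ) ≤ T₀ := by positivity
      have : (0 : ℝ) ≤ n₀ := by positivity
      linarith
  · have hK : T₀ + 2 ≤ fourthRoot n + 1 := by
      by_contra! hlt
      have h2 := le_fourthRoot_succ_pow n
      have h3 : (fourthRoot n + 1) ^ 4 < (T₀ + 2) ^ 4 := Nat.pow_lt_pow_left hlt (by norm_num)
      omega
    have h16 : 2 ≤ n₀ := by
      have : 0 < (T₀ + 2) ^ 4 := by positivity
      omega
    have hn1 : (1 : ℝ) ≤ n := by exact_mod_cast (show 1 ≤ n by omega)
    have hN : (0 : ℝ) < (n / 2 : ℕ) := by exact_mod_cast (show 0 < n / 2 by omega)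
    refine (h n (by omega) (by omega) (by omega)).trans ?_
    rw [← ENNReal.ofReal_add (by positivity) (by positivity)]
    refine ENNReal.ofReal_le_ofReal ?_
    have h4 : 4 * ((2 * T₀ : ℕ) : ℝ) / (n / 2 : ℕ) ≤ 32 * T₀ / n := by
      have h5 : (n : ℝ) ≤ 4 * (n / 2 : ℕ) := by exact_mod_cast (show n ≤ 4 * (n / 2) by omega)
      rw [div_le_div_iff₀ hN (by linarith)]
      push_cast [-Nat.cast_div_charZero]
      have : (0 : ℝ) ≤ T₀ := by positivity
      nlinarith
    calc _ ≤ C / n + 32 * T₀ / n := add_le_add (hC n (by omega)) h4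
      _ = (C + 32 * T₀) * (1 / max (n : ℝ) 1) := by rw [max_eq_left hn1]; ring
      _ ≤ _ := by
        refine mul_le_mul_of_nonneg_right ?_ (by positivity)
        have : (0 : ℝ) ≤ n₀ := by positivity
        linarith

theorem measurePreserving_batches_sample {𝒳 : Type*} [MeasurableSpace 𝒳] (P : Measure (𝒳 × Bool))
    [IsProbabilityMeasure P] :
    MeasurePreserving (fun ξ : Cell → 𝒳 × Bool =>
      ((fun i j k => ξ (.inl (i, j, k)) : ℕ → ℕ → ℕ → 𝒳 × Bool), fun c => ξ (.inr c)))
      (iid P Cell) ((iid (iid (iid P ℕ) ℕ) ℕ).prod (iid P ℕ)) := by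
  have hσ : Function.Injective fun p : (ℕ × ℕ) × ℕ => (Sum.inl (p.1.1, p.1.2, p.2) : Cell) := by
    rintro ⟨⟨i, j⟩, k⟩ ⟨⟨i', j'⟩, k'⟩ h
    simpa [and_assoc] using h
  have h1 := measurePreserving_pair P (τ := (Sum.inr : ℕ → Cell)) hσ Sum.inr_injective
    fun _ _ => Sum.inl_ne_inr
  have h2 := measurePreserving_curry P (I := ℕ × ℕ) (J := ℕ)
  have h3 := measurePreserving_curry (iid P ℕ) (I := ℕ) (J := ℕ)
  exact ((h3.comp h2).prod (MeasurePreserving.id _)).comp h1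

variable {𝒳 Θ : Type*} [TopologicalSpace 𝒳] [PolishSpace 𝒳] [MeasurableSpace 𝒳] [BorelSpace 𝒳]
  [Inhabited 𝒳] [TopologicalSpace Θ] [PolishSpace Θ] [MeasurableSpace Θ] [BorelSpace Θ]
  [Nonempty Θ] {f : Θ → 𝒳 → Bool}

/-- Classes without infinite VCL tree are learnable at a linear rate. -/
theorem learnableAtRate_linear (hf : Measurable (Function.uncurry f))
    (h : ¬ HasTree f fun k => k + 1) :
    LearnableAtRate (range f) fun n => 1 / max (n : ℝ) 1 := by
  classical
  obtain ⟨φ, hφ, hterm⟩ := exists_strategy hf h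
  set m : ℕ → ℕ := fun k => k + 1 with hm
  let E : ℕ → ℕ → ℕ → Set ((ℕ → ℕ → 𝒳 × Bool) × (ℕ → 𝒳 × Bool)) := fun N T a =>
    {p | OneInclusionErr m φ N (state m φ p.1 T) p.2 a}
  have hE : ∀ N T a, MeasurableSet[univMS] (E N T a) := fun N T a =>
    measurable_univMS_univMS ((measurable_univMS_comp (measurable_state hφ T)
      (measurable_univMS measurable_fst)).prodMk (measurable_univMS measurable_snd))
      (measurableSet_oneInclusionErr (m := m) (N := N) hφ a)
  have hbool : ∀ N T a B ζ x, (B, Function.update ζ a (x, true)) ∈ E N T a ↔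
      (B, Function.update ζ a (x, false)) ∉ E N T a :=
    fun N T a B ζ x => oneInclusionErr_bool (state m φ B T) ζ a x
  let G : ℕ → (Cell → 𝒳 × Bool) → 𝒳 → Bool := fun n ξ x =>
    votePredict (E (n / 2) (fourthRoot n)) (fourthRoot n) (n / 2)
      (fun i j k => ξ (.inl (i, j, k))) (fun c => ξ (.inr c)) x
  have hG : ∀ n, Measurable[univMS] (Function.uncurry (G n)) := fun n =>
    measurable_votePredict (hE _ _)
      (B := fun (q : (Cell → 𝒳 × Bool) × 𝒳) i j k => q.1 (.inl (i, j, k)))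
      (ζ := fun q c => q.1 (.inr c)) (x := Prod.snd) (by fun_prop) (by fun_prop) measurable_snd
  have hdep : ∀ n ξ ξ', (∀ i ∈ batchCells n, ξ i = ξ' i) → G n ξ = G n ξ' := by
    intro n ξ ξ' hξ
    funext x
    change decide _ = decide _
    congr 3
    refine wrongPairs_congr fun i hi a ha => ?_
    have hst : state m φ (fun j k => ξ (.inl (i, j, k))) (fourthRoot n) =
        state m φ (fun j k => ξ' (.inl (i, j, k))) (fourthRoot n) :=
      state_congr fun j hj k hk l hl => hξ _ (by
        have : l < fourthRoot n := by
          have : l < k + 1 := hl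
          omega
        simp [batchCells, hi, hj, this])
    change OneInclusionErr m φ _ _ _ _ ↔ OneInclusionErr m φ _ _ _ _
    simp only [hst]
    refine oneInclusionErr_congr ha fun c hc => ?_
    by_cases hca : c = a
    · simp [hca]
    · simp only [Function.update_of_ne hca]
      exact hξ _ (by simp [batchCells, hc])
  obtain ⟨A, hA⟩ := exists_learningAlgorithm batchCells card_batchCells_le hG hdep
  refine ⟨A, fun P _ hP => ?_⟩
  obtain ⟨T₀, hT₀⟩ := exists_forall_measure_not_good_le (m := m) hφ hterm hf hP
    (ε := ENNReal.ofReal (1 / 2 ^ 32)) (by simp)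
  refine exists_linear_bound (fun n => ?_) T₀ fun n hK hK0 hN => ?_
  · rw [hA P n]
    exact prob_le_one
  · rw [hA P n]
    let Bad : Set (ℕ → ℕ → 𝒳 × Bool) := {B | ¬ (Good m φ P (state m φ B (fourthRoot n)) ∧
      (state m φ B (fourthRoot n)).1 ≤ T₀)}
    have hBad : MeasurableSet[univMS] Bad :=
      MeasurableSet.compl (measurable_univMS_univMS (measurable_state hφ (fourthRoot n))
        (t := {st | Good m φ P st ∧ st.1 ≤ T₀})
        (MeasurableSet.inter (measurableSet_good hφ) (measurable_univMS measurable_fst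
          (MeasurableSet.of_discrete (s := {k : ℕ | k ≤ T₀})))))
    have hD : ∀ B ∉ Bad, ∀ᵐ ζ ∂iid P ℕ, ((Finset.range (n / 2)).filter fun a =>
        (B, ζ) ∈ E (n / 2) (fourthRoot n) a).card ≤ 2 * T₀ := by
      intro B hB
      obtain ⟨hgood, hle⟩ := not_not.1 hB
      refine (ae_positives_mem_patternFree (N := n / 2) hφ P hgood).mono fun ζ hζ => ?_
      exact (card_oneInclusionErr_le rfl hζ).trans (Nat.mul_le_mul_left 2 hle)
    have hmain := measure_votePredict_le (M := fourthRoot n) (N := n / 2)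
      (hE (n / 2) (fourthRoot n)) (iid (iid P ℕ) ℕ) P
      (hbool _ _) hBad (hT₀ _ hK) hD hK0 hN
    refine le_trans (le_of_eq ?_) hmain
    have hS : MeasurableSet[univMS] {q : ((ℕ → ℕ → ℕ → 𝒳 × Bool) × (ℕ → 𝒳 × Bool)) × (𝒳 × Bool) |
        votePredict (E (n / 2) (fourthRoot n)) (fourthRoot n) (n / 2) q.1.1 q.1.2 q.2.1 ≠
          q.2.2} := by
      have h1 := measurable_votePredict (M := fourthRoot n) (N := n / 2)
        (hE (n / 2) (fourthRoot n))
        (B := fun q : ((ℕ → ℕ → ℕ → 𝒳 × Bool) × (ℕ → 𝒳 × Bool)) × (𝒳 × Bool) => q.1.1)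
        (ζ := fun q => q.1.2) (x := fun q => q.2.1) (by fun_prop) (by fun_prop) (by fun_prop)
      have h2 : Measurable[univMS] fun q : ((ℕ → ℕ → ℕ → 𝒳 × Bool) × (ℕ → 𝒳 × Bool)) ×
        (𝒳 × Bool) => q.2.2 := measurable_univMS (by fun_prop)
      exact (h1.prodMk h2) (MeasurableSet.of_discrete (s := {b : Bool × Bool | b.1 ≠ b.2}))
    exact ((measurePreserving_batches_sample P).prod (MeasurePreserving.id P)).measure_preimage
      (hS.nullMeasurableSet_of_univMS _)

end Linear

section Combinatorics

theorem exists_branch {Φ : List ℕ → ℕ → Prop} (h : ∀ l, ∃ u, Φ l u) :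
    ∃ c : ℕ → ℕ, ∀ k, Φ ((List.range k).map c) (c k) := by
  choose U hU using h
  let L : ℕ → List ℕ := fun k => Nat.rec [] (fun _ l => l ++ [U l]) k
  refine ⟨fun k => U (L k), fun k => ?_⟩
  have hL : (List.range k).map (fun k => U (L k)) = L k := by
    induction k with
    | zero => rfl
    | succ k ih => rw [List.range_succ, List.map_append, ih]; rfl
  rw [hL]
  exact hU _

theorem exists_le_sum_of_flip {m : ℕ} {g : ℕ → ℕ → ℝ} {a : ℝ}
    (h : ∀ u, ∀ i < m, g u i + g (u ^^^ 2 ^ i) i = a) :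
    ∃ u, m * a / 2 ≤ ∑ i ∈ Finset.range m, g u i := by
  have hsum : ∀ i < m, ∑ u ∈ Finset.range (2 ^ m), g u i = 2 ^ m * a / 2 := by
    intro i hi
    have hlt : ∀ u ∈ Finset.range (2 ^ m), u ^^^ 2 ^ i ∈ Finset.range (2 ^ m) := fun u hu =>
      Finset.mem_range.2 (Nat.xor_lt_two_pow (Finset.mem_range.1 hu)
        (Nat.pow_lt_pow_right one_lt_two hi))
    have h1 : ∑ u ∈ Finset.range (2 ^ m), g u i = ∑ u ∈ Finset.range (2 ^ m), g (u ^^^ 2 ^ i) i :=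
      Finset.sum_nbij' (fun u => u ^^^ 2 ^ i) (fun u => u ^^^ 2 ^ i) hlt hlt
        (fun u _ => by simp) (fun u _ => by simp) fun u _ => by simp
    have h2 : ∑ u ∈ Finset.range (2 ^ m), (g u i + g (u ^^^ 2 ^ i) i) = 2 ^ m * a := by
      simp [Finset.sum_congr rfl fun u _ => h u i hi]
    rw [Finset.sum_add_distrib, ← h1] at h2
    linarith
  by_contra! hlt
  have h1 : ∑ u ∈ Finset.range (2 ^ m), ∑ i ∈ Finset.range m, g u i <
      ∑ u ∈ Finset.range (2 ^ m), m * a / 2 :=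
    Finset.sum_lt_sum_of_nonempty (by simp) fun u _ => hlt u
  rw [Finset.sum_comm, Finset.sum_congr rfl fun i hi => hsum i (Finset.mem_range.1 hi)] at h1
  simp only [Finset.sum_const, Finset.card_range, nsmul_eq_mul] at h1
  push_cast at h1
  linarith

variable {𝒳 : Type*} (x : List ℕ → ℕ → 𝒳)

/-- The labelled point of a tree of points with position `p.2` in the node at depth `p.1` along
the branch `l`. -/
def treePt (l : List ℕ) (p : ℕ × ℕ) : 𝒳 × Bool :=
  (x (l.take p.1) p.2, (l.getD p.1 0).testBit p.2)

theorem treePt_map_range {c : ℕ → ℕ} {k : ℕ} {p : ℕ × ℕ} (h : p.1 < k) :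
    treePt x ((List.range k).map c) p =
      (x ((List.range p.1).map c) p.2, (c p.1).testBit p.2) := by
  simp [treePt, ← List.map_take, List.take_range, h, h.le]

theorem treePt_flip {l : List ℕ} {u i : ℕ} {p : ℕ × ℕ} (h : p.1 ≤ l.length)
    (hp : p ≠ (l.length, i)) :
    treePt x (l ++ [u ^^^ 2 ^ i]) p = treePt x (l ++ [u]) p := by
  obtain ⟨k, j⟩ := p
  simp only at h
  rcases h.lt_or_eq with h | rfl
  · simp [treePt, List.take_append_of_le_length h.le, List.getElem?_append_left h]
  · have hj : i ≠ j := fun hij => hp (by rw [hij])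
    simp [treePt, Nat.testBit_two_pow_of_ne hj]

end Combinatorics

section Masses

/-- The measure on `ℕ × ℕ` giving mass `r k - r (k + 1)` to the first `m k` points of the `k`-th
column, uniformly. -/
noncomputable def columns (m : ℕ → ℕ) (r : ℕ → ℝ) : Measure (ℕ × ℕ) :=
  Measure.sum fun k => ∑ i ∈ Finset.range (m k),
    ENNReal.ofReal ((r k - r (k + 1)) / m k) • Measure.dirac (k, i)

variable {m : ℕ → ℕ} {r : ℕ → ℝ}

theorem columns_apply (S : Set (ℕ × ℕ)) : columns m r S = ∑' k, ∑ i ∈ Finset.range (m k),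
    ENNReal.ofReal ((r k - r (k + 1)) / m k) * S.indicator 1 (k, i) := by
  rw [columns, Measure.sum_apply _ (MeasurableSet.of_discrete)]
  refine tsum_congr fun k => ?_
  rw [Measure.finsetSum_apply]
  exact Finset.sum_congr rfl fun i _ => by simp

theorem columns_singleton {k i : ℕ} (hi : i < m k) :
    columns m r {(k, i)} = ENNReal.ofReal ((r k - r (k + 1)) / m k) := by
  rw [columns_apply, tsum_eq_single k, Finset.sum_eq_single i]
  · simp
  · intro j _ hj
    simp [hj]
  · simp [hi]
  · intro k' hk
    exact Finset.sum_eq_zero fun j _ => by simp [hk]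

variable (hm : ∀ k, 0 < m k) (h0 : r 0 = 1) (hr : Antitone r)
include hm h0 hr

theorem columns_lt (K : ℕ) : columns m r {p | p.1 < K} = ENNReal.ofReal (1 - r K) := by
  rw [columns_apply, tsum_eq_sum (s := Finset.range K)]
  · rw [← h0, ← Finset.sum_range_sub', ENNReal.ofReal_sum_of_nonneg
      fun k _ => sub_nonneg.2 (hr (Nat.le_succ k))]
    refine Finset.sum_congr rfl fun k hk => ?_
    have h1 : ∀ i, ({p | p.1 < K} : Set (ℕ × ℕ)).indicator (1 : ℕ × ℕ → ℝ≥0∞) (k, i) = 1 :=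
      fun i => indicator_of_mem (by simpa using hk) _
    simp only [h1, mul_one, Finset.sum_const, Finset.card_range, nsmul_eq_mul]
    have h2 : (0 : ℝ) < m k := by exact_mod_cast hm k
    rw [← ENNReal.ofReal_natCast, ← ENNReal.ofReal_mul h2.le, mul_div_cancel₀ _ h2.ne']
  · intro k hk
    exact Finset.sum_eq_zero fun i _ => by
      rw [indicator_of_notMem (by simpa using hk), mul_zero]

theorem isProbabilityMeasure_columns (hlim : Tendsto r atTop (𝓝 0)) :
    IsProbabilityMeasure (columns m r) := by
  have h1 : Tendsto (fun K => columns m r {p | p.1 < K}) atTop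
      (𝓝 (columns m r (⋃ K, {p | p.1 < K}))) :=
    tendsto_measure_iUnion_atTop fun K K' h p hp => lt_of_lt_of_le hp h
  have h2 : (⋃ K, {p : ℕ × ℕ | p.1 < K}) = univ :=
    eq_univ_of_forall fun p => mem_iUnion.2 ⟨p.1 + 1, Nat.lt_succ_self _⟩
  simp only [columns_lt hm h0 hr, h2] at h1
  have h3 := (ENNReal.tendsto_ofReal (hlim.const_sub 1))
  rw [sub_zero, ENNReal.ofReal_one] at h3
  exact ⟨tendsto_nhds_unique h1 h3⟩

end Masses

section LowerBound

theorem measurable_learner {𝒳 : Type*} [MeasurableSpace 𝒳] (A : LearningAlgorithm 𝒳) (n : ℕ) :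
    Measurable[univMS] fun q : (Fin n → 𝒳 × Bool) × 𝒳 => A.H n q.1 q.2 :=
  universallyMeasurable_iff.1 (A.meas n)

theorem expErr_map {𝒳 Z : Type*} [MeasurableSpace 𝒳] [MeasurableSpace Z]
    (A : LearningAlgorithm 𝒳) (n : ℕ) (Q : Measure Z) [IsProbabilityMeasure Q]
    {z : Z → 𝒳 × Bool} (hz : Measurable z) :
    expErr (Q.map z) A n = ((Measure.pi fun _ : Fin n => Q).prod Q)
      {q | A.H n (fun i => z (q.1 i)) (z q.2).1 ≠ (z q.2).2} := by
  have := Measure.isProbabilityMeasure_map (μ := Q) hz.aemeasurable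
  have hS : MeasurableSet[univMS] {q : (Fin n → 𝒳 × Bool) × (𝒳 × Bool) |
      A.H n q.1 q.2.1 ≠ q.2.2} := by
    have h1 := measurable_univMS_comp (measurable_learner A n) (measurable_univMS
      (f := fun q : (Fin n → 𝒳 × Bool) × (𝒳 × Bool) => (q.1, q.2.1)) (by fun_prop))
    have h2 : Measurable[univMS] fun q : (Fin n → 𝒳 × Bool) × (𝒳 × Bool) => q.2.2 :=
      measurable_univMS (by fun_prop)
    exact (h1.prodMk h2) (MeasurableSet.of_discrete (s := {b : Bool × Bool | b.1 ≠ b.2}))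
  have h1 : MeasurePreserving z Q (Q.map z) := ⟨hz, rfl⟩
  have h2 := (measurePreserving_pi (fun _ : Fin n => Q) (fun _ => Q.map z) fun _ => h1).prod h1
  have h3 := h2.measure_preimage (hS.nullMeasurableSet_of_univMS _)
  rw [(prod_apply_univMS hS _ _).2] at h3
  exact h3.symm

variable {𝒳 Θ : Type*} [MeasurableSpace 𝒳] {f : Θ → 𝒳 → Bool} {m : ℕ → ℕ} {r : ℕ → ℝ}

theorem realizable_map_columns (hf : ∀ θ, Measurable (f θ)) {x : List ℕ → ℕ → 𝒳}
    (hx : ∀ l : List ℕ, ∃ θ, ∀ k < l.length, ∀ i < m k,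
      f θ (x (l.take k) i) = (l.getD k 0).testBit i)
    (hm : ∀ k, 0 < m k) (h0 : r 0 = 1) (hr : Antitone r) (hlim : Tendsto r atTop (𝓝 0))
    (c : ℕ → ℕ) :
    Realizable (range f) ((columns m r).map fun p => (x ((List.range p.1).map c) p.2,
      (c p.1).testBit p.2)) := by
  have := isProbabilityMeasure_columns hm h0 hr hlim
  have hle : ∀ K, (⨅ h ∈ range f, errP ((columns m r).map fun p =>
      (x ((List.range p.1).map c) p.2, (c p.1).testBit p.2)) h) ≤ ENNReal.ofReal (r K) := by
    intro K
    obtain ⟨θ, hθ⟩ := hx ((List.range K).map c)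
    refine (iInf₂_le (f θ) (mem_range_self θ)).trans ?_
    have hms : MeasurableSet {p : 𝒳 × Bool | f θ p.1 ≠ p.2} :=
      (measurableSet_eq_fun ((hf θ).comp measurable_fst) measurable_snd).compl
    rw [errP, Measure.map_apply .of_discrete hms]
    have h1 : (columns m r) ({p | p.1 < K}ᶜ) = ENNReal.ofReal (r K) := by
      have hK : r K ≤ 1 := h0 ▸ hr (Nat.zero_le K)
      rw [prob_compl_eq_one_sub .of_discrete, columns_lt hm h0 hr, ← ENNReal.ofReal_one,
        ← ENNReal.ofReal_sub _ (by linarith), sub_sub_cancel]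
    have h2 : ∀ᵐ p ∂columns m r, p.2 < m p.1 := by
      rw [ae_iff, columns_apply]
      refine ENNReal.tsum_eq_zero.2 fun k => Finset.sum_eq_zero fun i hi => ?_
      rw [indicator_of_notMem (by simpa using hi), mul_zero]
    rw [← h1]
    refine measure_mono_ae (h2.mono fun p hp hne hlt => hne ?_)
    have h3 := hθ p.1 (by simpa using hlt) p.2 hp
    rw [← List.map_take, List.take_range, min_eq_left (le_of_lt hlt)] at h3
    rw [h3]
    simp [show p.1 < K from hlt]
  have h1 : Tendsto (fun K => ENNReal.ofReal (r K)) atTop (𝓝 0) := by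
    simpa using ENNReal.tendsto_ofReal hlim
  exact le_antisymm (ge_of_tendsto' h1 hle) zero_le

/-- The samples avoiding all columns after the `k`-th one, and the `i`-th point of the `k`-th
column. -/
def avoid (n k i : ℕ) : Set (Fin n → ℕ × ℕ) :=
  Set.pi univ fun _ => {p | p.1 < k + 1} \ {(k, i)}

theorem measureReal_avoid (hm : ∀ k, 0 < m k) (h0 : r 0 = 1) (hr : Antitone r)
    (hlim : Tendsto r atTop (𝓝 0)) {n k i : ℕ} (hi : i < m k) :
    (Measure.pi fun _ : Fin n => columns m r).real (avoid n k i) =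
      (1 - r (k + 1) - (r k - r (k + 1)) / m k) ^ n := by
  have := isProbabilityMeasure_columns hm h0 hr hlim
  have hk : r (k + 1) ≤ 1 := h0 ▸ hr (Nat.zero_le _)
  have hk' : 0 ≤ r k - r (k + 1) := sub_nonneg.2 (hr (Nat.le_succ k))
  rw [avoid, measureReal_def, Measure.pi_pi, Finset.prod_const, Finset.card_univ, Fintype.card_fin,
    ENNReal.toReal_pow]
  congr 1
  rw [← measureReal_def, measureReal_sdiff (by simp) .of_discrete, measureReal_def, measureReal_def,
    columns_lt hm h0 hr, columns_singleton hi, ENNReal.toReal_ofReal (by linarith),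
    ENNReal.toReal_ofReal (by positivity)]

/-- Universal lower bound for the error of a learning algorithm, along a random branch of a tree. -/
theorem exists_realizable_le_expErr (hf : ∀ θ, Measurable (f θ)) (hT : HasTree f m)
    (hm : ∀ k, 0 < m k) (h0 : r 0 = 1) (hr : Antitone r) (hlim : Tendsto r atTop (𝓝 0))
    (n : ℕ → ℕ) (A : LearningAlgorithm 𝒳) :
    ∃ P : Measure (𝒳 × Bool), IsProbabilityMeasure P ∧ Realizable (range f) P ∧
      ∀ k, ENNReal.ofReal ((r k - r (k + 1)) / 2 *
        (1 - r (k + 1) - (r k - r (k + 1)) / m k) ^ n k) ≤ expErr P A (n k) := by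
  obtain ⟨x, hx⟩ := hT
  have := isProbabilityMeasure_columns hm h0 hr hlim
  let S : List ℕ → ℕ → ∀ k, ℕ → Set (Fin (n k) → ℕ × ℕ) := fun l u k i =>
    {s | A.H (n k) (fun j => treePt x (l ++ [u]) (s j)) (x l i) ≠ u.testBit i}
  let a : ℕ → ℝ := fun k => (1 - r (k + 1) - (r k - r (k + 1)) / m k) ^ n k
  have hflip : ∀ l u k, l.length = k → ∀ i < m k,
      (Measure.pi fun _ : Fin (n k) => columns m r).real (avoid (n k) k i ∩ S l u k i) +
      (Measure.pi fun _ : Fin (n k) => columns m r).real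
        (avoid (n k) k i ∩ S l (u ^^^ 2 ^ i) k i) = a k := by
    intro l u k hl i hi
    have h1 : avoid (n k) k i ∩ S l (u ^^^ 2 ^ i) k i = avoid (n k) k i \ S l u k i := by
      ext s
      refine and_congr_right fun hs => ?_
      have h2 : (fun j => treePt x (l ++ [u ^^^ 2 ^ i]) (s j)) =
          fun j => treePt x (l ++ [u]) (s j) := by
        funext j
        have hj := hs j (mem_univ _)
        exact treePt_flip x (hl ▸ Nat.lt_succ_iff.1 hj.1) (hl ▸ hj.2)
      change _ ≠ _ ↔ ¬ (_ ≠ _)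
      rw [h2, Nat.testBit_xor, Nat.testBit_two_pow_self]
      cases A.H (n k) (fun j => treePt x (l ++ [u]) (s j)) (x l i) <;> cases u.testBit i <;> simp
    rw [h1, measureReal_inter_add_sdiff .of_discrete, measureReal_avoid hm h0 hr hlim hi]
  obtain ⟨c, hc⟩ := exists_branch (Φ := fun l u => ∀ k, l.length = k → m k * a k / 2 ≤
      ∑ i ∈ Finset.range (m k), (Measure.pi fun _ : Fin (n k) => columns m r).real
        (avoid (n k) k i ∩ S l u k i)) fun l => by
    obtain ⟨u, hu⟩ := exists_le_sum_of_flip fun u => hflip l u _ rfl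
    exact ⟨u, by rintro k rfl; exact hu⟩
  have hz : Measurable fun p : ℕ × ℕ => (x ((List.range p.1).map c) p.2, (c p.1).testBit p.2) :=
    .of_discrete
  refine ⟨_, Measure.isProbabilityMeasure_map hz.aemeasurable,
    realizable_map_columns hf hx hm h0 hr hlim c, fun k => ?_⟩
  rw [expErr_map A (n k) _ hz, ← ofReal_measureReal]
  refine ENNReal.ofReal_le_ofReal ?_
  have hsum := hc k k (by simp)
  have hmk : (0 : ℝ) < m k := by exact_mod_cast hm k
  have hrk : 0 ≤ r k - r (k + 1) := sub_nonneg.2 (hr (Nat.le_succ k))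
  calc (r k - r (k + 1)) / 2 * a k
      = (m k * a k / 2) * ((r k - r (k + 1)) / m k) := by field_simp
    _ ≤ (∑ i ∈ Finset.range (m k), (Measure.pi fun _ : Fin (n k) => columns m r).real
        (avoid (n k) k i ∩ S ((List.range k).map c) (c k) k i)) * ((r k - r (k + 1)) / m k) := by
        gcongr
    _ = ∑ i ∈ Finset.range (m k), ((Measure.pi fun _ : Fin (n k) => columns m r).prod
        (columns m r)).real ((avoid (n k) k i ∩ S ((List.range k).map c) (c k) k i) ×ˢ
          {(k, i)}) := by
        rw [Finset.sum_mul]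
        refine Finset.sum_congr rfl fun i hi => ?_
        rw [measureReal_prod_prod, measureReal_def (columns m r),
          columns_singleton (Finset.mem_range.1 hi), ENNReal.toReal_ofReal (by positivity)]
    _ = ((Measure.pi fun _ : Fin (n k) => columns m r).prod (columns m r)).real
        (⋃ i ∈ Finset.range (m k), (avoid (n k) k i ∩ S ((List.range k).map c) (c k) k i) ×ˢ
          {(k, i)}) := by
        refine (measureReal_biUnion_finset (fun i _ j _ hij => ?_) fun i _ => .of_discrete).symm
        refine Set.disjoint_left.2 fun q hq hq' => hij ?_
        have := hq.2.symm.trans hq'.2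
        simpa using this
    _ ≤ _ := by
        refine measureReal_mono (iUnion₂_subset fun i _ => ?_)
        rintro ⟨s, p⟩ ⟨⟨hs, hS⟩, rfl⟩
        have h2 : (fun j => treePt x ((List.range k).map c ++ [c k]) (s j)) = fun j =>
            (x ((List.range (s j).1).map c) (s j).2, (c (s j).1).testBit (s j).2) := by
          funext j
          rw [← treePt_map_range x (hs j (mem_univ _)).1, List.range_succ, List.map_append]
          rfl
        have hS' := hS
        simp only [S, mem_ofPred_eq, h2] at hS'
        exact hS'

end LowerBound

section LinearLowerBound

variable {𝒳 Θ : Type*} [MeasurableSpace 𝒳] {f : Θ → 𝒳 → Bool}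

/-- Classes with an infinite Littlestone tree are not learnable faster than at a linear rate. -/
theorem notLearnableFasterThan_linear (hf : ∀ θ, Measurable (f θ)) (hT : HasTree f fun _ => 1) :
    NotLearnableFasterThan (range f) fun n => 1 / max (n : ℝ) 1 := by
  intro A
  obtain ⟨P, hP, hreal, h⟩ := exists_realizable_le_expErr (r := fun k => (1 / 2 : ℝ) ^ k) hf hT
    (fun _ => one_pos) (pow_zero _)
    (fun i j hij => pow_le_pow_of_le_one (by norm_num) (by norm_num) hij)
    (tendsto_pow_atTop_nhds_zero_of_lt_one (by norm_num) (by norm_num)) (fun k => 2 ^ k) A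
  refine ⟨P, hP, hreal, 1 / 16, by norm_num, 1, one_pos, ?_⟩
  refine Set.infinite_of_injective_forall_mem (f := fun k : ℕ => 2 ^ (k + 1))
    (fun i j hij => by simpa using hij) fun k => ?_
  refine le_trans (ENNReal.ofReal_le_ofReal ?_) (h (k + 1))
  rw [one_mul, Nat.ceil_natCast]
  have h1 : (1 : ℝ) ≤ 2 ^ (k + 1) := one_le_pow₀ (by norm_num)
  push_cast
  rw [max_eq_left h1]
  have h2 : (1 / 4 : ℝ) ≤ (1 - (1 / 2) ^ (k + 1)) ^ 2 ^ (k + 1) := by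
    have h3 := one_add_mul_le_pow (a := -(1 / 2 : ℝ) ^ (k + 1)) (by
      have : (1 / 2 : ℝ) ^ (k + 1) ≤ 1 := pow_le_one₀ (by norm_num) (by norm_num)
      linarith) (2 ^ k)
    have h4 : (2 : ℝ) ^ k * (1 / 2) ^ (k + 1) = 1 / 2 := by
      rw [pow_succ, ← mul_assoc, ← mul_pow]
      norm_num
    push_cast at h3
    rw [mul_neg, h4] at h3
    rw [pow_succ 2 k, pow_mul, sub_eq_add_neg]
    nlinarith
  calc 1 / 16 * (1 / (2 : ℝ) ^ (k + 1)) = (1 / 2) ^ (k + 1) / 4 * (1 / 4) := by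
        rw [one_div_pow]
        ring
    _ ≤ (1 / 2) ^ (k + 1) / 4 * (1 - (1 / 2) ^ (k + 1)) ^ 2 ^ (k + 1) := by gcongr
    _ = _ := by
        congr 1
        · ring
        · congr 1
          ring

end LinearLowerBound

section Slow

/-- Masses that decrease to zero along a sparse sequence of times at which they dominate the given
rate. -/
noncomputable def slowMasses (R : ℕ → ℝ) : ℕ → ℝ
  | 0 => 1
  | k + 1 => if R ((k + 1) / 4) ≤ slowMasses R k
      then min (slowMasses R k / 2) (1 / ((k : ℝ) + 1)) else slowMasses R k

variable (R : ℕ → ℝ)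

theorem slowMasses_pos (k : ℕ) : 0 < slowMasses R k := by
  induction k with
  | zero => exact one_pos
  | succ k ih =>
    rw [slowMasses]
    split_ifs
    · exact lt_min (by linarith) (by positivity)
    · exact ih

theorem antitone_slowMasses : Antitone (slowMasses R) := by
  refine antitone_nat_of_succ_le fun k => ?_
  rw [slowMasses]
  split_ifs
  · exact (min_le_left _ _).trans (by linarith [slowMasses_pos R k])
  · exact le_rfl

theorem exists_ge_le_slowMasses (hR : Tendsto R atTop (𝓝 0)) (K : ℕ) :
    ∃ k ≥ K, R ((k + 1) / 4) ≤ slowMasses R k := by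
  by_contra! h
  have hconst : ∀ k ≥ K, slowMasses R k = slowMasses R K := by
    intro k hk
    induction k, hk using Nat.le_induction with
    | base => rfl
    | succ k hk ih => rw [slowMasses, if_neg (not_le.2 (h k hk)), ih]
  obtain ⟨N, hN⟩ := (hR.eventually (eventually_lt_nhds (slowMasses_pos R K))).exists_forall_of_atTop
  have h1 := h (K + 4 * N) (by omega)
  have h2 := hN ((K + 4 * N + 1) / 4) (by omega)
  rw [hconst _ (by omega)] at h1
  linarith

theorem tendsto_slowMasses (hR : Tendsto R atTop (𝓝 0)) :
    Tendsto (slowMasses R) atTop (𝓝 0) := by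
  rw [Metric.tendsto_atTop]
  intro ε hε
  obtain ⟨K, hK⟩ := exists_nat_one_div_lt hε
  obtain ⟨k, hk, hle⟩ := exists_ge_le_slowMasses R hR K
  refine ⟨k + 1, fun j hj => ?_⟩
  rw [Real.dist_0_eq_abs, abs_of_pos (slowMasses_pos R j)]
  refine (antitone_slowMasses R hj).trans_lt ?_
  rw [slowMasses, if_pos hle]
  refine (min_le_right _ _).trans_lt (lt_of_le_of_lt ?_ hK)
  have : (K : ℝ) ≤ k := by exact_mod_cast hk
  gcongr

variable {𝒳 Θ : Type*} [MeasurableSpace 𝒳] {f : Θ → 𝒳 → Bool}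

/-- Classes with an infinite VCL tree require arbitrarily slow rates. -/
theorem requiresArbitrarilySlowRates (hf : ∀ θ, Measurable (f θ)) (hT : HasTree f fun k => k + 1) :
    RequiresArbitrarilySlowRates (range f) := by
  intro R hR A
  obtain ⟨P, hP, hreal, h⟩ := exists_realizable_le_expErr hf hT (fun k => k.succ_pos) rfl
    (antitone_slowMasses R) (tendsto_slowMasses R hR.2) (fun k => (k + 1) / 4) A
  refine ⟨P, hP, hreal, 1 / 8, by norm_num, 1, one_pos, ?_⟩
  refine Set.infinite_of_forall_exists_gt fun N => ?_
  obtain ⟨k, hk, hle⟩ := exists_ge_le_slowMasses R hR.2 (4 * N + 4)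
  refine ⟨(k + 1) / 4, ?_, by omega⟩
  refine le_trans (ENNReal.ofReal_le_ofReal ?_) (h k)
  rw [one_mul, Nat.ceil_natCast]
  have hpos := slowMasses_pos R k
  have hpos' := slowMasses_pos R (k + 1)
  have hone : slowMasses R k ≤ 1 := antitone_slowMasses R (Nat.zero_le k)
  have hs : slowMasses R (k + 1) = min (slowMasses R k / 2) (1 / ((k : ℝ) + 1)) := by
    rw [slowMasses, if_pos hle]
  have hs1 : slowMasses R (k + 1) ≤ slowMasses R k / 2 := hs ▸ min_le_left _ _
  have hs2 : slowMasses R (k + 1) ≤ 1 / ((k : ℝ) + 1) := hs ▸ min_le_right _ _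
  have hk1 : (4 : ℝ) ≤ (k : ℝ) + 1 := by
    have : (4 * N + 4 : ℝ) ≤ k := by exact_mod_cast hk
    have : (0 : ℝ) ≤ N := by positivity
    linarith
  have hdiv : (slowMasses R k - slowMasses R (k + 1)) / ((k : ℝ) + 1) ≤ 1 / ((k : ℝ) + 1) := by
    gcongr
    linarith
  set t : ℝ := slowMasses R (k + 1) + (slowMasses R k - slowMasses R (k + 1)) / ((k : ℝ) + 1)
    with ht
  have ht2 : t ≤ 2 / ((k : ℝ) + 1) := by
    calc t ≤ 1 / ((k : ℝ) + 1) + 1 / ((k : ℝ) + 1) := add_le_add hs2 hdiv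
      _ = _ := by ring
  have ht1 : t ≤ 1 / 2 := ht2.trans (by rw [div_le_div_iff₀ (by linarith) (by norm_num)]; linarith)
  have hn : (((k + 1) / 4 : ℕ) : ℝ) ≤ ((k : ℝ) + 1) / 4 := by
    have := @Nat.cast_div_le ℝ _ _ _ (k + 1) 4
    push_cast at this
    exact_mod_cast this
  have ht0 : 0 ≤ t := by
    have : 0 ≤ slowMasses R k - slowMasses R (k + 1) := by linarith
    positivity
  have hpow : (1 / 2 : ℝ) ≤ (1 - t) ^ ((k + 1) / 4) := by
    have h1 := one_add_mul_le_pow (a := -t) (by linarith) ((k + 1) / 4)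
    have h2 : (((k + 1) / 4 : ℕ) : ℝ) * t ≤ ((k : ℝ) + 1) / 4 * (2 / ((k : ℝ) + 1)) := by gcongr
    have h3 : ((k : ℝ) + 1) / 4 * (2 / ((k : ℝ) + 1)) = 1 / 2 := by field_simp; norm_num
    rw [← sub_eq_add_neg] at h1
    linarith
  calc 1 / 8 * R ((k + 1) / 4) ≤ slowMasses R k / 2 / 2 * (1 / 2) := by linarith
    _ ≤ (slowMasses R k - slowMasses R (k + 1)) / 2 * (1 - t) ^ ((k + 1) / 4) := by
        refine mul_le_mul ?_ hpow (by norm_num) ?_ <;> linarith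
    _ = _ := by
        rw [ht, ← sub_sub]
        push_cast
        rfl

end Slow

section ExponentialLowerBound

variable {𝒳 : Type*} {ℋ : Set (𝒳 → Bool)}

theorem exists_agree_disagree (h : 3 ≤ ℋ.encard) :
    ∃ h₁ ∈ ℋ, ∃ h₂ ∈ ℋ, ∃ x x', h₁ x = h₂ x ∧ h₁ x' ≠ h₂ x' := by
  obtain ⟨s, hs, hcard⟩ := exists_subset_encard_eq h
  obtain ⟨a, b, c, hab, hac, hbc, rfl⟩ := encard_eq_three.1 hcard
  have ha : a ∈ ℋ := hs (by simp)
  have hb : b ∈ ℋ := hs (by simp)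
  have hc : c ∈ ℋ := hs (by simp)
  obtain ⟨x, hx⟩ := Function.ne_iff.1 hab
  by_cases hca : c x = a x
  · obtain ⟨y, hy⟩ := Function.ne_iff.1 hac
    exact ⟨a, ha, c, hc, x, y, hca.symm, hy⟩
  · obtain ⟨y, hy⟩ := Function.ne_iff.1 hbc
    refine ⟨b, hb, c, hc, x, y, ?_, hy⟩
    revert hx hca
    cases a x <;> cases b x <;> cases c x <;> simp

/-- The fair coin on the two booleans. -/
noncomputable def coin : Measure Bool :=
  (2⁻¹ : ℝ≥0∞) • (Measure.dirac true + Measure.dirac false)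

theorem coin_singleton (b : Bool) : coin {b} = 2⁻¹ := by
  cases b <;> simp [coin]

instance : IsProbabilityMeasure coin :=
  ⟨by simpa [coin] using ENNReal.inv_two_add_inv_two⟩

variable [MeasurableSpace 𝒳]

theorem le_expErr_map_coin (A : LearningAlgorithm 𝒳) (n : ℕ) {z z' : 𝒳 × Bool}
    (h : A.H n (fun _ => z) z'.1 ≠ z'.2) :
    ENNReal.ofReal ((1 / 2) ^ (n + 1)) ≤ expErr (coin.map fun b => bif b then z else z') A n := by
  rw [expErr_map A n _ .of_discrete]
  have h1 : ({fun _ => true} ×ˢ {false} : Set ((Fin n → Bool) × Bool)) ⊆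
      {q | A.H n (fun i => bif q.1 i then z else z') (bif q.2 then z else z').1 ≠
        (bif q.2 then z else z').2} := by
    rintro ⟨s, b⟩ ⟨rfl, rfl⟩
    exact h
  refine le_trans (le_of_eq ?_) (measure_mono h1)
  rw [Measure.prod_prod, coin_singleton, ← univ_pi_singleton, Measure.pi_pi]
  simp only [coin_singleton, Finset.prod_const, Finset.card_univ, Fintype.card_fin]
  rw [← pow_succ, ENNReal.ofReal_pow (by norm_num), one_div, ENNReal.ofReal_inv_of_pos two_pos,
    ENNReal.ofReal_ofNat]

theorem realizable_map_coin {h : 𝒳 → Bool} (hh : h ∈ ℋ) (hm : Measurable h) (x x' : 𝒳) :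
    Realizable ℋ (coin.map fun b => bif b then (x, h x) else (x', h x')) := by
  refine le_antisymm ((iInf₂_le h hh).trans (le_of_eq ?_)) zero_le
  have hms : MeasurableSet {p : 𝒳 × Bool | h p.1 ≠ p.2} :=
    (measurableSet_eq_fun (hm.comp measurable_fst) measurable_snd).compl
  rw [errP, Measure.map_apply .of_discrete hms]
  convert measure_empty (μ := coin)
  ext b
  cases b <;> simp

/-- Classes with at least three concepts are not learnable faster than at an exponential rate. -/
theorem notLearnableFasterThan_exp (hm : ∀ h ∈ ℋ, Measurable h) (hcard : 3 ≤ ℋ.encard) :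
    NotLearnableFasterThan ℋ fun n => Real.exp (-(n : ℝ)) := by
  intro A
  obtain ⟨h₁, hh₁, h₂, hh₂, x, x', hx, hx'⟩ := exists_agree_disagree hcard
  have hexp : ∀ n : ℕ, ENNReal.ofReal (1 / 2 * Real.exp (-((⌈1 * (n : ℝ)⌉₊ : ℕ) : ℝ))) ≤
      ENNReal.ofReal ((1 / 2) ^ (n + 1)) := by
    intro n
    refine ENNReal.ofReal_le_ofReal ?_
    have h1 : Real.exp (-1) ≤ 1 / 2 := by
      rw [Real.exp_neg, one_div]
      have := Real.add_one_le_exp 1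
      exact inv_anti₀ two_pos (by linarith)
    rw [one_mul, Nat.ceil_natCast, pow_succ', show -(n : ℝ) = n * (-1) by ring, Real.exp_nat_mul]
    gcongr
  have key : ∀ h ∈ ℋ, h x = h₁ x →
      {n | A.H n (fun _ => (x, h₁ x)) x' ≠ h x'}.Infinite →
      ∃ P : Measure (𝒳 × Bool), IsProbabilityMeasure P ∧ Realizable ℋ P ∧ ∃ C > (0 : ℝ),
        ∃ c > (0 : ℝ), {n : ℕ | ENNReal.ofReal (C * Real.exp (-((⌈c * (n : ℝ)⌉₊ : ℕ) : ℝ))) ≤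
          expErr P A n}.Infinite := by
    intro h hh hhx hinf
    refine ⟨_, Measure.isProbabilityMeasure_map (Measurable.of_discrete).aemeasurable,
      realizable_map_coin hh (hm h hh) x x', 1 / 2, by norm_num, 1, one_pos, ?_⟩
    refine hinf.mono fun n hn => (hexp n).trans (le_expErr_map_coin A n ?_)
    rw [hhx]
    exact hn
  have hunion : {n | A.H n (fun _ => (x, h₁ x)) x' ≠ h₁ x'} ∪
      {n | A.H n (fun _ => (x, h₁ x)) x' ≠ h₂ x'} = univ := by
    refine eq_univ_of_forall fun n => ?_
    by_contra hn
    simp only [mem_union, mem_ofPred_eq, not_or, not_not] at hn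
    exact hx' (hn.1.symm.trans hn.2)
  rcases infinite_union.1 (hunion ▸ infinite_univ) with hinf | hinf
  · exact key h₁ hh₁ rfl hinf
  · exact key h₂ hh₂ hx.symm hinf

end ExponentialLowerBound

section Comparison

variable {𝒳 : Type*} [MeasurableSpace 𝒳] {ℋ : Set (𝒳 → Bool)} {R R' : ℕ → ℝ}

theorem LearnableAtRate.not_notLearnableFasterThan (h : LearnableAtRate ℋ R) (hR' : ∀ n, 0 < R' n)
    (hlim : ∀ c > 0, ∀ c' > 0, Tendsto (fun n : ℕ => R ⌈c * (n : ℝ)⌉₊ / R' ⌈c' * (n : ℝ)⌉₊) atTop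
      (𝓝 0)) : ¬ NotLearnableFasterThan ℋ R' := by
  intro h'
  obtain ⟨A, hA⟩ := h
  obtain ⟨P, hP, hreal, C', hC', c', hc', hinf⟩ := h' A
  obtain ⟨C, hC, c, hc, hle⟩ := hA P hP hreal
  have h1 := (hlim c hc c' hc').eventually (eventually_lt_nhds (div_pos hC' hC))
  obtain ⟨n, hn, hlt⟩ := ((Nat.frequently_atTop_iff_infinite.2 hinf).and_eventually h1).exists
  rw [div_lt_div_iff₀ (hR' _) hC] at hlt
  have h2 : ENNReal.ofReal (C' * R' ⌈c' * (n : ℝ)⌉₊) ≤ ENNReal.ofReal (C * R ⌈c * (n : ℝ)⌉₊) :=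
    le_trans hn (hle n)
  refine absurd h2 (not_le.2 ?_)
  exact (ENNReal.ofReal_lt_ofReal_iff (mul_pos hC' (hR' _))).2 (by linarith)

theorem not_notLearnableFasterThan_linear (h : LearnableAtRate ℋ fun n => Real.exp (-(n : ℝ))) :
    ¬ NotLearnableFasterThan ℋ fun n => 1 / max (n : ℝ) 1 := by
  refine LearnableAtRate.not_notLearnableFasterThan h (fun n => by positivity) fun c hc c' hc' => ?_
  have h1 : Tendsto (fun n : ℕ => c * (n : ℝ)) atTop atTop :=
    tendsto_natCast_atTop_atTop.const_mul_atTop hc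
  have h2 : Tendsto (fun n : ℕ => c' / c * ((c * (n : ℝ)) ^ 1 * Real.exp (-(c * (n : ℝ)))) +
      Real.exp (-(c * (n : ℝ)))) atTop (𝓝 (c' / c * 0 + 0)) :=
    (((Real.tendsto_pow_mul_exp_neg_atTop_nhds_zero 1).comp h1).const_mul _).add
      (Real.tendsto_exp_neg_atTop_nhds_zero.comp h1)
  rw [mul_zero, add_zero] at h2
  refine squeeze_zero (fun n => by positivity) (fun n => ?_) h2
  have h3 : (⌈c' * (n : ℝ)⌉₊ : ℝ) ≤ c' * n + 1 := (Nat.ceil_lt_add_one (by positivity)).le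
  have h4 : max (⌈c' * (n : ℝ)⌉₊ : ℝ) 1 ≤ c' * n + 1 := max_le h3 (by
    have : 0 ≤ c' * (n : ℝ) := by positivity
    linarith)
  rw [div_div_eq_mul_div, div_one]
  calc Real.exp (-(⌈c * (n : ℝ)⌉₊ : ℝ)) * max (⌈c' * (n : ℝ)⌉₊ : ℝ) 1
      ≤ Real.exp (-(c * (n : ℝ))) * (c' * n + 1) := by
        gcongr
        exact Nat.le_ceil _
    _ = _ := by field_simp

theorem isRate_linear : IsRate fun n => 1 / max (n : ℝ) 1 := by
  refine ⟨fun n => ⟨by positivity, ?_⟩, ?_⟩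
  · rw [div_le_one (by positivity)]
    exact le_max_right _ _
  · refine tendsto_one_div_atTop_nhds_zero_nat.congr' ?_
    filter_upwards [eventually_ge_atTop 1] with n hn
    rw [max_eq_left (by exact_mod_cast hn)]

theorem not_requiresArbitrarilySlowRates (h : LearnableAtRate ℋ fun n => 1 / max (n : ℝ) 1) :
    ¬ RequiresArbitrarilySlowRates ℋ := by
  intro h'
  have hrate : IsRate fun n => Real.sqrt (1 / max (n : ℝ) 1) :=
    ⟨fun n => ⟨Real.sqrt_nonneg _, Real.sqrt_le_one.2 (isRate_linear.1 n).2⟩, by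
      simpa using isRate_linear.2.sqrt⟩
  refine LearnableAtRate.not_notLearnableFasterThan h (fun n => by positivity)
    (fun c hc c' hc' => ?_) (h' _ hrate)
  have h1 : Tendsto (fun n : ℕ => Real.sqrt (c' + 1) / c * Real.sqrt (1 / max (n : ℝ) 1)) atTop
      (𝓝 (Real.sqrt (c' + 1) / c * 0)) := hrate.2.const_mul _
  rw [mul_zero] at h1
  refine squeeze_zero' (Eventually.of_forall fun n => by positivity) ?_ h1
  filter_upwards [eventually_ge_atTop 1] with n hn
  have hn1 : (1 : ℝ) ≤ n := by exact_mod_cast hn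
  have h3 : (⌈c' * (n : ℝ)⌉₊ : ℝ) ≤ c' * n + 1 := (Nat.ceil_lt_add_one (by positivity)).le
  have h4 : max (⌈c' * (n : ℝ)⌉₊ : ℝ) 1 ≤ (c' + 1) * n := max_le (by nlinarith) (by nlinarith)
  have h5 : c * n ≤ max (⌈c * (n : ℝ)⌉₊ : ℝ) 1 := (Nat.le_ceil _).trans (le_max_left _ _)
  rw [max_eq_left hn1, one_div, one_div, one_div, Real.sqrt_inv, Real.sqrt_inv, div_inv_eq_mul]
  have hs : Real.sqrt n * Real.sqrt n = n := Real.mul_self_sqrt (by linarith)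
  have hs0 : 0 < Real.sqrt n := Real.sqrt_pos.2 (by linarith)
  calc _ ≤ (c * n)⁻¹ * Real.sqrt ((c' + 1) * n) := by gcongr
    _ = (c * (Real.sqrt n * Real.sqrt n))⁻¹ * (Real.sqrt (c' + 1) * Real.sqrt n) := by
        rw [hs, Real.sqrt_mul (by positivity)]
    _ = _ := by field_simp

end Comparison

end UniversalLearning

/-- **Theorem 1.6 (trichotomy of universal learning rates).** For every measurable concept class
`ℋ` on a Polish space with `|ℋ| ≥ 3`, exactly one of the following holds: `ℋ` is learnable with
optimal rate `e^{-n}`; `ℋ` is learnable with optimal rate `1/max(n,1)`; `ℋ` requires arbitrarily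
slow rates. -/
theorem universal_learning_trichotomy
    (𝒳 : Type*) [TopologicalSpace 𝒳] [PolishSpace 𝒳] [MeasurableSpace 𝒳] [BorelSpace 𝒳]
    (ℋ : Set (𝒳 → Bool)) (hmeas : MeasurableClass 𝒳 ℋ) (hcard : 3 ≤ ℋ.encard) :
    (LearnableWithOptimalRate ℋ (fun n => Real.exp (-(n : ℝ))) ∧
        ¬ LearnableWithOptimalRate ℋ (fun n => 1 / max (n : ℝ) 1) ∧
        ¬ RequiresArbitrarilySlowRates ℋ) ∨
      (¬ LearnableWithOptimalRate ℋ (fun n => Real.exp (-(n : ℝ))) ∧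
        LearnableWithOptimalRate ℋ (fun n => 1 / max (n : ℝ) 1) ∧
        ¬ RequiresArbitrarilySlowRates ℋ) ∨
      (¬ LearnableWithOptimalRate ℋ (fun n => Real.exp (-(n : ℝ))) ∧
        ¬ LearnableWithOptimalRate ℋ (fun n => 1 / max (n : ℝ) 1) ∧
        RequiresArbitrarilySlowRates ℋ) := by
  open UniversalLearning in
  obtain ⟨⟨Θ, f, hf, rfl⟩⟩ := hmeas
  obtain ⟨h₁, ⟨θ, rfl⟩, -, -, x, -⟩ := exists_agree_disagree hcard
  have : Inhabited 𝒳 := ⟨x⟩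
  have : Nonempty Θ := ⟨θ⟩
  have hfm : ∀ θ, Measurable (f θ) := fun θ => hf.comp measurable_prodMk_left
  by_cases hV : HasTree f fun k => k + 1
  · have hslow := requiresArbitrarilySlowRates hfm hV
    exact .inr (.inr ⟨fun h => not_notLearnableFasterThan_linear h.1 (hslow _ isRate_linear),
      fun h => not_requiresArbitrarilySlowRates h.1 hslow, hslow⟩)
  have hlin := learnableAtRate_linear hf hV
  have hfast := not_requiresArbitrarilySlowRates hlin
  by_cases hL : HasTree f fun _ => 1
  · have hlow := notLearnableFasterThan_linear hfm hL
    exact .inr (.inl ⟨fun h => not_notLearnableFasterThan_linear h.1 hlow, ⟨hlin, hlow⟩, hfast⟩)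
  · have hexp := learnableAtRate_exp hf hL
    exact .inl ⟨⟨hexp, notLearnableFasterThan_exp (Set.forall_mem_range.2 hfm) hcard⟩,
      fun h => not_notLearnableFasterThan_linear hexp h.2, hfast⟩
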